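/- The set S = { k ∈ ℕ : for every 3-dimensional empty lattice tetrahedron Δ, the dilate kΔ has a unimodular triangulation with standard boundary } is closed under addition: if k₁ ∈ S and k₂ ∈ S then k₁ + k₂ ∈ S. -/

import Mathlib

open Pointwise

/-- The real point associated to an integer point of `ℤ³`. -/
def rcast (x : Fin 3 → ℤ) : Fin 3 → ℝ := fun i => (x i : ℝ)

/-- `v` is (the vertex tuple of) an empty lattice tetrahedron in `ℝ³`:
affinely independent, and the only integer points in its convex hull are its
four vertices. -/
def IsEmptyTetra (v : Fin 4 → Fin 3 → ℤ) : Prop :=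
  AffineIndependent ℝ (fun i => rcast (v i)) ∧
  ∀ x : Fin 3 → ℤ, rcast x ∈ convexHull ℝ (Set.range fun i => rcast (v i)) → ∃ i, x = v i

/-- The convex hull in `ℝ³` of a tuple of integer points. -/
def simplexHull (s : Fin 4 → Fin 3 → ℤ) : Set (Fin 3 → ℝ) :=
  convexHull ℝ (Set.range fun i => rcast (s i))

/-- `kΔ` has a unimodular triangulation with standard boundary: a finite family of
lattice tetrahedra covering `kΔ`, each of normalized volume one, any two of which
meet in the convex hull of their common vertices, and such that every edge of a
tetrahedron of the triangulation lying in the boundary of `kΔ` is parallel to an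
edge of `Δ`. -/
def HasUnimodTriangStdBdry (k : ℕ) (v : Fin 4 → Fin 3 → ℤ) : Prop :=
  ∃ T : Finset (Fin 4 → Fin 3 → ℤ),
    (⋃ s ∈ T, simplexHull s) = (k : ℝ) • simplexHull v ∧
    (∀ s ∈ T, (Matrix.det (Matrix.of fun i j : Fin 3 => s i.succ j - s 0 j)).natAbs = 1) ∧
    (∀ s ∈ T, ∀ s' ∈ T,
      simplexHull s ∩ simplexHull s' = convexHull ℝ (rcast '' (Set.range s ∩ Set.range s'))) ∧
    (∀ s ∈ T, ∀ i j : Fin 4, i ≠ j →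
      segment ℝ (rcast (s i)) (rcast (s j)) ⊆ frontier ((k : ℝ) • simplexHull v) →
      ∃ (a b : Fin 4) (c : ℝ), a ≠ b ∧ rcast (s j) - rcast (s i) = c • (rcast (v b) - rcast (v a)))

/-- Real-valued affine functions, in the elementary two-point form. -/
def IsAff {E : Type*} [AddCommGroup E] [Module ℝ E] (h : E → ℝ) : Prop :=
  ∀ (x y : E) (a b : ℝ), a + b = 1 → h (a • x + b • y) = a * h x + b * h y

/-- The convex hulls of two point sets meet in the convex hull of the common points. -/
def Proper {E : Type*} [AddCommGroup E] [Module ℝ E] (V W : Set E) : Prop :=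
  convexHull ℝ V ∩ convexHull ℝ W ⊆ convexHull ℝ (V ∩ W)

section Hulls

variable {E : Type*} [AddCommGroup E] [Module ℝ E]

theorem IsAff.neg {h : E → ℝ} (hh : IsAff h) : IsAff (fun x => - h x) := by
  intro x y a b hab
  simp only [hh x y a b hab]; ring

theorem IsAff.add {h g : E → ℝ} (hh : IsAff h) (hg : IsAff g) : IsAff (fun x => h x + g x) := by
  intro x y a b hab
  simp only [hh x y a b hab, hg x y a b hab]; ring

theorem isAff_const (c : ℝ) : IsAff (fun _ : E => c) := by
  intro x y a b hab
  rw [← add_mul, hab, one_mul]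

theorem IsAff.sum {ι : Type*} (s : Finset ι) {h : ι → E → ℝ} (hh : ∀ i, IsAff (h i)) :
    IsAff (fun x => ∑ i ∈ s, h i x) := by
  classical
  induction s using Finset.induction_on with
  | empty => simpa using isAff_const (E := E) 0
  | insert a s ha ih =>
    have := (hh a).add ih
    simpa [Finset.sum_insert ha] using this

theorem IsAff.le_of_mem_hull {h : E → ℝ} (hh : IsAff h) {V : Set E} {c : ℝ}
    (hV : ∀ v ∈ V, c ≤ h v) {x : E} (hx : x ∈ convexHull ℝ V) : c ≤ h x := by
  have hc : Convex ℝ {y : E | c ≤ h y} := by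
    intro y hy z hz a b ha hb hab
    simp only [Set.mem_ofPred_eq] at hy hz ⊢
    rw [hh y z a b hab]
    have : c = a * c + b * c := by rw [← add_mul, hab, one_mul]
    rw [this]; gcongr
  exact convexHull_min hV hc hx

theorem IsAff.ge_of_mem_hull {h : E → ℝ} (hh : IsAff h) {V : Set E} {c : ℝ}
    (hV : ∀ v ∈ V, h v ≤ c) {x : E} (hx : x ∈ convexHull ℝ V) : h x ≤ c := by
  have := hh.neg.le_of_mem_hull (V := V) (c := -c) (fun v hv => by simpa using hV v hv) hx
  simpa using this

theorem IsAff.eq_of_mem_hull {h : E → ℝ} (hh : IsAff h) {V : Set E} {c : ℝ}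
    (hV : ∀ v ∈ V, h v = c) {x : E} (hx : x ∈ convexHull ℝ V) : h x = c :=
  le_antisymm (hh.ge_of_mem_hull (fun v hv => (hV v hv).le) hx)
    (hh.le_of_mem_hull (fun v hv => (hV v hv).ge) hx)

/-- A point of a hull on a supporting hyperplane is in the hull of the points on it. -/
theorem IsAff.mem_hull_face {h : E → ℝ} (hh : IsAff h) {V : Set E} (hV : ∀ v ∈ V, 0 ≤ h v)
    {x : E} (hx : x ∈ convexHull ℝ V) (h0 : h x = 0) :
    x ∈ convexHull ℝ {v ∈ V | h v = 0} := by
  set V0 := {v ∈ V | h v = 0}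
  have hz : ∀ y ∈ convexHull ℝ V0, h y = 0 := fun y hy =>
    hh.eq_of_mem_hull (fun v hv => hv.2) hy
  have hc : Convex ℝ {y : E | 0 < h y ∨ y ∈ convexHull ℝ V0} := by
    intro y hy z hz' a b ha hb hab
    simp only [Set.mem_ofPred_eq] at hy hz' ⊢
    rcases eq_or_lt_of_le ha with rfl | ha
    · obtain rfl : b = 1 := by linarith
      simpa using hz'
    rcases eq_or_lt_of_le hb with rfl | hb
    · obtain rfl : a = 1 := by linarith
      simpa using hy
    rw [hh y z a b hab]
    rcases hy with hy | hy <;> rcases hz' with hz' | hz'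
    · left; positivity
    · left; rw [hz z hz']; simp [mul_pos ha hy]
    · left; rw [hz y hy]; simp [mul_pos hb hz']
    · right; exact convex_convexHull ℝ V0 hy hz' ha.le hb.le hab
  have hsub : V ⊆ {y : E | 0 < h y ∨ y ∈ convexHull ℝ V0} := by
    intro v hv
    rcases eq_or_lt_of_le (hV v hv) with h1 | h1
    · exact Or.inr (subset_convexHull ℝ V0 ⟨hv, h1.symm⟩)
    · exact Or.inl h1
  rcases convexHull_min hsub hc hx with h1 | h1
  · rw [h0] at h1; exact absurd h1 (lt_irrefl _)
  · exact h1

theorem IsAff.mem_hull_face' {h : E → ℝ} (hh : IsAff h) {V : Set E} (hV : ∀ v ∈ V, h v ≤ 0)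
    {x : E} (hx : x ∈ convexHull ℝ V) (h0 : h x = 0) :
    x ∈ convexHull ℝ {v ∈ V | h v = 0} := by
  have := hh.neg.mem_hull_face (V := V) (fun v hv => by simpa using hV v hv) hx (by simpa using h0)
  simpa using this

theorem Proper.symm {V W : Set E} (h : Proper V W) : Proper W V := by
  intro x hx
  rw [Set.inter_comm]
  exact h ⟨hx.2, hx.1⟩

theorem proper_of_subset {V W : Set E} (h : V ⊆ W) : Proper V W := by
  intro x hx
  rw [Set.inter_eq_left.2 h]
  exact hx.1

theorem proper_self (V : Set E) : Proper V V := proper_of_subset subset_rfl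

/-- Two point sets separated by a hyperplane are proper as soon as their traces on it are. -/
theorem Proper.of_sep {V W : Set E} {h : E → ℝ} (hh : IsAff h) (hV : ∀ v ∈ V, h v ≤ 0)
    (hW : ∀ w ∈ W, 0 ≤ h w) (hp : Proper {v ∈ V | h v = 0} {w ∈ W | h w = 0}) :
    Proper V W := by
  intro x hx
  have h0 : h x = 0 :=
    le_antisymm (hh.ge_of_mem_hull hV hx.1) (hh.le_of_mem_hull hW hx.2)
  have h1 := hp ⟨hh.mem_hull_face' hV hx.1 h0, hh.mem_hull_face hW hx.2 h0⟩
  refine convexHull_mono ?_ h1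
  rintro y ⟨⟨hy, -⟩, hy', -⟩
  exact ⟨hy, hy'⟩

theorem proper_of_subsingleton {V W : Set E} {p : E} (hV : V ⊆ {p}) (hW : W ⊆ {p}) :
    Proper V W := by
  rcases Set.subset_singleton_iff_eq.1 hV with rfl | rfl
  · exact proper_of_subset (Set.empty_subset _)
  · rcases Set.subset_singleton_iff_eq.1 hW with rfl | rfl
    · exact (proper_of_subset (Set.empty_subset _)).symm
    · exact proper_self _

/-- Points of `V` outside `W` can be discarded if some supporting function detects them. -/
theorem mem_hull_of_prune {V W : Set E} (hfin : V.Finite) {x : E} (hx : x ∈ convexHull ℝ V)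
    (h : ∀ p ∈ V, p ∉ W → ∃ f : E → ℝ, IsAff f ∧ (∀ v ∈ V, 0 ≤ f v) ∧ 0 < f p ∧ f x = 0) :
    x ∈ convexHull ℝ (V ∩ W) := by
  classical
  have h' : ∀ p : E, ∃ f : E → ℝ, IsAff f ∧ (∀ v ∈ V, 0 ≤ f v) ∧ (p ∈ V → p ∉ W → 0 < f p) ∧
      f x = 0 := by
    intro p
    by_cases hp : p ∈ V ∧ p ∉ W
    · obtain ⟨f, h1, h2, h3, h4⟩ := h p hp.1 hp.2
      exact ⟨f, h1, h2, fun _ _ => h3, h4⟩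
    · exact ⟨fun _ => 0, isAff_const 0, fun _ _ => le_rfl, fun a b => absurd ⟨a, b⟩ hp, rfl⟩
  choose f h1 h2 h3 h4 using h'
  have haff : IsAff (fun y => ∑ p ∈ hfin.toFinset, f p y) := IsAff.sum _ h1
  have := haff.mem_hull_face (V := V) (fun v hv => Finset.sum_nonneg fun p _ => h2 p v hv) hx
    (Finset.sum_eq_zero fun p _ => h4 p)
  refine convexHull_mono ?_ this
  rintro v ⟨hv, hv0⟩
  refine ⟨hv, ?_⟩
  by_contra hW
  have h5 := (Finset.sum_eq_zero_iff_of_nonneg (fun p _ => h2 p v hv)).1 hv0 v (by simpa using hv)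
  exact absurd h5 (h3 v hv hW).ne'

theorem proper_of_separating {V W : Set E} (hfin : V.Finite)
    (h : ∀ p ∈ V, p ∉ W → ∃ f : E → ℝ, IsAff f ∧ (∀ v ∈ V, 0 ≤ f v) ∧ 0 < f p ∧
      ∀ w ∈ W, f w = 0) : Proper V W := by
  intro x hx
  refine mem_hull_of_prune hfin hx.1 fun p hp hpW => ?_
  obtain ⟨f, h1, h2, h3, h4⟩ := h p hp hpW
  exact ⟨f, h1, h2, h3, h1.eq_of_mem_hull h4 hx.2⟩

theorem proper_of_subset_pair {V W : Set E} {a b : E} {f : E → ℝ} (hf : IsAff f) (ha : f a = 0)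
    (hb : f b = 1) (hV : V ⊆ {a, b}) (hW : W ⊆ {a, b}) : Proper V W := by
  refine proper_of_separating ((Set.toFinite {a, b}).subset hV) fun p hp hpW => ?_
  rcases hV hp with rfl | rfl
  · refine ⟨fun x => 1 + - f x, (isAff_const 1).add hf.neg, ?_, by simp [ha], ?_⟩
    · intro v hv; rcases hV hv with rfl | rfl <;> simp [ha, hb]
    · intro w hw; rcases hW hw with rfl | rfl
      · exact absurd hw hpW
      · simp [hb]
  · refine ⟨f, hf, ?_, by simp [hb], ?_⟩
    · intro v hv; rcases hV hv with rfl | rfl <;> simp [ha, hb]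
    · intro w hw; rcases hW hw with rfl | rfl
      · exact ha
      · exact absurd hw hpW

end Hulls

section Alcoves

variable {E : Type*}

/-- `f` takes at most the two consecutive integer values `m`, `m + 1` on `V`. -/
def InSlab (f : E → ℝ) (V : Set E) (m : ℤ) : Prop := ∀ v ∈ V, f v = m ∨ f v = m + 1

theorem exists_inSlab {f : E → ℝ} {V : Set E} (hint : ∀ v ∈ V, ∃ m : ℤ, f v = m)
    (hd : ∀ v ∈ V, ∀ w ∈ V, f v - f w ≤ 1) : ∃ m, InSlab f V m := by
  rcases V.eq_empty_or_nonempty with rfl | ⟨v0, hv0⟩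
  · exact ⟨0, by simp [InSlab]⟩
  obtain ⟨m0, hm0⟩ := hint v0 hv0
  by_cases h : ∃ v ∈ V, f v = m0 - 1
  · obtain ⟨v1, hv1, h1⟩ := h
    refine ⟨m0 - 1, fun v hv => ?_⟩
    obtain ⟨m, hm⟩ := hint v hv
    have a1 := hd v hv v1 hv1
    have a2 := hd v0 hv0 v hv
    rw [hm, hm0] at *
    rw [h1] at a1
    have b1 : m ≤ m0 := by
      have : (m : ℝ) ≤ m0 := by linarith
      exact_mod_cast this
    have b2 : m0 - 1 ≤ m := by
      have : (m0 : ℝ) - 1 ≤ m := by linarith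
      exact_mod_cast this
    have : m = m0 - 1 ∨ m = m0 := by omega
    rcases this with rfl | rfl
    · left; rfl
    · right; push_cast; ring
  · refine ⟨m0, fun v hv => ?_⟩
    obtain ⟨m, hm⟩ := hint v hv
    have a1 := hd v hv v0 hv0
    have a2 := hd v0 hv0 v hv
    have a3 : m ≠ m0 - 1 := fun e => h ⟨v, hv, by rw [hm, e]; push_cast; ring⟩
    rw [hm, hm0] at a1 a2
    rw [hm]
    have b1 : m ≤ m0 + 1 := by
      have : (m : ℝ) ≤ m0 + 1 := by linarith
      exact_mod_cast this
    have b2 : m0 ≤ m + 1 := by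
      have : (m0 : ℝ) ≤ m + 1 := by linarith
      exact_mod_cast this
    have : m = m0 ∨ m = m0 + 1 := by omega
    rcases this with rfl | rfl
    · left; rfl
    · right; push_cast; ring

variable [AddCommGroup E] [Module ℝ E]

theorem Proper.of_common_slab {f : E → ℝ} (hf : IsAff f) {V W : Set E} {m m' : ℤ}
    (hV : InSlab f V m) (hW : InSlab f W m')
    (h : ∀ V1 ⊆ V, ∀ W1 ⊆ W, ∀ n, InSlab f V1 n → InSlab f W1 n → Proper V1 W1) :
    Proper V W := by
  have key : ∀ {V W : Set E} {m m' : ℤ}, InSlab f V m → InSlab f W m' → m < m' →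
      (∀ V1 ⊆ V, ∀ W1 ⊆ W, ∀ n, InSlab f V1 n → InSlab f W1 n → Proper V1 W1) →
      Proper V W := by
    intro V W m m' hV hW hlt h
    have hlt' : (m : ℝ) + 1 ≤ m' := by exact_mod_cast hlt
    refine Proper.of_sep (h := fun x => f x + -((m : ℝ) + 1)) (hf.add (isAff_const _)) ?_ ?_ ?_
    · intro v hv; rcases hV v hv with e | e <;> rw [e] <;> linarith
    · intro v hv; rcases hW v hv with e | e <;> rw [e] <;> linarith
    · refine h _ (fun v hv => hv.1) _ (fun v hv => hv.1) (m + 1) ?_ ?_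
      · intro v hv; left; have := hv.2; push_cast; linarith
      · intro v hv; left; have := hv.2; push_cast; linarith
  rcases lt_trichotomy m m' with hlt | rfl | hlt
  · exact key hV hW hlt h
  · exact h V subset_rfl W subset_rfl m hV hW
  · exact (key hW hV hlt fun W1 hW1 V1 hV1 n a b => (h V1 hV1 W1 hW1 n b a).symm).symm

/-- Point sets in a plane on which three integral functions with constant sum vary by at most
one are faces of one triangulation of that plane. -/
theorem proper_of_alcove {f g h : E → ℝ} (hf : IsAff f) (hg : IsAff g) (hh : IsAff h)
    {V W : Set E} (hfin : V.Finite)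
    (hint : ∀ v ∈ V ∪ W, (∃ m : ℤ, f v = m) ∧ (∃ m : ℤ, g v = m) ∧ ∃ m : ℤ, h v = m)
    (hV : ∀ v ∈ V, ∀ w ∈ V, f v - f w ≤ 1 ∧ g v - g w ≤ 1 ∧ h v - h w ≤ 1)
    (hW : ∀ v ∈ W, ∀ w ∈ W, f v - f w ≤ 1 ∧ g v - g w ≤ 1 ∧ h v - h w ≤ 1)
    {κ : ℤ} (hsum : ∀ v ∈ V ∪ W, f v + g v + h v = κ)
    (hinj : ∀ v ∈ V ∪ W, ∀ w ∈ V ∪ W, f v = f w → g v = g w → h v = h w → v = w) :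
    Proper V W := by
  obtain ⟨a1, b1⟩ := exists_inSlab (fun v hv => (hint v (Or.inl hv)).1)
    (fun v hv w hw => (hV v hv w hw).1)
  obtain ⟨a2, b2⟩ := exists_inSlab (fun v hv => (hint v (Or.inl hv)).2.1)
    (fun v hv w hw => (hV v hv w hw).2.1)
  obtain ⟨a3, b3⟩ := exists_inSlab (fun v hv => (hint v (Or.inl hv)).2.2)
    (fun v hv w hw => (hV v hv w hw).2.2)
  obtain ⟨c1, d1⟩ := exists_inSlab (fun v hv => (hint v (Or.inr hv)).1)
    (fun v hv w hw => (hW v hv w hw).1)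
  obtain ⟨c2, d2⟩ := exists_inSlab (fun v hv => (hint v (Or.inr hv)).2.1)
    (fun v hv w hw => (hW v hv w hw).2.1)
  obtain ⟨c3, d3⟩ := exists_inSlab (fun v hv => (hint v (Or.inr hv)).2.2)
    (fun v hv w hw => (hW v hv w hw).2.2)
  refine Proper.of_common_slab hf b1 d1 fun V1 hV1 W1 hW1 n1 e1 e1' => ?_
  refine Proper.of_common_slab hg (m := a2) (m' := c2) (fun v hv => b2 v (hV1 hv))
    (fun v hv => d2 v (hW1 hv)) fun V2 hV2 W2 hW2 n2 e2 e2' => ?_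
  refine Proper.of_common_slab hh (m := a3) (m' := c3) (fun v hv => b3 v (hV1 (hV2 hv)))
    (fun v hv => d3 v (hW1 (hW2 hv))) fun V3 hV3 W3 hW3 n3 e3 e3' => ?_
  have sV : V3 ⊆ V := fun v hv => hV1 (hV2 (hV3 hv))
  have sW : W3 ⊆ W := fun v hv => hW1 (hW2 (hW3 hv))
  have bit : ∀ v ∈ V3 ∪ W3, (f v = n1 ∨ f v = n1 + 1) ∧ (g v = n2 ∨ g v = n2 + 1) ∧
      (h v = n3 ∨ h v = n3 + 1) ∧ f v + g v + h v = κ := by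
    rintro v (hv | hv)
    · exact ⟨e1 v (hV2 (hV3 hv)), e2 v (hV3 hv), e3 v hv, hsum v (Or.inl (sV hv))⟩
    · exact ⟨e1' v (hW2 (hW3 hv)), e2' v (hW3 hv), e3' v hv, hsum v (Or.inr (sW hv))⟩
  have inj : ∀ v ∈ V3, ∀ w ∈ W3, v ∉ W3 → f v = f w → g v = g w → h v = h w → False := by
    intro v hv w hw hvW x y z
    have := hinj v (Or.inl (sV hv)) w (Or.inr (sW hw)) x y z
    exact hvW (this ▸ hw)
  refine proper_of_separating (hfin.subset sV) fun p hp hpW => ?_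
  have bp := bit p (Or.inl hp)
  by_cases hκ : (κ : ℝ) - n1 - n2 - n3 = 1
  · have hz : ∀ {u : E → ℝ} {n : ℤ}, IsAff u → u p = n + 1 →
        (∀ v ∈ V3 ∪ W3, u v = n ∨ u v = n + 1) → (∀ w ∈ W3, u w ≠ n + 1) →
        ∃ u : E → ℝ, IsAff u ∧ (∀ v ∈ V3, 0 ≤ u v) ∧ 0 < u p ∧ ∀ w ∈ W3, u w = 0 := by
      intro u n hu hup huv huw
      refine ⟨fun x => u x + -(n : ℝ), hu.add (isAff_const _), ?_, by simp [hup], ?_⟩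
      · intro v hv; rcases huv v (Or.inl hv) with e | e <;> simp [e]
      · intro w hw; rcases huv w (Or.inr hw) with e | e
        · simp [e]
        · exact absurd e (huw w hw)
    have pick : f p = n1 + 1 ∨ g p = n2 + 1 ∨ h p = n3 + 1 := by
      by_contra hcon
      push Not at hcon
      obtain ⟨x, y, z, s⟩ := bp
      have := x.resolve_right hcon.1
      have := y.resolve_right hcon.2.1
      have := z.resolve_right hcon.2.2
      linarith
    rcases pick with e | e | e
    · refine hz hf e (fun v hv => (bit v hv).1) fun w hw e' => ?_
      obtain ⟨-, y, z, s⟩ := bp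
      obtain ⟨-, y', z', s'⟩ := bit w (Or.inr hw)
      refine inj p hp w hw hpW (by linarith) ?_ ?_ <;>
      rcases y with y | y <;> rcases z with z | z <;> rcases y' with y' | y' <;>
        rcases z' with z' | z' <;> linarith
    · refine hz hg e (fun v hv => (bit v hv).2.1) fun w hw e' => ?_
      obtain ⟨y, -, z, s⟩ := bp
      obtain ⟨y', -, z', s'⟩ := bit w (Or.inr hw)
      refine inj p hp w hw hpW ?_ (by linarith) ?_ <;>
      rcases y with y | y <;> rcases z with z | z <;> rcases y' with y' | y' <;>
        rcases z' with z' | z' <;> linarith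
    · refine hz hh e (fun v hv => (bit v hv).2.2.1) fun w hw e' => ?_
      obtain ⟨y, z, -, s⟩ := bp
      obtain ⟨y', z', -, s'⟩ := bit w (Or.inr hw)
      refine inj p hp w hw hpW ?_ ?_ (by linarith) <;>
      rcases y with y | y <;> rcases z with z | z <;> rcases y' with y' | y' <;>
        rcases z' with z' | z' <;> linarith
  by_cases hκ2 : (κ : ℝ) - n1 - n2 - n3 = 2
  · have hz : ∀ {u : E → ℝ} {n : ℤ}, IsAff u → u p = n →
        (∀ v ∈ V3 ∪ W3, u v = n ∨ u v = n + 1) → (∀ w ∈ W3, u w ≠ n) →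
        ∃ u : E → ℝ, IsAff u ∧ (∀ v ∈ V3, 0 ≤ u v) ∧ 0 < u p ∧ ∀ w ∈ W3, u w = 0 := by
      intro u n hu hup huv huw
      refine ⟨fun x => (n + 1 : ℝ) + -u x, (isAff_const _).add hu.neg, ?_, by simp [hup], ?_⟩
      · intro v hv; rcases huv v (Or.inl hv) with e | e <;> simp [e]
      · intro w hw; rcases huv w (Or.inr hw) with e | e
        · exact absurd e (huw w hw)
        · simp [e]
    have pick : f p = n1 ∨ g p = n2 ∨ h p = n3 := by
      by_contra hcon
      push Not at hcon
      obtain ⟨x, y, z, s⟩ := bp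
      have := x.resolve_left hcon.1
      have := y.resolve_left hcon.2.1
      have := z.resolve_left hcon.2.2
      linarith
    rcases pick with e | e | e
    · refine hz hf e (fun v hv => (bit v hv).1) fun w hw e' => ?_
      obtain ⟨-, y, z, s⟩ := bp
      obtain ⟨-, y', z', s'⟩ := bit w (Or.inr hw)
      refine inj p hp w hw hpW (by linarith) ?_ ?_ <;>
      rcases y with y | y <;> rcases z with z | z <;> rcases y' with y' | y' <;>
        rcases z' with z' | z' <;> linarith
    · refine hz hg e (fun v hv => (bit v hv).2.1) fun w hw e' => ?_
      obtain ⟨y, -, z, s⟩ := bp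
      obtain ⟨y', -, z', s'⟩ := bit w (Or.inr hw)
      refine inj p hp w hw hpW ?_ (by linarith) ?_ <;>
      rcases y with y | y <;> rcases z with z | z <;> rcases y' with y' | y' <;>
        rcases z' with z' | z' <;> linarith
    · refine hz hh e (fun v hv => (bit v hv).2.2.1) fun w hw e' => ?_
      obtain ⟨y, z, -, s⟩ := bp
      obtain ⟨y', z', -, s'⟩ := bit w (Or.inr hw)
      refine inj p hp w hw hpW ?_ ?_ (by linarith) <;>
      rcases y with y | y <;> rcases z with z | z <;> rcases y' with y' | y' <;>
        rcases z' with z' | z' <;> linarith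
  · refine ⟨fun _ => 1, isAff_const 1, fun _ _ => zero_le_one, one_pos, fun w hw => ?_⟩
    exfalso
    have all : ∀ v ∈ V3 ∪ W3, (f v = n1 ∧ g v = n2 ∧ h v = n3 ∧ (κ : ℝ) - n1 - n2 - n3 = 0) ∨
        (f v = n1 + 1 ∧ g v = n2 + 1 ∧ h v = n3 + 1 ∧ (κ : ℝ) - n1 - n2 - n3 = 3) := by
      intro v hv
      obtain ⟨x, y, z, s⟩ := bit v hv
      rcases x with x | x <;> rcases y with y | y <;> rcases z with z | z <;> rw [x, y, z] at s
      on_goal 1 => exact Or.inl ⟨x, y, z, by linarith⟩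
      on_goal 7 => exact Or.inr ⟨x, y, z, by linarith⟩
      all_goals
        first
        | exact absurd (by linarith) hκ
        | exact absurd (by linarith) hκ2
    rcases all p (Or.inl hp) with ⟨x, y, z, s⟩ | ⟨x, y, z, s⟩ <;>
      rcases all w (Or.inr hw) with ⟨x', y', z', s'⟩ | ⟨x', y', z', s'⟩ <;>
      first
      | linarith
      | exact inj p hp w hw hpW (by rw [x, x']) (by rw [y, y']) (by rw [z, z'])

end Alcoves

theorem IsAff.mem_hull_image_face {ι E : Type*} [AddCommGroup E] [Module ℝ E] {h : E → ℝ}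
    (hh : IsAff h) {φ : ι → E} {F G : Set ι} {x : E} (hF : ∀ v ∈ F, 0 ≤ h (φ v))
    (hx : x ∈ convexHull ℝ (φ '' F)) (h0 : h x = 0) (hG : ∀ v ∈ F, h (φ v) = 0 → v ∈ G) :
    x ∈ convexHull ℝ (φ '' G) := by
  have := hh.mem_hull_face (V := φ '' F) (by rintro _ ⟨v, hv, rfl⟩; exact hF v hv) hx h0
  refine convexHull_mono ?_ this
  rintro _ ⟨⟨v, hv, rfl⟩, hv0⟩
  exact ⟨v, hG v hv hv0, rfl⟩

theorem IsAff.le_of_mem_hull_image {ι E : Type*} [AddCommGroup E] [Module ℝ E] {h : E → ℝ}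
    (hh : IsAff h) {φ : ι → E} {F : Set ι} {x : E} {c : ℝ} (hF : ∀ v ∈ F, c ≤ h (φ v))
    (hx : x ∈ convexHull ℝ (φ '' F)) : c ≤ h x :=
  hh.le_of_mem_hull (by rintro _ ⟨v, hv, rfl⟩; exact hF v hv) hx

/-- Variant of `Proper.of_sep` for images. -/
theorem Proper.image_of_sep {ι E : Type*} [AddCommGroup E] [Module ℝ E] {φ : ι → E} {V W : Set ι}
    {h : E → ℝ} (hh : IsAff h) (hV : ∀ v ∈ V, h (φ v) ≤ 0) (hW : ∀ w ∈ W, 0 ≤ h (φ w))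
    (hp : Proper (φ '' {v ∈ V | h (φ v) = 0}) (φ '' {w ∈ W | h (φ w) = 0})) :
    Proper (φ '' V) (φ '' W) := by
  refine Proper.of_sep hh (by rintro _ ⟨v, hv, rfl⟩; exact hV v hv)
    (by rintro _ ⟨v, hv, rfl⟩; exact hW v hv) ?_
  convert hp using 1 <;> ext y <;> constructor
  all_goals
    first
    | (rintro ⟨⟨v, hv, rfl⟩, h0⟩; exact ⟨v, ⟨hv, h0⟩, rfl⟩)
    | (rintro ⟨v, ⟨hv, h0⟩, rfl⟩; exact ⟨⟨v, hv, rfl⟩, h0⟩)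

section Plane

/-- The real point associated to an integer point of `ℤ²`. -/
def rcast₂ (P : ℤ × ℤ) : ℝ × ℝ := ((P.1 : ℝ), (P.2 : ℝ))

theorem rcast₂_injective : Function.Injective rcast₂ := by
  intro P Q h
  simp only [rcast₂, Prod.mk.injEq, Int.cast_inj] at h
  exact Prod.ext h.1 h.2

theorem isAff_plane (α β γ : ℝ) : IsAff (fun P : ℝ × ℝ => α * P.1 + β * P.2 + γ) := by
  intro x y a b hab
  simp only [Prod.fst_add, Prod.snd_add, Prod.smul_fst, Prod.smul_snd, smul_eq_mul]
  linear_combination (-γ) * hab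

/-- The convex hull of integer points of the plane. -/
def hull₂ (F : Set (ℤ × ℤ)) : Set (ℝ × ℝ) := convexHull ℝ (rcast₂ '' F)

/-- Piecewise linear interpolation of an integer sequence. -/
noncomputable def interp (g : ℤ → ℤ) (X : ℝ) : ℝ :=
  g ⌊X⌋ + Int.fract X * (g (⌊X⌋ + 1) - g ⌊X⌋)

theorem interp_eq (g : ℤ → ℤ) {X : ℝ} {x : ℤ} (h0 : (x : ℝ) ≤ X) (h1 : X ≤ x + 1) :
    interp g X = g x + (X - x) * (g (x + 1) - g x) := by
  rcases eq_or_lt_of_le h1 with rfl | h1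
  · have : ⌊(x : ℝ) + 1⌋ = x + 1 := by
      rw [Int.floor_eq_iff]; push_cast; constructor <;> linarith
    simp [interp, this, Int.fract]
  · have : ⌊X⌋ = x := by rw [Int.floor_eq_iff]; exact ⟨h0, h1⟩
    simp [interp, this, Int.fract]

/-- `F` lies on one side of the graph of `interp g` (below for `σ = 1`, above for `σ = -1`) and
touches it only along faces lying on single edges of the graph. -/
def Side (σ : ℝ) (g : ℤ → ℤ) (F : Set (ℤ × ℤ)) : Prop :=
  ∀ P ∈ hull₂ F, σ * P.2 ≤ σ * interp g P.1 ∧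
    (P.2 = interp g P.1 →
      P ∈ hull₂ (F ∩ {(⌊P.1⌋, g ⌊P.1⌋), (⌊P.1⌋ + 1, g (⌊P.1⌋ + 1))}))

theorem proper_pair (x y y' : ℤ) {F F' : Set (ℤ × ℤ)} (hF : F ⊆ {(x, y), (x + 1, y')})
    (hF' : F' ⊆ {(x, y), (x + 1, y')}) : Proper (rcast₂ '' F) (rcast₂ '' F') := by
  refine proper_of_subset_pair (a := rcast₂ (x, y)) (b := rcast₂ (x + 1, y'))
    (isAff_plane 1 0 (-x)) (by simp [rcast₂]) (by simp [rcast₂]) ?_ ?_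
  · rw [← Set.image_pair]; exact Set.image_mono hF
  · rw [← Set.image_pair]; exact Set.image_mono hF'

theorem Side.proper {g : ℤ → ℤ} {F F' : Set (ℤ × ℤ)} (h : Side 1 g F) (h' : Side (-1) g F') :
    Proper (rcast₂ '' F) (rcast₂ '' F') := by
  rintro P ⟨hP, hP'⟩
  obtain ⟨a, b⟩ := h P hP
  obtain ⟨a', b'⟩ := h' P hP'
  have e : P.2 = interp g P.1 := by linarith
  have := proper_pair ⌊P.1⌋ (g ⌊P.1⌋) (g (⌊P.1⌋ + 1)) Set.inter_subset_right
    Set.inter_subset_right ⟨b e, b' e⟩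
  exact convexHull_mono (Set.inter_subset_inter (Set.image_mono Set.inter_subset_left)
    (Set.image_mono Set.inter_subset_left)) this

theorem Side.le {g : ℤ → ℤ} {F F' : Set (ℤ × ℤ)} (h : Side 1 g F) (h' : Side (-1) g F')
    {P P' : ℝ × ℝ} (hP : P ∈ hull₂ F) (hP' : P' ∈ hull₂ F') (e : P.1 = P'.1) : P.2 ≤ P'.2 := by
  have a := (h P hP).1
  have b := (h' P' hP').1
  rw [e] at a
  linarith

theorem Side.mono {σ : ℝ} {g g' : ℤ → ℤ} {F : Set (ℤ × ℤ)} (hσ : σ = 1 ∨ σ = -1)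
    (hg : ∀ x, σ * g x ≤ σ * g' x) (h : Side σ g F) : Side σ g' F := by
  intro P hP
  obtain ⟨a, b⟩ := h P hP
  have h1 := hg ⌊P.1⌋
  have h2 := hg (⌊P.1⌋ + 1)
  have h3 := Int.fract_nonneg P.1
  have h4 := Int.fract_lt_one P.1
  have key : σ * interp g' P.1 - σ * interp g P.1 =
      (1 - Int.fract P.1) * (σ * g' ⌊P.1⌋ - σ * g ⌊P.1⌋) +
        Int.fract P.1 * (σ * g' (⌊P.1⌋ + 1) - σ * g (⌊P.1⌋ + 1)) := by
    unfold interp; ring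
  have k1 : 0 ≤ (1 - Int.fract P.1) * (σ * g' ⌊P.1⌋ - σ * g ⌊P.1⌋) :=
    mul_nonneg (by linarith) (by linarith)
  have k2 : 0 ≤ Int.fract P.1 * (σ * g' (⌊P.1⌋ + 1) - σ * g (⌊P.1⌋ + 1)) :=
    mul_nonneg h3 (by linarith)
  have σ0 : σ ≠ 0 := by rcases hσ with rfl | rfl <;> norm_num
  refine ⟨by linarith, fun e => ?_⟩
  rw [e] at a
  have e' : P.2 = interp g P.1 := by
    rw [e]
    have : σ * interp g' P.1 = σ * interp g P.1 := by linarith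
    exact mul_left_cancel₀ σ0 this
  have hm := b e'
  have z1 : (1 - Int.fract P.1) * (σ * g' ⌊P.1⌋ - σ * g ⌊P.1⌋) = 0 := by linarith
  have z2 : Int.fract P.1 * (σ * g' (⌊P.1⌋ + 1) - σ * g (⌊P.1⌋ + 1)) = 0 := by linarith
  have w1 : g ⌊P.1⌋ = g' ⌊P.1⌋ := by
    rcases mul_eq_zero.1 z1 with h | h
    · linarith
    · have := mul_left_cancel₀ σ0 (sub_eq_zero.1 h)
      exact_mod_cast this.symm
  rcases mul_eq_zero.1 z2 with hf | hf
  · have hP1 : P.1 = ⌊P.1⌋ := by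
      have := Int.floor_add_fract P.1
      rw [hf, add_zero] at this; exact this.symm
    refine (isAff_plane 1 0 (-⌊P.1⌋)).mem_hull_image_face ?_ hm (by linarith) ?_
    · rintro v ⟨-, rfl | rfl⟩ <;> simp [rcast₂]
    · rintro v ⟨hv, rfl | rfl⟩ hv0
      · exact ⟨hv, Or.inl (by rw [w1])⟩
      · simp [rcast₂] at hv0
  · have w2 : g (⌊P.1⌋ + 1) = g' (⌊P.1⌋ + 1) := by
      have := mul_left_cancel₀ σ0 (sub_eq_zero.1 hf)
      exact_mod_cast this.symm
    rw [← w1, ← w2]; exact hm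

/-- Points over two consecutive abscissae, all on one side of the graph. -/
theorem side_strip {σ : ℝ} (hσ : σ = 1 ∨ σ = -1) {g : ℤ → ℤ} {F : Set (ℤ × ℤ)} (x : ℤ)
    (hF : ∀ v ∈ F, (v.1 = x ∨ v.1 = x + 1) ∧ σ * v.2 ≤ σ * g v.1) : Side σ g F := by
  intro P hP
  have σ0 : σ ≠ 0 := by rcases hσ with rfl | rfl <;> norm_num
  have l0 : (x : ℝ) ≤ P.1 := by
    have := (isAff_plane 1 0 0).le_of_mem_hull_image (c := x) ?_ hP
    · linarith
    · intro v hv; rcases (hF v hv).1 with e | e <;> simp [rcast₂, e]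
  have l1 : P.1 ≤ x + 1 := by
    have := (isAff_plane (-1) 0 0).le_of_mem_hull_image (c := -(x + 1)) ?_ hP
    · linarith
    · intro v hv; rcases (hF v hv).1 with e | e <;> simp [rcast₂, e]
  have hline := isAff_plane (σ * (g (x + 1) - g x)) (-σ) (σ * (g x - x * (g (x + 1) - g x)))
  have hpos : ∀ v ∈ F, 0 ≤ σ * (g (x + 1) - g x) * (rcast₂ v).1 + (-σ) * (rcast₂ v).2 +
      σ * (g x - x * (g (x + 1) - g x)) := by
    rintro ⟨v1, v2⟩ hv
    obtain ⟨e | e, h⟩ := hF _ hv <;> simp only at e <;> subst e <;>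
      simp only [rcast₂] at h ⊢ <;> push_cast <;> nlinarith
  have hle := hline.le_of_mem_hull_image hpos hP
  rw [interp_eq g l0 l1]
  refine ⟨by linarith, fun e => ?_⟩
  have hm := hline.mem_hull_image_face (G := F ∩ {(x, g x), (x + 1, g (x + 1))}) hpos hP
    (by rw [e]; ring) (by
      rintro ⟨v1, v2⟩ hv h0
      refine ⟨hv, ?_⟩
      have key : ∀ u w : ℝ, σ * u = σ * w → u = w := fun u w => mul_left_cancel₀ σ0
      obtain ⟨h | h, -⟩ := hF _ hv <;> simp only at h <;> subst h <;> simp only [rcast₂] at h0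
      · left
        have : (v2 : ℝ) = g v1 := key _ _ (by linarith)
        rw [show v2 = g v1 by exact_mod_cast this]
      · right
        have : (v2 : ℝ) = g (x + 1) := key _ _ (by push_cast at h0; linarith)
        rw [show v2 = g (x + 1) by exact_mod_cast this]; rfl)
  rcases eq_or_lt_of_le l1 with l1 | l1
  · have fl : ⌊P.1⌋ = x + 1 := by rw [l1, Int.floor_eq_iff]; push_cast; constructor <;> linarith
    rw [fl]
    refine (isAff_plane (-1) 0 (x + 1)).mem_hull_image_face ?_ hm (by linarith) ?_
    · rintro v ⟨-, rfl | rfl⟩ <;> simp [rcast₂]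
    · rintro v ⟨hv, rfl | rfl⟩ hv0
      · simp [rcast₂] at hv0
      · exact ⟨hv, Or.inl rfl⟩
  · have fl : ⌊P.1⌋ = x := by rw [Int.floor_eq_iff]; exact ⟨l0, l1⟩
    rw [fl]; exact hm

end Plane

section Caps

/-- The signed height of the point `(x, y)` over the line `q * y = p * x + c`. -/
def height (σ q p c x y : ℤ) : ℤ := σ * (q * y - p * x - c)

/-- A lattice path `g` from one end of a lattice segment to the other, staying as close as
possible to it. -/
structure ClosePath (σ q p c : ℤ) (g : ℤ → ℤ) : Prop where
  sign : σ = 1 ∨ σ = -1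
  left : height σ q p c 0 (g 0) = 0
  right : height σ q p c q (g q) = 0
  inner : ∀ x, 0 < x → x < q → 0 < height σ q p c x (g x) ∧ height σ q p c x (g x) < q
  inj : ∀ x x', 0 < x → x < q → 0 < x' → x' < q →
    height σ q p c x (g x) = height σ q p c x' (g x') → x = x'

/-- `j` is the unique minimum of `a` in the open interval `(i, k)`, and both ends are lower. -/
structure CapTri (q : ℤ) (a : ℤ → ℤ) (i j k : ℤ) : Prop where
  nonneg : 0 ≤ i
  lt_left : i < j
  lt_right : j < k
  le : k ≤ q
  low_left : a i < a j
  low_right : a k < a j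
  min : ∀ x, i < x → x < k → x ≠ j → a j < a x

/-- The signed height of `x` over the chord of `a` from `m` to `n`, times `n - m`. -/
def overChord (a : ℤ → ℤ) (m n x : ℤ) : ℤ := (n - m) * (a x - a m) - (a n - a m) * (x - m)

/-- The real version of `overChord` for the heights along `g`. -/
def overChordR (σ q p c : ℤ) (g : ℤ → ℤ) (m n : ℤ) (P : ℝ × ℝ) : ℝ :=
  (n - m) * (σ * (q * P.2 - p * P.1 - c) - height σ q p c m (g m)) -
    (height σ q p c n (g n) - height σ q p c m (g m)) * (P.1 - m)

theorem isAff_overChordR (σ q p c : ℤ) (g : ℤ → ℤ) (m n : ℤ) :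
    IsAff (overChordR σ q p c g m n) := by
  intro x y a b hab
  obtain rfl : b = 1 - a := by linarith
  simp only [overChordR, Prod.fst_add, Prod.snd_add, Prod.smul_fst, Prod.smul_snd, smul_eq_mul]
  ring

theorem overChordR_cast (σ q p c : ℤ) (g : ℤ → ℤ) (m n x : ℤ) :
    overChordR σ q p c g m n (rcast₂ (x, g x)) =
      overChord (fun x => height σ q p c x (g x)) m n x := by
  simp only [overChordR, overChord, rcast₂, height]; push_cast; ring

/-- The vertices of the triangle on three points of the path `g`. -/
def pathTri (g : ℤ → ℤ) (i j k : ℤ) : Set (ℤ × ℤ) := {(i, g i), (j, g j), (k, g k)}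

theorem side_of_chord {σ q p c : ℤ} (hq : 0 < q) {g : ℤ → ℤ} {m n : ℤ}
    (hmn : m < n)
    {F : Set (ℤ × ℤ)} (hF : ∀ v ∈ F, overChordR σ q p c g m n (rcast₂ v) ≤ 0 ∧
      (overChordR σ q p c g m n (rcast₂ v) = 0 → v = (m, g m) ∨ v = (n, g n)))
    (hg : ∀ x, m < x → x < n → 0 < overChord (fun x => height σ q p c x (g x)) m n x)
    {P : ℝ × ℝ} (hP : P ∈ hull₂ F) (h0 : (m : ℝ) ≤ P.1) (h1 : P.1 ≤ n) :
    (σ : ℝ) * P.2 ≤ σ * interp g P.1 ∧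
    (P.2 = interp g P.1 →
      P ∈ hull₂ (F ∩ {(⌊P.1⌋, g ⌊P.1⌋), (⌊P.1⌋ + 1, g (⌊P.1⌋ + 1))})) := by
  set a : ℤ → ℤ := fun x => height σ q p c x (g x) with ha
  have hm0 : overChord a m n m = 0 := by simp [overChord]
  have hn0 : overChord a m n n = 0 := by simp only [overChord]; ring
  have hge : ∀ x, m ≤ x → x ≤ n → 0 ≤ overChord a m n x := by
    intro x hx hx'
    rcases eq_or_lt_of_le hx with rfl | hx
    · exact hm0.ge
    rcases eq_or_lt_of_le hx' with rfl | hx'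
    · exact hn0.ge
    exact (hg x hx hx').le
  have hP0 : overChordR σ q p c g m n P ≤ 0 := by
    have := (isAff_overChordR σ q p c g m n).neg.le_of_mem_hull_image (c := 0)
      (fun v hv => by simpa using (hF v hv).1) hP
    linarith
  have hface : overChordR σ q p c g m n P = 0 → P ∈ hull₂ (F ∩ {(m, g m), (n, g n)}) := fun h =>
    (isAff_overChordR σ q p c g m n).neg.mem_hull_image_face
      (fun v hv => by simpa using (hF v hv).1) hP (by simpa using h)
      (fun v hv hv0 => ⟨hv, (hF v hv).2 (by simpa using hv0)⟩)
  obtain ⟨N, hN⟩ : ∃ N, N = ⌊P.1⌋ := ⟨_, rfl⟩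
  obtain ⟨t, ht⟩ : ∃ t, t = Int.fract P.1 := ⟨_, rfl⟩
  have ht0 : 0 ≤ t := ht ▸ Int.fract_nonneg _
  have ht1 : t < 1 := ht ▸ Int.fract_lt_one _
  have hX : P.1 = N + t := by rw [hN, ht, Int.floor_add_fract]
  have hmN : m ≤ N := by rw [hN]; exact Int.le_floor.2 h0
  have hNn : N ≤ n := by
    have : (N : ℝ) ≤ n := by linarith
    exact_mod_cast this
  have hNn' : 0 < t → N + 1 ≤ n := by
    intro h
    have : (N : ℝ) < n := by linarith
    have : N < n := by exact_mod_cast this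
    omega
  have hint : interp g P.1 = g N + t * (g (N + 1) - g N) := by rw [interp, ← hN, ← ht]
  have key : overChordR σ q p c g m n P = (n - m) * q * (σ * P.2 - σ * interp g P.1) +
      (1 - t) * overChord a m n N + t * overChord a m n (N + 1) := by
    rw [hint]
    simp only [overChordR, overChord, hX, ha, height]
    push_cast; ring
  have k1 : 0 ≤ (1 - t) * overChord a m n N :=
    mul_nonneg (by linarith) (by exact_mod_cast hge N hmN hNn)
  have k2 : 0 ≤ t * overChord a m n (N + 1) := by
    rcases eq_or_lt_of_le ht0 with h | h
    · rw [← h, zero_mul]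
    · exact mul_nonneg ht0 (by exact_mod_cast hge (N + 1) (by omega) (hNn' h))
  have hpos : (0 : ℝ) < (n - m) * q := by
    have : (m : ℝ) < n := by exact_mod_cast hmn
    have : (0 : ℝ) < q := by exact_mod_cast hq
    nlinarith
  refine ⟨?_, fun e => ?_⟩
  · by_contra hcon
    push Not at hcon
    have := mul_pos hpos (sub_pos.2 hcon)
    linarith
  · rw [e, sub_self, mul_zero, zero_add] at key
    have hP0' : overChordR σ q p c g m n P = 0 := by linarith
    have hm := hface hP0'
    rw [← hN]
    have z1 : overChord a m n N = 0 := by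
      have : (1 - t) * overChord a m n N = 0 := by linarith
      rcases mul_eq_zero.1 this with h | h
      · linarith
      · exact_mod_cast h
    have N1 : N = m ∨ N = n := by
      by_contra hcon
      push Not at hcon
      exact absurd z1 (hg N (lt_of_le_of_ne hmN hcon.1.symm) (lt_of_le_of_ne hNn hcon.2)).ne'
    rcases eq_or_lt_of_le ht0 with h | h
    · rw [← h, add_zero] at hX
      rcases N1 with rfl | rfl
      · refine (isAff_plane 1 0 (-N)).mem_hull_image_face ?_ hm (by linarith) ?_
        · rintro v ⟨-, rfl | rfl⟩
          · simp [rcast₂]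
          · have : (N : ℝ) ≤ n := by exact_mod_cast hmn.le
            simpa [rcast₂] using this
        · rintro v ⟨hv, rfl | rfl⟩ hv0
          · exact ⟨hv, Or.inl rfl⟩
          · have : (N : ℝ) < n := by exact_mod_cast hmn
            simp [rcast₂] at hv0; linarith
      · refine (isAff_plane (-1) 0 N).mem_hull_image_face ?_ hm (by linarith) ?_
        · rintro v ⟨-, rfl | rfl⟩
          · have : (m : ℝ) ≤ N := by exact_mod_cast hmn.le
            simpa [rcast₂] using this
          · simp [rcast₂]
        · rintro v ⟨hv, rfl | rfl⟩ hv0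
          · have : (m : ℝ) < N := by exact_mod_cast hmn
            simp [rcast₂] at hv0; linarith
          · exact ⟨hv, Or.inl rfl⟩
    · have hNn' := hNn' h
      obtain rfl : N = m := by omega
      have z2 : overChord a N n (N + 1) = 0 := by
        have : t * overChord a N n (N + 1) = 0 := by linarith
        rcases mul_eq_zero.1 this with h | h
        · linarith
        · exact_mod_cast h
      have N2 : n = N + 1 := by
        by_contra hcon
        exact absurd z2 (hg (N + 1) (by omega) (by omega)).ne'
      rw [← N2]; exact hm

variable {q p c σ : ℤ} {g : ℤ → ℤ}

theorem ClosePath.bounds (h : ClosePath σ q p c g) (hq : 0 < q) {x : ℤ} (h0 : 0 ≤ x) (h1 : x ≤ q) :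
    0 ≤ height σ q p c x (g x) ∧ height σ q p c x (g x) < q := by
  rcases eq_or_lt_of_le h0 with rfl | h0
  · rw [h.left]; exact ⟨le_rfl, hq⟩
  rcases eq_or_lt_of_le h1 with rfl | h1
  · rw [h.right]; exact ⟨le_rfl, hq⟩
  exact ⟨(h.inner x h0 h1).1.le, (h.inner x h0 h1).2⟩

theorem CapTri.chord_left {a : ℤ → ℤ} {i j k : ℤ} (h : CapTri q a i j k) {x : ℤ} (h0 : i < x)
    (h1 : x < j) : 0 < overChord a i j x := by
  have h2 := h.min x h0 (h1.trans h.lt_right) h1.ne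
  have h3 := h.low_left
  unfold overChord
  nlinarith [mul_pos (sub_pos.2 h3) (sub_pos.2 h1), mul_pos (sub_pos.2 h2) (sub_pos.2 h.lt_left)]

theorem CapTri.chord_right {a : ℤ → ℤ} {i j k : ℤ} (h : CapTri q a i j k) {x : ℤ} (h0 : j < x)
    (h1 : x < k) : 0 < overChord a j k x := by
  have h2 := h.min x (h.lt_left.trans h0) h1 h0.ne'
  have h3 := h.low_right
  unfold overChord
  nlinarith [mul_pos (sub_pos.2 h3) (sub_pos.2 h0), mul_pos (sub_pos.2 h2) (sub_pos.2 h.lt_right)]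

theorem CapTri.chord_left_neg {a : ℤ → ℤ} {i j k : ℤ} (h : CapTri q a i j k) :
    overChord a i j k < 0 := by
  have h2 := h.low_left
  have h3 := h.low_right
  unfold overChord
  nlinarith [mul_pos (sub_pos.2 h2) (sub_pos.2 h.lt_right),
    mul_pos (sub_pos.2 h3) (sub_pos.2 h.lt_left)]

theorem CapTri.chord_right_neg {a : ℤ → ℤ} {i j k : ℤ} (h : CapTri q a i j k) :
    overChord a j k i < 0 := by
  have h2 := h.low_left
  have h3 := h.low_right
  unfold overChord
  nlinarith [mul_pos (sub_pos.2 h2) (sub_pos.2 h.lt_right),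
    mul_pos (sub_pos.2 h3) (sub_pos.2 h.lt_left)]

theorem overChord_self_left (a : ℤ → ℤ) (m n : ℤ) : overChord a m n m = 0 := by simp [overChord]

theorem overChord_self_right (a : ℤ → ℤ) (m n : ℤ) : overChord a m n n = 0 := by
  simp only [overChord]; ring

theorem CapTri.side (hq : 0 < q) {i j k : ℤ}
    (h : CapTri q (fun x => height σ q p c x (g x)) i j k) : Side σ g (pathTri g i j k) := by
  intro P hP
  have hij : (i : ℝ) < j := by exact_mod_cast h.lt_left
  have hjk : (j : ℝ) < k := by exact_mod_cast h.lt_right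
  rcases le_total P.1 j with hX | hX
  · refine side_of_chord hq h.lt_left ?_ (fun x => h.chord_left) hP ?_ hX
    · rintro v (rfl | rfl | rfl) <;> rw [overChordR_cast]
      · simp [overChord_self_left]
      · simp [overChord_self_right]
      · have := h.chord_left_neg
        refine ⟨by exact_mod_cast this.le, fun h0 => ?_⟩
        have h0' := Int.cast_eq_zero.1 h0
        omega
    · have := (isAff_plane 1 0 0).le_of_mem_hull_image (c := i) ?_ hP
      · linarith
      · rintro v (rfl | rfl | rfl) <;> simp [rcast₂] <;>
          exact_mod_cast (by have := h.lt_left; have := h.lt_right; omega)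
  · refine side_of_chord hq h.lt_right ?_ (fun x => h.chord_right) hP hX ?_
    · rintro v (rfl | rfl | rfl) <;> rw [overChordR_cast]
      · have := h.chord_right_neg
        refine ⟨by exact_mod_cast this.le, fun h0 => ?_⟩
        have h0' := Int.cast_eq_zero.1 h0
        omega
      · simp [overChord_self_left]
      · simp [overChord_self_right]
    · have := (isAff_plane (-1) 0 0).le_of_mem_hull_image (c := -k) ?_ hP
      · linarith
      · rintro v (rfl | rfl | rfl) <;> simp [rcast₂] <;>
          exact_mod_cast (by have := h.lt_left; have := h.lt_right; omega)

end Caps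

theorem mem_hull_triple {E : Type*} [AddCommGroup E] [Module ℝ E] {V : Set E} {a b c x : E}
    (ha : a ∈ V) (hb : b ∈ V) (hc : c ∈ V) {u v w : ℝ} (hu : 0 ≤ u) (hv : 0 ≤ v) (hw : 0 ≤ w)
    (h1 : u + v + w = 1) (hx : x = u • a + v • b + w • c) : x ∈ convexHull ℝ V := by
  have h := (convex_convexHull ℝ V).sum_mem (t := Finset.univ) (w := ![u, v, w]) (z := ![a, b, c])
    (by intro i _; fin_cases i <;> assumption)
    (by simpa [Fin.sum_univ_three] using h1)
    (by intro i _; fin_cases i <;> exact subset_convexHull ℝ V (by assumption))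
  simpa [Fin.sum_univ_three, hx] using h

section CapFamily

variable {q p c σ : ℤ} {g : ℤ → ℤ}

theorem CapTri.proper_of_le {i j k i' j' k' : ℤ}
    (h : CapTri q (fun x => height σ q p c x (g x)) i j k)
    (h' : CapTri q (fun x => height σ q p c x (g x)) i' j' k')
    (hlt : height σ q p c j (g j) < height σ q p c j' (g j')) :
    Proper (rcast₂ '' pathTri g i j k) (rcast₂ '' pathTri g i' j' k') := by
  set a : ℤ → ℤ := fun x => height σ q p c x (g x) with ha
  have hlt' : a j < a j' := hlt
  have := h.lt_left
  have := h.lt_right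
  have := h'.lt_left
  have := h'.lt_right
  have hl := h.low_left
  have hr := h.low_right
  have inI : ∀ x, i' < x → x < k' → a x < a j' → False := by
    intro x h0 h1 h2
    have : x ≠ j' := by rintro rfl; exact lt_irrefl _ h2
    have := h'.min x h0 h1 this
    omega
  have hj : j ≤ i' ∨ k' ≤ j := by
    by_contra hcon
    push Not at hcon
    exact inI j hcon.1 hcon.2 hlt'
  have onpath : ∀ {x y z : ℤ} (w : ℤ × ℤ), w ∈ pathTri g x y z → w = (w.1, g w.1) := by
    rintro x y z w (h | h | h) <;> rw [h]
  have vertical : ∀ m : ℤ, (∀ v ∈ pathTri g i j k, v.1 ≤ m) → (∀ v ∈ pathTri g i' j' k', m ≤ v.1) →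
      Proper (rcast₂ '' pathTri g i j k) (rcast₂ '' pathTri g i' j' k') := by
    intro m h1 h2
    refine Proper.image_of_sep (isAff_plane 1 0 (-m)) ?_ ?_ (proper_of_subsingleton
      (p := rcast₂ (m, g m)) ?_ ?_)
    · intro v hv
      have : (v.1 : ℝ) ≤ m := by exact_mod_cast h1 v hv
      simpa [rcast₂] using this
    · intro v hv
      have : (m : ℝ) ≤ v.1 := by exact_mod_cast h2 v hv
      simpa [rcast₂] using this
    all_goals
      rintro _ ⟨v, ⟨hv, hv0⟩, rfl⟩
      have : (v.1 : ℝ) = m := by simp [rcast₂] at hv0; linarith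
      have : v.1 = m := by exact_mod_cast this
      rw [onpath v hv, this]; rfl
  have vertical' : ∀ m : ℤ, (∀ v ∈ pathTri g i j k, m ≤ v.1) → (∀ v ∈ pathTri g i' j' k', v.1 ≤ m) →
      Proper (rcast₂ '' pathTri g i j k) (rcast₂ '' pathTri g i' j' k') := by
    intro m h1 h2
    refine Proper.image_of_sep (isAff_plane (-1) 0 m) ?_ ?_ (proper_of_subsingleton
      (p := rcast₂ (m, g m)) ?_ ?_)
    · intro v hv
      have : (m : ℝ) ≤ v.1 := by exact_mod_cast h1 v hv
      simpa [rcast₂] using this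
    · intro v hv
      have : (v.1 : ℝ) ≤ m := by exact_mod_cast h2 v hv
      simpa [rcast₂] using this
    all_goals
      rintro _ ⟨v, ⟨hv, hv0⟩, rfl⟩
      have : (v.1 : ℝ) = m := by simp [rcast₂] at hv0; linarith
      have : v.1 = m := by exact_mod_cast this
      rw [onpath v hv, this]; rfl
  have chord : ∀ m n : ℤ, m < n →
      (∀ v ∈ pathTri g i j k, overChord a m n v.1 ≤ 0 ∧
        (overChord a m n v.1 = 0 → v.1 = m ∨ v.1 = n)) →
      (∀ v ∈ pathTri g i' j' k', 0 ≤ overChord a m n v.1 ∧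
        (overChord a m n v.1 = 0 → v.1 = m ∨ v.1 = n)) →
      Proper (rcast₂ '' pathTri g i j k) (rcast₂ '' pathTri g i' j' k') := by
    intro m n hmn h1 h2
    have hmn' : (0 : ℝ) < n - m := by
      have : (m : ℝ) < n := by exact_mod_cast hmn
      linarith
    refine Proper.image_of_sep (isAff_overChordR σ q p c g m n) ?_ ?_ (proper_of_subset_pair
      (a := rcast₂ (m, g m)) (b := rcast₂ (n, g n))
      (isAff_plane (1 / (n - m)) 0 (-m / (n - m))) ?_ ?_ ?_ ?_)
    · intro v hv
      rw [onpath v hv, overChordR_cast]; exact_mod_cast (h1 v hv).1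
    · intro v hv
      rw [onpath v hv, overChordR_cast]; exact_mod_cast (h2 v hv).1
    · simp only [rcast₂]; field_simp; ring
    · simp only [rcast₂]; field_simp; ring
    · rintro _ ⟨v, ⟨hv, hv0⟩, rfl⟩
      rw [onpath v hv, overChordR_cast] at hv0
      rcases (h1 v hv).2 (by exact_mod_cast hv0) with e | e <;> rw [onpath v hv, e] <;> simp
    · rintro _ ⟨v, ⟨hv, hv0⟩, rfl⟩
      rw [onpath v hv, overChordR_cast] at hv0
      rcases (h2 v hv).2 (by exact_mod_cast hv0) with e | e <;> rw [onpath v hv, e] <;> simp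
  rcases hj with hj | hj
  · rcases le_or_gt k i' with hk | hk
    · apply vertical k <;> rintro v (rfl | rfl | rfl) <;> dsimp only <;> omega
    · have hk' : k' ≤ k := by
        by_contra hcon
        exact inI k hk (by omega) (by omega)
      have mid : ∀ x, j ≤ x → x ≤ k → 0 ≤ overChord a j k x ∧
          (overChord a j k x = 0 → x = j ∨ x = k) := by
        intro x h0 h1
        rcases eq_or_lt_of_le h0 with rfl | h0
        · simp [overChord_self_left]
        rcases eq_or_lt_of_le h1 with rfl | h1
        · simp [overChord_self_right]
        have := h.chord_right h0 h1
        exact ⟨this.le, fun e => absurd e this.ne'⟩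
      refine chord j k h.lt_right ?_ ?_
      · have := h.chord_right_neg
        rintro v (rfl | rfl | rfl)
        · exact ⟨this.le, fun e => absurd e this.ne⟩
        · simp [overChord_self_left]
        · simp [overChord_self_right]
      · rintro v (rfl | rfl | rfl) <;> apply mid <;> dsimp only <;> omega
  · rcases le_or_gt k' i with hk | hk
    · apply vertical' i <;> rintro v (rfl | rfl | rfl) <;> dsimp only <;> omega
    · have hk' : i ≤ i' := by
        by_contra hcon
        exact inI i (by omega) hk (by omega)
      have mid : ∀ x, i ≤ x → x ≤ j → 0 ≤ overChord a i j x ∧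
          (overChord a i j x = 0 → x = i ∨ x = j) := by
        intro x h0 h1
        rcases eq_or_lt_of_le h0 with rfl | h0
        · simp [overChord_self_left]
        rcases eq_or_lt_of_le h1 with rfl | h1
        · simp [overChord_self_right]
        have := h.chord_left h0 h1
        exact ⟨this.le, fun e => absurd e this.ne'⟩
      refine chord i j h.lt_left ?_ ?_
      · have := h.chord_left_neg
        rintro v (rfl | rfl | rfl)
        · simp [overChord_self_left]
        · simp [overChord_self_right]
        · exact ⟨this.le, fun e => absurd e this.ne⟩
      · rintro v (rfl | rfl | rfl) <;> apply mid <;> dsimp only <;> omega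

theorem CapTri.proper (hp : ClosePath σ q p c g) {i j k i' j' k' : ℤ}
    (h : CapTri q (fun x => height σ q p c x (g x)) i j k)
    (h' : CapTri q (fun x => height σ q p c x (g x)) i' j' k') :
    Proper (rcast₂ '' pathTri g i j k) (rcast₂ '' pathTri g i' j' k') := by
  have i0 := h.nonneg
  have i1 := h.lt_left
  have i2 := h.lt_right
  have i3 := h.le
  have i0' := h'.nonneg
  have i1' := h'.lt_left
  have i2' := h'.lt_right
  have i3' := h'.le
  rcases lt_trichotomy (height σ q p c j (g j)) (height σ q p c j' (g j')) with hlt | heq | hlt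
  · exact h.proper_of_le h' hlt
  · obtain rfl := hp.inj j j' (by omega) (by omega) (by omega) (by omega) heq
    have hi : i = i' := by
      by_contra hne
      rcases lt_or_gt_of_ne hne with hlt | hlt
      · have := h.min i' hlt (by omega) (by omega)
        have := h'.low_left
        omega
      · have := h'.min i hlt (by omega) (by omega)
        have := h.low_left
        omega
    have hk : k = k' := by
      by_contra hne
      rcases lt_or_gt_of_ne hne with hlt | hlt
      · have := h'.min k (by omega) hlt (by omega)
        have := h.low_right
        omega
      · have := h.min k' (by omega) hlt (by omega)
        have := h'.low_right
        omega
    rw [hi, hk]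
    exact proper_self _
  · exact (h'.proper_of_le h hlt).symm

theorem exists_min_Ioo (a : ℤ → ℤ) {i k : ℤ} (hik : i + 2 ≤ k)
    (hinj : ∀ x y, i < x → x < k → i < y → y < k → a x = a y → x = y) :
    ∃ j, i < j ∧ j < k ∧ ∀ x, i < x → x < k → x ≠ j → a j < a x := by
  obtain ⟨j, hj, hmin⟩ := (Finset.Ioo i k).exists_min_image a
    ⟨i + 1, by rw [Finset.mem_Ioo]; omega⟩
  rw [Finset.mem_Ioo] at hj
  refine ⟨j, hj.1, hj.2, fun x h0 h1 hne => ?_⟩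
  refine lt_of_le_of_ne (hmin x (Finset.mem_Ioo.2 ⟨h0, h1⟩)) fun e => hne ?_
  exact (hinj j x hj.1 hj.2 h0 h1 e).symm

theorem mem_pathTri (hq : 0 < q) (hp : ClosePath σ q p c g) {i j k : ℤ}
    (h : CapTri q (fun x => height σ q p c x (g x)) i j k) {P : ℝ × ℝ}
    (h1 : 0 ≤ overChordR σ q p c g i k P) (h2 : overChordR σ q p c g i j P ≤ 0)
    (h3 : overChordR σ q p c g j k P ≤ 0) : P ∈ hull₂ (pathTri g i j k) := by
  set a : ℤ → ℤ := fun x => height σ q p c x (g x) with ha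
  obtain ⟨ai, hai⟩ : ∃ r : ℝ, r = (a i : ℝ) := ⟨_, rfl⟩
  obtain ⟨aj, haj⟩ : ∃ r : ℝ, r = (a j : ℝ) := ⟨_, rfl⟩
  obtain ⟨ak, hak⟩ : ∃ r : ℝ, r = (a k : ℝ) := ⟨_, rfl⟩
  obtain ⟨D, hD⟩ : ∃ D : ℝ, D = (j - i) * (aj - ak) + (k - j) * (aj - ai) := ⟨_, rfl⟩
  have e1 : (i : ℝ) < j := by exact_mod_cast h.lt_left
  have e2 : (j : ℝ) < k := by exact_mod_cast h.lt_right
  have e3 : ai < aj := by rw [hai, haj]; exact_mod_cast h.low_left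
  have e4 : ak < aj := by rw [hak, haj]; exact_mod_cast h.low_right
  have hDpos : 0 < D := by
    rw [hD]
    have := mul_pos (sub_pos.2 e1) (sub_pos.2 e4)
    have := mul_pos (sub_pos.2 e2) (sub_pos.2 e3)
    linarith
  have hq' : (q : ℝ) ≠ 0 := by exact_mod_cast hq.ne'
  have σ2 : (σ : ℝ) * σ = 1 := by rcases hp.sign with h | h <;> rw [h] <;> norm_num
  have hg : ∀ x : ℤ, (g x : ℝ) = (σ * a x + p * x + c) / q := by
    intro x
    rw [eq_div_iff hq']
    simp only [ha, height]; push_cast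
    linear_combination (-(q : ℝ) * g x + p * x + c) * σ2
  obtain ⟨r, hr⟩ : ∃ r : ℝ, r = σ * (q * P.2 - p * P.1 - c) := ⟨_, rfl⟩
  have hP2 : P.2 = (σ * r + p * P.1 + c) / q := by
    rw [eq_div_iff hq', hr]
    linear_combination (-(q : ℝ) * P.2 + p * P.1 + c) * σ2
  have c1 : overChordR σ q p c g i k P = (k - i) * (r - ai) - (ak - ai) * (P.1 - i) := by
    simp only [overChordR, hr, hai, hak, ha]
  have c2 : overChordR σ q p c g i j P = (j - i) * (r - ai) - (aj - ai) * (P.1 - i) := by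
    simp only [overChordR, hr, hai, haj, ha]
  have c3 : overChordR σ q p c g j k P = (k - j) * (r - aj) - (ak - aj) * (P.1 - j) := by
    simp only [overChordR, hr, haj, hak, ha]
  rw [c1] at h1
  rw [c2] at h2
  rw [c3] at h3
  refine mem_hull_triple (a := rcast₂ (i, g i)) (b := rcast₂ (j, g j)) (c := rcast₂ (k, g k))
    ⟨_, Or.inl rfl, rfl⟩ ⟨_, Or.inr (Or.inl rfl), rfl⟩ ⟨_, Or.inr (Or.inr rfl), rfl⟩
    (u := -((k - j) * (r - aj) - (ak - aj) * (P.1 - j)) / D)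
    (v := ((k - i) * (r - ai) - (ak - ai) * (P.1 - i)) / D)
    (w := -((j - i) * (r - ai) - (aj - ai) * (P.1 - i)) / D)
    (div_nonneg (by linarith) hDpos.le) (div_nonneg h1 hDpos.le)
    (div_nonneg (by linarith) hDpos.le) ?_ ?_
  · field_simp; rw [hD]; ring
  · have hD0 := hDpos.ne'
    ext
    · simp only [rcast₂, Prod.fst_add, Prod.smul_fst, smul_eq_mul]
      field_simp; rw [hD]; ring
    · simp only [rcast₂, Prod.snd_add, Prod.smul_snd, smul_eq_mul, hg, ← hai, ← haj, ← hak]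
      rw [hP2]
      field_simp
      rw [hD]; ring

end CapFamily

section CapCover

variable {q p c σ : ℤ} {g : ℤ → ℤ}

theorem overChordR_succ (m : ℤ) {P : ℝ × ℝ} (h0 : (m : ℝ) ≤ P.1) (h1 : P.1 ≤ m + 1) :
    overChordR σ q p c g m (m + 1) P = q * (σ * P.2 - σ * interp g P.1) := by
  rw [interp_eq g h0 h1]
  simp only [overChordR, height]
  push_cast; ring

theorem exists_capTri_of_chord (hq : 0 < q) (hp : ClosePath σ q p c g) {P : ℝ × ℝ}
    (hP : (σ : ℝ) * P.2 ≤ σ * interp g P.1) (n : ℕ) : ∀ i k : ℤ, k - i ≤ n → 0 ≤ i → k ≤ q →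
    i + 2 ≤ k → (i : ℝ) ≤ P.1 → P.1 ≤ k →
    (∀ x, i < x → x < k → height σ q p c i (g i) < height σ q p c x (g x) ∧
      height σ q p c k (g k) < height σ q p c x (g x)) →
    0 ≤ overChordR σ q p c g i k P →
    ∃ i j k, CapTri q (fun x => height σ q p c x (g x)) i j k ∧ P ∈ hull₂ (pathTri g i j k) := by
  induction n with
  | zero => intro i k h0 h1 h2 h3; exfalso; simp at h0; omega
  | succ n ih =>
  intro i k hn hi hk hik hiP hkP hlow hch
  obtain ⟨j, hij, hjk, hmin⟩ := exists_min_Ioo (fun x => height σ q p c x (g x)) hik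
    (fun x y h0 h1 h2 h3 e => hp.inj x y (by omega) (by omega) (by omega) (by omega) e)
  have htri : CapTri q (fun x => height σ q p c x (g x)) i j k :=
    ⟨hi, hij, hjk, hk, (hlow j hij hjk).1, (hlow j hij hjk).2, hmin⟩
  obtain ⟨r, hr⟩ : ∃ r : ℝ, r = σ * (q * P.2 - p * P.1 - c) := ⟨_, rfl⟩
  have c2 : ∀ m n : ℤ, overChordR σ q p c g m n P = (n - m) * (r - height σ q p c m (g m)) -
    (height σ q p c n (g n) - height σ q p c m (g m)) * (P.1 - m) := by
    intro m n; simp only [overChordR, hr]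
  have e1 : (i : ℝ) < j := by exact_mod_cast htri.lt_left
  have e2 : (j : ℝ) < k := by exact_mod_cast htri.lt_right
  have e3 : (height σ q p c i (g i) : ℝ) < height σ q p c j (g j) := by
    exact_mod_cast htri.low_left
  have e4 : (height σ q p c k (g k) : ℝ) < height σ q p c j (g j) := by
    exact_mod_cast htri.low_right
  push_cast at hn
  rcases le_total P.1 j with hX | hX
  · by_cases h2 : overChordR σ q p c g i j P ≤ 0
    · refine ⟨i, j, k, htri, mem_pathTri hq hp htri hch h2 ?_⟩
      rw [c2] at h2 ⊢
      have h4 : (j - i : ℝ) * (r - height σ q p c j (g j)) ≤ 0 := by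
        nlinarith [mul_nonneg (sub_nonneg.2 hX) (sub_pos.2 e3).le]
      have h5 : r ≤ height σ q p c j (g j) := by
        by_contra hcon
        push Not at hcon
        have := mul_pos (sub_pos.2 e1) (sub_pos.2 hcon)
        linarith
      nlinarith [mul_nonneg (sub_nonneg.2 hX) (sub_pos.2 e4).le,
        mul_nonneg (sub_nonneg.2 h5) (sub_pos.2 e2).le]
    · push Not at h2
      have hne : j ≠ i + 1 := by
        rintro rfl
        rw [overChordR_succ i hiP (by push_cast at hX; exact hX)] at h2
        have : (0 : ℝ) < q := by exact_mod_cast hq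
        nlinarith
      refine ih i j (by omega) hi (by omega) (by omega) hiP hX (fun x h0 h1 => ?_) h2.le
      have a1 := hmin x h0 (by omega) (by omega)
      have a2 := htri.low_left
      omega
  · by_cases h2 : overChordR σ q p c g j k P ≤ 0
    · refine ⟨i, j, k, htri, mem_pathTri hq hp htri hch ?_ h2⟩
      rw [c2] at h2 ⊢
      have h4 : (k - j : ℝ) * (r - height σ q p c j (g j)) ≤ 0 := by
        nlinarith [mul_nonneg (sub_nonneg.2 hX) (sub_pos.2 e4).le]
      have h5 : r ≤ height σ q p c j (g j) := by
        by_contra hcon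
        push Not at hcon
        have := mul_pos (sub_pos.2 e2) (sub_pos.2 hcon)
        linarith
      nlinarith [mul_nonneg (sub_nonneg.2 hX) (sub_pos.2 e3).le,
        mul_nonneg (sub_nonneg.2 h5) (sub_pos.2 e1).le]
    · push Not at h2
      have hne : k ≠ j + 1 := by
        rintro rfl
        rw [overChordR_succ j hX (by push_cast at hkP; exact hkP)] at h2
        have : (0 : ℝ) < q := by exact_mod_cast hq
        nlinarith
      refine ih j k (by omega) (by omega) hk (by omega) hX hkP (fun x h0 h1 => ?_) h2.le
      have a1 := hmin x (by omega) h1 (by omega)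
      have a2 := htri.low_right
      omega

/-- The cap triangles fill the region between the path and the segment it follows. -/
theorem exists_capTri (hq : 2 ≤ q) (hp : ClosePath σ q p c g) {P : ℝ × ℝ} (h0 : 0 ≤ P.1)
    (h1 : P.1 ≤ q) (h2 : 0 ≤ (σ : ℝ) * (q * P.2 - p * P.1 - c))
    (h3 : (σ : ℝ) * P.2 ≤ σ * interp g P.1) :
    ∃ i j k, CapTri q (fun x => height σ q p c x (g x)) i j k ∧ P ∈ hull₂ (pathTri g i j k) := by
  refine exists_capTri_of_chord (by omega) hp h3 q.toNat 0 q (by omega) le_rfl le_rfl (by omega)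
    (by simpa using h0) h1 (fun x hx hx' => ?_) ?_
  · rw [hp.left, hp.right]
    exact ⟨(hp.inner x hx hx').1, (hp.inner x hx hx').1⟩
  · simp only [overChordR, hp.left, hp.right, Int.cast_zero, sub_zero, zero_mul]
    exact mul_nonneg (by exact_mod_cast (by omega : 0 ≤ q)) h2

/-- A lattice parallelogram of area `D > 1` contains a lattice point besides its vertices. -/
theorem exists_box_point {u₁ u₂ v₁ v₂ D : ℤ} (hD : 1 < D) (hdet : (u₁ * v₂ - u₂ * v₁) ^ 2 = D ^ 2) :
    ∃ s t : ℤ, 0 ≤ s ∧ s < D ∧ 0 ≤ t ∧ t < D ∧ s + t ≤ D ∧ (0 < s ∨ 0 < t) ∧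
      D ∣ s * u₁ + t * v₁ ∧ D ∣ s * u₂ + t * v₂ := by
  have hD0 : D ≠ 0 := by omega
  have hdvd : D ∣ u₁ * v₂ - u₂ * v₁ := (sq_eq_sq_iff_abs_eq_abs _ _).1 hdet |> fun h => by
    rw [← dvd_abs, h, dvd_abs]
  have main : ∀ s t : ℤ, D ∣ s * u₁ + t * v₁ → D ∣ s * u₂ + t * v₂ → ¬ (D ∣ s ∧ D ∣ t) →
      ∃ s t : ℤ, 0 ≤ s ∧ s < D ∧ 0 ≤ t ∧ t < D ∧ s + t ≤ D ∧ (0 < s ∨ 0 < t) ∧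
      D ∣ s * u₁ + t * v₁ ∧ D ∣ s * u₂ + t * v₂ := by
    intro s t h1 h2 h3
    have red : ∀ u v, D ∣ s * u + t * v → D ∣ (s % D) * u + (t % D) * v := by
      intro u v h
      have : (s % D) * u + (t % D) * v = (s * u + t * v) - D * ((s / D) * u + (t / D) * v) := by
        have e1 := Int.emod_add_mul_ediv s D
        have e2 := Int.emod_add_mul_ediv t D
        linear_combination u * e1 + v * e2
      rw [this]
      exact dvd_sub h (dvd_mul_right _ _)
    have s0 := Int.emod_nonneg s hD0
    have s1 := Int.emod_lt_of_pos s (by omega : 0 < D)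
    have t0 := Int.emod_nonneg t hD0
    have t1 := Int.emod_lt_of_pos t (by omega : 0 < D)
    have hpos : 0 < s % D ∨ 0 < t % D := by
      by_contra hcon
      exact h3 ⟨Int.dvd_of_emod_eq_zero (by omega), Int.dvd_of_emod_eq_zero (by omega)⟩
    by_cases hle : s % D + t % D ≤ D
    · exact ⟨_, _, s0, s1, t0, t1, hle, hpos, red _ _ h1, red _ _ h2⟩
    · have compl : ∀ u v, D ∣ s * u + t * v → D ∣ (D - s % D) * u + (D - t % D) * v := by
        intro u v h
        have : (D - s % D) * u + (D - t % D) * v =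
            D * (u + v) - ((s % D) * u + (t % D) * v) := by ring
        rw [this]
        exact dvd_sub (dvd_mul_right _ _) (red _ _ h)
      exact ⟨_, _, by omega, by omega, by omega, by omega, by omega, by omega,
        compl _ _ h1, compl _ _ h2⟩
  by_cases h1 : D ∣ v₂ ∧ D ∣ u₂
  · by_cases h2 : D ∣ v₁ ∧ D ∣ u₁
    · exfalso
      obtain ⟨⟨a, rfl⟩, b, rfl⟩ := h1
      obtain ⟨⟨a', rfl⟩, b', rfl⟩ := h2
      have h3 : (D * b' * (D * a) - D * b * (D * a')) ^ 2 =
          D ^ 2 * (D * (b' * a - b * a')) ^ 2 := by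
        ring
      rw [h3] at hdet
      have h4 : (D * (b' * a - b * a')) ^ 2 = 1 :=
        mul_left_cancel₀ (pow_ne_zero 2 hD0) (by rw [hdet, mul_one])
      have h5 : D ∣ (D * (b' * a - b * a')) ^ 2 := dvd_pow (dvd_mul_right _ _) two_ne_zero
      rw [h4] at h5
      have := Int.le_of_dvd one_pos h5
      omega
    · refine main (-v₁) u₁ (by ring_nf; exact dvd_zero D) ?_ ?_
      · convert hdvd using 1; ring
      · rw [dvd_neg]; exact h2
  · refine main v₂ (-u₂) ?_ (by ring_nf; exact dvd_zero D) ?_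
    · convert hdvd using 1; ring
    · rw [dvd_neg]; exact h1

/-- The cap triangles are unimodular. -/
theorem CapTri.det_eq (hp : ClosePath σ q p c g) {i j k : ℤ}
    (h : CapTri q (fun x => height σ q p c x (g x)) i j k) :
    ((j - i) * (g k - g i) - (g j - g i) * (k - i)).natAbs = 1 := by
  set a : ℤ → ℤ := fun x => height σ q p c x (g x) with ha
  obtain ⟨D, hD⟩ : ∃ D, D = -σ * ((j - i) * (g k - g i) - (g j - g i) * (k - i)) := ⟨_, rfl⟩
  have i1 := h.lt_left
  have i2 := h.lt_right
  have i0 := h.nonneg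
  have i3 := h.le
  have hq : 0 < q := by omega
  have hl := h.low_left
  have hr := h.low_right
  have hqD : q * D = (j - i) * (a j - a k) + (k - j) * (a j - a i) := by
    rw [hD]; simp only [ha, height]; ring
  have hDpos : 0 < D := by
    have := mul_pos (sub_pos.2 i1) (sub_pos.2 hr)
    have := mul_pos (sub_pos.2 i2) (sub_pos.2 hl)
    by_contra hcon
    push Not at hcon
    nlinarith
  have σ2 : σ * σ = 1 := by rcases hp.sign with h | h <;> rw [h] <;> norm_num
  suffices hD1 : D = 1 by
    rw [hD1] at hD
    rcases hp.sign with e | e <;> rw [e] at hD <;> omega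
  by_contra hne
  obtain ⟨s, t, s0, s1, t0, t1, hst, hpos, ⟨x, hx⟩, y, hy⟩ := exists_box_point
    (u₁ := i - j) (u₂ := g i - g j) (v₁ := k - j) (v₂ := g k - g j) (D := D) (by omega) (by
      rw [hD]
      linear_combination -(((j - i) * (g k - g i) - (g j - g i) * (k - i)) ^ 2) * σ2)
  have hxi : i < j + x := by
    have : 0 < D * (j + x - i) := by
      have e : D * (j + x - i) = (D - s) * (j - i) + t * (k - j) := by linear_combination -hx
      rw [e]
      have := mul_pos (sub_pos.2 s1) (sub_pos.2 i1)
      have := mul_nonneg t0 (sub_pos.2 i2).le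
      omega
    have := pos_of_mul_pos_right this hDpos.le
    omega
  have hxk : j + x < k := by
    have : 0 < D * (k - (j + x)) := by
      have e : D * (k - (j + x)) = (D - t) * (k - j) + s * (j - i) := by linear_combination hx
      rw [e]
      have := mul_pos (sub_pos.2 t1) (sub_pos.2 i2)
      have := mul_nonneg s0 (sub_pos.2 i1).le
      omega
    have := pos_of_mul_pos_right this hDpos.le
    omega
  obtain ⟨r, hr'⟩ : ∃ r, r = height σ q p c (j + x) (g j + y) := ⟨_, rfl⟩
  have hDr : D * r = (D - s - t) * a j + s * a i + t * a k := by
    rw [hr']; simp only [ha, height]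
    linear_combination (σ * p) * hx - (σ * q) * hy
  have bi := hp.bounds hq i0 (by omega : i ≤ q)
  have bk := hp.bounds hq (by omega : 0 ≤ k) i3
  have bj := hp.bounds hq (by omega : 0 ≤ j) (by omega : j ≤ q)
  have hr0 : 0 ≤ r := by
    have : 0 ≤ D * r := by
      rw [hDr]
      have := mul_nonneg (by omega : 0 ≤ D - s - t) bj.1
      have := mul_nonneg s0 bi.1
      have := mul_nonneg t0 bk.1
      linarith
    exact nonneg_of_mul_nonneg_right this hDpos
  have hrj : r < a j := by
    have : 0 < D * (a j - r) := by
      have e : D * (a j - r) = s * (a j - a i) + t * (a j - a k) := by linear_combination -hDr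
      rw [e]
      have hs := mul_nonneg s0 (sub_pos.2 hl).le
      have ht := mul_nonneg t0 (sub_pos.2 hr).le
      rcases hpos with h | h
      · have := mul_pos h (sub_pos.2 hl); omega
      · have := mul_pos h (sub_pos.2 hr); omega
    have := pos_of_mul_pos_right this hDpos.le
    omega
  have bx := hp.inner (j + x) (by omega) (by omega)
  have hrx : r = a (j + x) := by
    have e : r - a (j + x) = q * (σ * (g j + y - g (j + x))) := by
      rw [hr']; simp only [ha, height]; ring
    have b1 : a (j + x) < q := bx.2
    have b0 : 0 < a (j + x) := bx.1
    have b2 : a j < q := bj.2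
    have hlt : |r - a (j + x)| < q := by rw [abs_lt]; omega
    have := Int.eq_zero_of_abs_lt_dvd ⟨_, e⟩ hlt
    omega
  by_cases hx0 : j + x = j
  · rw [hx0] at hrx; omega
  · have := h.min (j + x) hxi hxk hx0
    omega

end CapCover

section Pieces

/-- The lowest lattice path above the line `q * y = p * x`. -/
def lowPath (q p x : ℤ) : ℤ := -((-(p * x)) / q)

/-- `lowPath`, raised by one at abscissa `0`. -/
def midPath (q p x : ℤ) : ℤ := lowPath q p x + if x = 0 then 1 else 0

/-- `lowPath`, raised by one at abscissae `0` and `q`. -/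
def upPath (q p x : ℤ) : ℤ := midPath q p x + if x = q then 1 else 0

variable {q p : ℤ}

theorem lowPath_spec (hq : 0 < q) (x : ℤ) :
    0 ≤ q * lowPath q p x - p * x ∧ q * lowPath q p x - p * x < q := by
  have h1 := Int.emod_add_mul_ediv (-(p * x)) q
  have h2 := Int.emod_nonneg (-(p * x)) hq.ne'
  have h3 := Int.emod_lt_of_pos (-(p * x)) hq
  have e : q * lowPath q p x = -(q * (-(p * x) / q)) := by rw [lowPath]; ring
  constructor <;> omega

theorem lowPath_zero : lowPath q p 0 = 0 := by simp [lowPath]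

theorem lowPath_right (hq : 0 < q) : lowPath q p q = p := by
  rw [lowPath, ← neg_mul, Int.mul_ediv_cancel _ hq.ne', neg_neg]

theorem lowPath_le_midPath (x : ℤ) : lowPath q p x ≤ midPath q p x := by
  unfold midPath; split_ifs <;> omega

theorem midPath_le_upPath (x : ℤ) : midPath q p x ≤ upPath q p x := by
  unfold upPath; split_ifs <;> omega

theorem midPath_zero : midPath q p 0 = 1 := by simp [midPath, lowPath_zero]

theorem midPath_of_ne {x : ℤ} (hx : x ≠ 0) : midPath q p x = lowPath q p x := by
  simp [midPath, hx]

theorem upPath_of_ne {x : ℤ} (hx : x ≠ q) : upPath q p x = midPath q p x := by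
  simp [upPath, hx]

theorem upPath_zero (hq : 0 < q) : upPath q p 0 = 1 := by
  rw [upPath_of_ne hq.ne, midPath_zero]

theorem midPath_right (hq : 0 < q) : midPath q p q = p := by
  rw [midPath_of_ne hq.ne', lowPath_right hq]

theorem upPath_right (hq : 0 < q) : upPath q p q = p + 1 := by
  rw [upPath, midPath_right hq, if_pos rfl]

theorem lowPath_ne (hpq : IsCoprime p q) {x : ℤ} (h0 : 0 < x) (h1 : x < q) :
    q * lowPath q p x - p * x ≠ 0 := by
  intro h
  have h2 : q ∣ p * x := ⟨lowPath q p x, by omega⟩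
  have := Int.le_of_dvd h0 (hpq.symm.dvd_of_dvd_mul_left h2)
  omega

theorem lowPath_inj (hpq : IsCoprime p q) {x x' : ℤ} (h0 : 0 < x) (h1 : x < q)
    (h0' : 0 < x') (h1' : x' < q)
    (h : q * lowPath q p x - p * x = q * lowPath q p x' - p * x') : x = x' := by
  have h2 : q ∣ p * (x - x') := ⟨lowPath q p x - lowPath q p x', by linear_combination -h⟩
  have h3 := hpq.symm.dvd_of_dvd_mul_left h2
  have := Int.eq_zero_of_abs_lt_dvd h3 (by rw [abs_lt]; omega)
  omega

theorem closePath_lowPath (hq : 0 < q) (hpq : IsCoprime p q) : ClosePath 1 q p 0 (lowPath q p) where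
  sign := Or.inl rfl
  left := by simp [height, lowPath_zero]
  right := by simp [height, lowPath_right hq, mul_comm]
  inner x h0 h1 := by
    have h2 := lowPath_spec (p := p) hq x
    have h3 := lowPath_ne hpq h0 h1
    simp only [height]; constructor <;> omega
  inj x x' h0 h1 h0' h1' h := lowPath_inj hpq h0 h1 h0' h1' (by simp only [height] at h; omega)

theorem closePath_upPath (hq : 0 < q) (hpq : IsCoprime p q) :
    ClosePath (-1) q p q (upPath q p) where
  sign := Or.inr rfl
  left := by simp [height, upPath_zero hq]
  right := by simp only [height, upPath_right hq]; ring
  inner x h0 h1 := by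
    have h2 := lowPath_spec (p := p) hq x
    have h3 := lowPath_ne hpq h0 h1
    simp only [height, upPath_of_ne h1.ne, midPath_of_ne h0.ne']; constructor <;> omega
  inj x x' h0 h1 h0' h1' h := lowPath_inj hpq h0 h1 h0' h1' (by
    simp only [height, upPath_of_ne h1.ne, midPath_of_ne h0.ne', upPath_of_ne h1'.ne,
      midPath_of_ne h0'.ne'] at h
    omega)

/-- The base faces of the tetrahedra filling a cell, by layers. -/
inductive Piece (q p e₁ e₂ : ℤ) : ℕ → Set (ℤ × ℤ) → Prop
  | lowCap {i j k : ℤ} (h : CapTri q (fun x => height 1 q p 0 x (lowPath q p x)) i j k) :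
      Piece q p e₁ e₂ 0 (pathTri (lowPath q p) i j k)
  | lowEdge (x : ℤ) (he : e₁ = 1) (h0 : 0 ≤ x) (h1 : x < q) :
      Piece q p e₁ e₂ 1 {(x, lowPath q p x), (x + 1, lowPath q p (x + 1))}
  | leftTri : Piece q p e₁ e₂ 2 {(0, 0), (0, 1), (1, midPath q p 1)}
  | rightTri : Piece q p e₁ e₂ 3 {(q, p), (q, p + 1), (q - 1, midPath q p (q - 1))}
  | upEdge (x : ℤ) (he : e₂ = 1) (h0 : 0 ≤ x) (h1 : x < q) :
      Piece q p e₁ e₂ 4 {(x, upPath q p x), (x + 1, upPath q p (x + 1))}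
  | upCap {i j k : ℤ} (h : CapTri q (fun x => height (-1) q p q x (upPath q p x)) i j k) :
      Piece q p e₁ e₂ 5 (pathTri (upPath q p) i j k)

/-- The path bounding a layer from above. -/
def topPath (q p : ℤ) (t : ℕ) : ℤ → ℤ :=
  if t ≤ 1 then lowPath q p else if t = 2 then midPath q p else upPath q p

/-- The path bounding a layer from below. -/
def botPath (q p : ℤ) (t : ℕ) : ℤ → ℤ :=
  if t ≤ 2 then lowPath q p else if t = 3 then midPath q p else upPath q p

theorem topPath_le_botPath {t t' : ℕ} (h : t < t') (x : ℤ) :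
    topPath q p t x ≤ botPath q p t' x := by
  have h1 := lowPath_le_midPath (q := q) (p := p) x
  have h2 := midPath_le_upPath (q := q) (p := p) x
  unfold topPath botPath
  split_ifs <;> omega

variable {e₁ e₂ e₁' e₂' : ℤ} {t t' : ℕ} {F F' : Set (ℤ × ℤ)}

theorem side_edge {σ : ℝ} (hσ : σ = 1 ∨ σ = -1) (g : ℤ → ℤ) (x : ℤ) :
    Side σ g {(x, g x), (x + 1, g (x + 1))} := by
  refine side_strip hσ x ?_
  rintro v (rfl | rfl)
  · exact ⟨Or.inl rfl, le_rfl⟩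
  · exact ⟨Or.inr rfl, le_rfl⟩

theorem Piece.side_top (hq : 0 < q) (h : Piece q p e₁ e₂ t F) (ht : t ≠ 5) :
    Side 1 (topPath q p t) F := by
  cases h with
  | lowCap h => simpa [topPath] using h.side hq
  | lowEdge x he h0 h1 => exact side_edge (Or.inl rfl) _ x
  | leftTri =>
    refine side_strip (Or.inl rfl) 0 ?_
    rintro v (rfl | rfl | rfl) <;> simp [topPath, midPath_zero]
  | rightTri =>
    refine side_strip (Or.inl rfl) (q - 1) ?_
    rintro v (rfl | rfl | rfl)
    · simp [topPath, upPath_right hq]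
    · simp [topPath, upPath_right hq]
    · simp [topPath, upPath_of_ne (show q - 1 ≠ q by omega)]
  | upEdge x he h0 h1 => exact side_edge (Or.inl rfl) _ x
  | upCap h => exact absurd rfl ht

theorem Piece.side_bot (hq : 0 < q) (h : Piece q p e₁ e₂ t F) (ht : t ≠ 0) :
    Side (-1) (botPath q p t) F := by
  cases h with
  | lowCap h => exact absurd rfl ht
  | lowEdge x he h0 h1 => exact side_edge (Or.inr rfl) _ x
  | leftTri =>
    refine side_strip (Or.inr rfl) 0 ?_
    rintro v (rfl | rfl | rfl) <;>
      simp [botPath, lowPath_zero, midPath_of_ne one_ne_zero]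
  | rightTri =>
    refine side_strip (Or.inr rfl) (q - 1) ?_
    rintro v (rfl | rfl | rfl)
    · simp [botPath, midPath_right hq]
    · simp [botPath, midPath_right hq]
    · simp [botPath]
  | upEdge x he h0 h1 => exact side_edge (Or.inr rfl) _ x
  | upCap h => simpa [botPath] using h.side hq

theorem Piece.le_five (h : Piece q p e₁ e₂ t F) : t ≤ 5 := by
  cases h <;> norm_num

theorem Piece.side_bot_of_lt (hq : 0 < q) (h : Piece q p e₁ e₂ t' F) (ht : t < t') :
    Side (-1) (topPath q p t) F := by
  refine (h.side_bot hq (by omega)).mono (Or.inr rfl) fun x => ?_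
  have : (topPath q p t x : ℝ) ≤ botPath q p t' x := by exact_mod_cast topPath_le_botPath ht x
  linarith

theorem Piece.proper_of_lt (hq : 0 < q) (h : Piece q p e₁ e₂ t F) (h' : Piece q p e₁' e₂' t' F')
    (ht : t < t') : Proper (rcast₂ '' F) (rcast₂ '' F') :=
  (h.side_top hq (by have := h'.le_five; omega)).proper (h'.side_bot_of_lt hq ht)

theorem Piece.proper (hq : 0 < q) (hpq : IsCoprime p q) (h : Piece q p e₁ e₂ t F)
    (h' : Piece q p e₁' e₂' t' F') : Proper (rcast₂ '' F) (rcast₂ '' F') := by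
  rcases lt_trichotomy t t' with ht | rfl | ht
  · exact h.proper_of_lt hq h' ht
  · cases h with
    | lowCap h => cases h' with | lowCap h' => exact h.proper (closePath_lowPath hq hpq) h'
    | lowEdge x =>
      cases h' with
      | lowEdge x' => exact (side_edge (Or.inl rfl) _ x).proper (side_edge (Or.inr rfl) _ x')
    | leftTri => cases h' with | leftTri => exact proper_self _
    | rightTri => cases h' with | rightTri => exact proper_self _
    | upEdge x =>
      cases h' with
      | upEdge x' => exact (side_edge (Or.inl rfl) _ x).proper (side_edge (Or.inr rfl) _ x')
    | upCap h => cases h' with | upCap h' => exact h.proper (closePath_upPath hq hpq) h'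
  · exact (h'.proper_of_lt hq h ht).symm

theorem Piece.nonempty (h : Piece q p e₁ e₂ t F) : F.Nonempty := by
  cases h <;> exact ⟨_, Or.inl rfl⟩

/-- The vertices of the pieces lie in the base parallelogram. -/
theorem Piece.bounds (hq : 0 < q) (hpq : IsCoprime p q) (h : Piece q p e₁ e₂ t F)
    {v : ℤ × ℤ} (hv : v ∈ F) :
    0 ≤ v.1 ∧ v.1 ≤ q ∧ 0 ≤ q * v.2 - p * v.1 ∧ q * v.2 - p * v.1 ≤ q := by
  have hl : ∀ x, 0 ≤ x → x ≤ q → 0 ≤ x ∧ x ≤ q ∧ 0 ≤ q * lowPath q p x - p * x ∧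
      q * lowPath q p x - p * x ≤ q := fun x h0 h1 =>
    ⟨h0, h1, (lowPath_spec hq x).1, (lowPath_spec hq x).2.le⟩
  have hu : ∀ x, 0 ≤ x → x ≤ q → 0 ≤ x ∧ x ≤ q ∧ 0 ≤ q * upPath q p x - p * x ∧
      q * upPath q p x - p * x ≤ q := fun x h0 h1 => by
    have := (closePath_upPath hq hpq).bounds hq h0 h1
    simp only [height] at this
    refine ⟨h0, h1, ?_, ?_⟩ <;> omega
  cases h with
  | lowCap h =>
    have := h.nonneg; have := h.lt_left; have := h.lt_right; have := h.le
    rcases hv with rfl | rfl | rfl <;> apply hl <;> omega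
  | lowEdge x he h0 h1 => rcases hv with rfl | rfl <;> apply hl <;> omega
  | leftTri =>
    rcases hv with rfl | rfl | rfl
    · simp [hq.le]
    · simp [hq.le]
    · rw [midPath_of_ne one_ne_zero]; apply hl <;> omega
  | rightTri =>
    rcases hv with rfl | rfl | rfl
    · refine ⟨hq.le, le_rfl, ?_, ?_⟩ <;> dsimp only <;> linarith [mul_comm p q]
    · refine ⟨hq.le, le_rfl, ?_, ?_⟩ <;> dsimp only <;> linarith [mul_comm p q]
    · rw [← upPath_of_ne (show q - 1 ≠ q by omega)]; apply hu <;> omega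
  | upEdge x he h0 h1 => rcases hv with rfl | rfl <;> apply hu <;> omega
  | upCap h =>
    have := h.nonneg; have := h.lt_left; have := h.lt_right; have := h.le
    rcases hv with rfl | rfl | rfl <;> apply hu <;> omega

/-- The lower end of the range of apices used by a layer. -/
def loLevel (e₁ e₂ : ℤ) (t : ℕ) : ℤ := if t ≤ 1 then 0 else if t ≤ 4 then e₁ else e₁ + e₂

/-- The upper end of the range of apices used by a layer. -/
def hiLevel (e₁ e₂ : ℤ) (t : ℕ) : ℤ := if t = 0 then 0 else if t ≤ 3 then e₁ else e₁ + e₂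

theorem loLevel_le_hiLevel (h₁ : 0 ≤ e₁) (h₂ : 0 ≤ e₂) (t : ℕ) :
    loLevel e₁ e₂ t ≤ hiLevel e₁ e₂ t := by
  unfold loLevel hiLevel; split_ifs <;> omega

theorem hiLevel_le_loLevel (h₁ : 0 ≤ e₁) (h₂ : 0 ≤ e₂) (ht : t < t') :
    hiLevel e₁ e₂ t ≤ loLevel e₁ e₂ t' := by
  unfold loLevel hiLevel; split_ifs <;> omega

/-- At a corner of the base parallelogram, the apices used are adjacent to the corner. -/
theorem Piece.corner (hq : 0 < q) (h₁ : 0 ≤ e₁) (h₁' : e₁ ≤ 1) (h₂ : 0 ≤ e₂) (h₂' : e₂ ≤ 1)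
    (h : Piece q p e₁ e₂ t F) {v : ℤ × ℤ} (hv : v ∈ F) (hx : v.1 = 0 ∨ v.1 = q) :
    ∃ b κ : ℤ, 0 ≤ b ∧ b ≤ 1 ∧ 0 ≤ κ ∧ κ ≤ 1 ∧ v.1 = q * b ∧ v.2 = p * b + κ ∧
      e₁ - 1 + κ ≤ loLevel e₁ e₂ t ∧ hiLevel e₁ e₂ t ≤ e₁ + κ := by
  have hcor : ∀ (g : ℤ → ℤ) (κ x : ℤ), 0 ≤ κ → κ ≤ 1 → g 0 = κ → g q = p + κ →
      e₁ - 1 + κ ≤ loLevel e₁ e₂ t → hiLevel e₁ e₂ t ≤ e₁ + κ → v = (x, g x) →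
      ∃ b κ : ℤ, 0 ≤ b ∧ b ≤ 1 ∧ 0 ≤ κ ∧ κ ≤ 1 ∧ v.1 = q * b ∧ v.2 = p * b + κ ∧
      e₁ - 1 + κ ≤ loLevel e₁ e₂ t ∧ hiLevel e₁ e₂ t ≤ e₁ + κ := by
    rintro g κ x k0 k1 g0 g1 hl hh rfl
    rcases hx with hx | hx <;> dsimp only at hx <;> subst hx
    · exact ⟨0, κ, le_rfl, zero_le_one, k0, k1, by simp, by simp [g0], hl, hh⟩
    · exact ⟨1, κ, zero_le_one, le_rfl, k0, k1, by simp, by simp [g1], hl, hh⟩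
  cases h with
  | lowCap h =>
    rcases hv with e | e | e <;>
      exact hcor (lowPath q p) 0 _ le_rfl zero_le_one lowPath_zero
        (by rw [lowPath_right hq, add_zero]) (by simp [loLevel]; omega) (by simp [hiLevel]; omega) e
  | lowEdge x he h0 h1 =>
    rcases hv with e | e <;>
      exact hcor (lowPath q p) 0 _ le_rfl zero_le_one lowPath_zero
        (by rw [lowPath_right hq, add_zero]) (by simp [loLevel]; omega) (by simp [hiLevel]) e
  | leftTri =>
    rcases hv with rfl | rfl | rfl
    · exact ⟨0, 0, by simp [loLevel, hiLevel]⟩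
    · exact ⟨0, 1, by simp [loLevel, hiLevel]⟩
    · exact hcor (lowPath q p) 0 1 le_rfl zero_le_one lowPath_zero
        (by rw [lowPath_right hq, add_zero]) (by simp [loLevel]) (by simp [hiLevel])
        (by rw [midPath_of_ne one_ne_zero])
  | rightTri =>
    rcases hv with rfl | rfl | rfl
    · exact ⟨1, 0, by simp [loLevel, hiLevel]⟩
    · exact ⟨1, 1, by simp [loLevel, hiLevel]⟩
    · exact hcor (upPath q p) 1 (q - 1) zero_le_one le_rfl (upPath_zero hq) (upPath_right hq)
        (by simp [loLevel]) (by simp [hiLevel])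
        (by rw [upPath_of_ne (show q - 1 ≠ q by omega)])
  | upEdge x he h0 h1 =>
    rcases hv with e | e <;>
      exact hcor (upPath q p) 1 _ zero_le_one le_rfl (upPath_zero hq) (upPath_right hq)
        (by simp [loLevel]) (by simp [hiLevel]; omega) e
  | upCap h =>
    rcases hv with e | e | e <;>
      exact hcor (upPath q p) 1 _ zero_le_one le_rfl (upPath_zero hq) (upPath_right hq)
        (by simp [loLevel]; omega) (by simp [hiLevel]; omega) e

end Pieces

section Lift

theorem image_hull {E E' : Type*} [AddCommGroup E] [Module ℝ E] [AddCommGroup E'] [Module ℝ E']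
    {φ : E → E'} (hφ : ∀ (x y : E) (a b : ℝ), a + b = 1 → φ (a • x + b • y) = a • φ x + b • φ y)
    (V : Set E) : convexHull ℝ (φ '' V) = φ '' convexHull ℝ V := by
  refine Set.Subset.antisymm
    (convexHull_min (Set.image_mono (subset_convexHull ℝ V)) ?_) ?_
  · rintro _ ⟨x, hx, rfl⟩ _ ⟨y, hy, rfl⟩ a b ha hb hab
    exact ⟨_, convex_convexHull ℝ V hx hy ha hb hab, hφ x y a b hab⟩
  · rintro _ ⟨x, hx, rfl⟩
    have hc : Convex ℝ (φ ⁻¹' convexHull ℝ (φ '' V)) := by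
      intro x hx y hy a b ha hb hab
      rw [Set.mem_preimage, hφ x y a b hab]
      exact convex_convexHull ℝ _ hx hy ha hb hab
    have hV : V ⊆ φ ⁻¹' convexHull ℝ (φ '' V) := fun v hv =>
      subset_convexHull ℝ (φ '' V) (Set.mem_image_of_mem φ hv)
    exact convexHull_min hV hc hx

theorem rcast_injective : Function.Injective rcast := by
  intro x y h
  funext i
  have := congrFun h i
  simpa [rcast] using this

/-- Points of the horizontal plane through `O`. -/
def basePt (O : Fin 3 → ℤ) (P : ℤ × ℤ) : Fin 3 → ℤ := ![O 0 + P.1, O 1 + P.2, O 2]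

/-- Points of the line through `C` in the second coordinate direction. -/
def apexPt (C : Fin 3 → ℤ) (θ : ℤ) : Fin 3 → ℤ := ![C 0, C 1 + θ, C 2]

/-- The join of a planar configuration over `O` with a linear one over `C`. -/
def joinSet (O C : Fin 3 → ℤ) (F : Set (ℤ × ℤ)) (A : Set ℤ) : Set (Fin 3 → ℤ) :=
  basePt O '' F ∪ apexPt C '' A

/-- Real version of `basePt`. -/
def basePtR (O : Fin 3 → ℤ) (P : ℝ × ℝ) : Fin 3 → ℝ := ![O 0 + P.1, O 1 + P.2, O 2]

/-- Real version of `apexPt`. -/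
def apexPtR (C : Fin 3 → ℤ) (θ : ℝ) : Fin 3 → ℝ := ![C 0, C 1 + θ, C 2]

theorem rcast_basePt (O : Fin 3 → ℤ) (P : ℤ × ℤ) : rcast (basePt O P) = basePtR O (rcast₂ P) := by
  funext i
  fin_cases i <;> simp [rcast, basePt, basePtR, rcast₂]

theorem rcast_apexPt (C : Fin 3 → ℤ) (θ : ℤ) : rcast (apexPt C θ) = apexPtR C θ := by
  funext i
  fin_cases i <;> simp [rcast, apexPt, apexPtR]

variable {O C : Fin 3 → ℤ} {F F' : Set (ℤ × ℤ)} {A A' : Set ℤ}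

/-- The convex hull of a set of integers. -/
def hull₁ (A : Set ℤ) : Set ℝ := convexHull ℝ ((fun n : ℤ => (n : ℝ)) '' A)

theorem hull_basePt (O : Fin 3 → ℤ) (F : Set (ℤ × ℤ)) :
    convexHull ℝ (rcast '' (basePt O '' F)) = basePtR O '' hull₂ F := by
  rw [hull₂, ← image_hull, Set.image_image, Set.image_image]
  · simp only [rcast_basePt]
  · intro x y a b hab
    obtain rfl : b = 1 - a := by linarith
    funext i
    fin_cases i <;> simp [basePtR] <;> ring

theorem hull_apexPt (C : Fin 3 → ℤ) (A : Set ℤ) :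
    convexHull ℝ (rcast '' (apexPt C '' A)) = apexPtR C '' hull₁ A := by
  rw [hull₁, ← image_hull, Set.image_image, Set.image_image]
  · simp only [rcast_apexPt]
  · intro x y a b hab
    obtain rfl : b = 1 - a := by linarith
    funext i
    fin_cases i <;> simp [apexPtR] <;> ring

theorem basePtR_mem {P : ℝ × ℝ} (hP : P ∈ hull₂ F) :
    basePtR O P ∈ convexHull ℝ (rcast '' joinSet O C F A) :=
  convexHull_mono (Set.image_mono Set.subset_union_left)
    (by rw [hull_basePt]; exact Set.mem_image_of_mem _ hP)

theorem apexPtR_mem {θ : ℝ} (hθ : θ ∈ hull₁ A) :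
    apexPtR C θ ∈ convexHull ℝ (rcast '' joinSet O C F A) :=
  convexHull_mono (Set.image_mono Set.subset_union_right)
    (by rw [hull_apexPt]; exact Set.mem_image_of_mem _ hθ)

theorem join_mem {P : ℝ × ℝ} {θ ρ : ℝ} (hP : P ∈ hull₂ F) (hθ : θ ∈ hull₁ A) (h0 : 0 ≤ ρ)
    (h1 : ρ ≤ 1) :
    (1 - ρ) • basePtR O P + ρ • apexPtR C θ ∈ convexHull ℝ (rcast '' joinSet O C F A) :=
  convex_convexHull ℝ _ (basePtR_mem hP) (apexPtR_mem hθ) (by linarith) h0 (by ring)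

theorem exists_of_mem_join (hF : F.Nonempty) (hA : A.Nonempty) {x : Fin 3 → ℝ}
    (hx : x ∈ convexHull ℝ (rcast '' joinSet O C F A)) :
    ∃ P ∈ hull₂ F, ∃ θ ∈ hull₁ A, ∃ ρ : ℝ, 0 ≤ ρ ∧ ρ ≤ 1 ∧
      x = (1 - ρ) • basePtR O P + ρ • apexPtR C θ := by
  rw [joinSet, Set.image_union, convexHull_union ((hF.image _).image _) ((hA.image _).image _),
    mem_convexJoin] at hx
  obtain ⟨u, hu, w, hw, hx⟩ := hx
  rw [hull_basePt] at hu
  rw [hull_apexPt] at hw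
  obtain ⟨P, hP, rfl⟩ := hu
  obtain ⟨θ, hθ, rfl⟩ := hw
  obtain ⟨a, b, ha, hb, hab, rfl⟩ := hx
  obtain rfl : a = 1 - b := by linarith
  exact ⟨P, hP, θ, hθ, b, hb, by linarith, rfl⟩

theorem joinSet_inter : joinSet O C (F ∩ F') (A ∩ A') ⊆ joinSet O C F A ∩ joinSet O C F' A' := by
  rintro _ (⟨v, hv, rfl⟩ | ⟨v, hv, rfl⟩)
  · exact ⟨Or.inl ⟨v, hv.1, rfl⟩, Or.inl ⟨v, hv.2, rfl⟩⟩
  · exact ⟨Or.inr ⟨v, hv.1, rfl⟩, Or.inr ⟨v, hv.2, rfl⟩⟩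

/-- Two joins over the same centres are proper if the order of the bases along the second
coordinate is compatible with that of the apices. -/
theorem proper_join (hF : F.Nonempty) (hA : A.Nonempty) (hF' : F'.Nonempty) (hA' : A'.Nonempty)
    (hOC : O 2 ≠ C 2) (pF : Proper (rcast₂ '' F) (rcast₂ '' F'))
    (pA : Proper ((fun n : ℤ => (n : ℝ)) '' A) ((fun n : ℤ => (n : ℝ)) '' A'))
    (hord : ∀ P ∈ hull₂ F, ∀ P' ∈ hull₂ F', ∀ θ ∈ hull₁ A, ∀ θ' ∈ hull₁ A', P.1 = P'.1 →
      (P.2 ≤ P'.2 ∧ θ ≤ θ') ∨ (P'.2 ≤ P.2 ∧ θ' ≤ θ)) :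
    Proper (rcast '' joinSet O C F A) (rcast '' joinSet O C F' A') := by
  rintro x ⟨hx, hx'⟩
  obtain ⟨P, hP, θ, hθ, ρ, h0, h1, rfl⟩ := exists_of_mem_join hF hA hx
  obtain ⟨P', hP', θ', hθ', ρ', h0', h1', e⟩ := exists_of_mem_join hF' hA' hx'
  have e0 := congrFun e 0
  have e1 := congrFun e 1
  have e2 := congrFun e 2
  simp only [basePtR, apexPtR, Pi.add_apply, Pi.smul_apply, smul_eq_mul,
      Matrix.cons_val] at e0 e1 e2
  obtain rfl : ρ = ρ' := by
    have hne : (C 2 : ℝ) - O 2 ≠ 0 := sub_ne_zero.2 (by exact_mod_cast hOC.symm)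
    apply mul_right_cancel₀ hne
    linarith
  rw [← Set.image_inter rcast_injective]
  refine convexHull_mono (Set.image_mono joinSet_inter) ?_
  have kF : P = P' → P ∈ hull₂ (F ∩ F') := by
    rintro rfl
    have := pF ⟨hP, hP'⟩
    rwa [← Set.image_inter rcast₂_injective] at this
  have kA : θ = θ' → θ ∈ hull₁ (A ∩ A') := by
    rintro rfl
    have := pA ⟨hθ, hθ'⟩
    rwa [← Set.image_inter Int.cast_injective] at this
  rcases eq_or_lt_of_le h0 with rfl | h0
  · have : P = P' := Prod.ext (by linarith) (by linarith)
    simpa using basePtR_mem (kF this)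
  rcases eq_or_lt_of_le h1 with rfl | h1
  · have : θ = θ' := by linarith
    simpa using apexPtR_mem (kA this)
  have eX : P.1 = P'.1 := by
    apply mul_left_cancel₀ (sub_pos.2 h1).ne'
    linarith
  have key : P.2 = P'.2 ∧ θ = θ' := by
    rcases hord P hP P' hP' θ hθ θ' hθ' eX with ⟨h2, h3⟩ | ⟨h2, h3⟩
    · have h4 := mul_nonneg (sub_pos.2 h1).le (sub_nonneg.2 h2)
      have h5 := mul_nonneg h0.le (sub_nonneg.2 h3)
      constructor
      · apply mul_left_cancel₀ (sub_pos.2 h1).ne'; linarith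
      · apply mul_left_cancel₀ h0.ne'; linarith
    · have h4 := mul_nonneg (sub_pos.2 h1).le (sub_nonneg.2 h2)
      have h5 := mul_nonneg h0.le (sub_nonneg.2 h3)
      constructor
      · apply mul_left_cancel₀ (sub_pos.2 h1).ne'; linarith
      · apply mul_left_cancel₀ h0.ne'; linarith
  exact join_mem (kF (Prod.ext eX key.1)) (kA key.2) h0.le h1.le

end Lift

section Cell

variable {q p e₁ e₂ : ℤ} {t t' : ℕ} {F F' : Set (ℤ × ℤ)} {O C : Fin 3 → ℤ}

/-- The apices over the layer `t`. -/
def levels (e₁ e₂ : ℤ) (t : ℕ) : Set ℤ := {loLevel e₁ e₂ t, hiLevel e₁ e₂ t}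

theorem mem_hull₁_levels (h₁ : 0 ≤ e₁) (h₂ : 0 ≤ e₂) {θ : ℝ} :
    θ ∈ hull₁ (levels e₁ e₂ t) ↔ (loLevel e₁ e₂ t : ℝ) ≤ θ ∧ θ ≤ hiLevel e₁ e₂ t := by
  rw [hull₁, levels, Set.image_pair, convexHull_pair, segment_eq_Icc, Set.mem_Icc]
  exact_mod_cast loLevel_le_hiLevel h₁ h₂ t

theorem proper_levels (h₁ : 0 ≤ e₁) (h₂ : 0 ≤ e₂) (ht : t < t') :
    Proper ((fun n : ℤ => (n : ℝ)) '' levels e₁ e₂ t)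
      ((fun n : ℤ => (n : ℝ)) '' levels e₁ e₂ t') := by
  have ha : (loLevel e₁ e₂ t : ℝ) ≤ hiLevel e₁ e₂ t := by
    exact_mod_cast loLevel_le_hiLevel h₁ h₂ t
  have hb : (loLevel e₁ e₂ t' : ℝ) ≤ hiLevel e₁ e₂ t' := by
    exact_mod_cast loLevel_le_hiLevel h₁ h₂ t'
  have hc : (hiLevel e₁ e₂ t : ℝ) ≤ loLevel e₁ e₂ t' := by
    exact_mod_cast hiLevel_le_loLevel h₁ h₂ ht
  have hh : IsAff (fun x : ℝ => x - hiLevel e₁ e₂ t) := by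
    intro x y a b hab
    simp only [smul_eq_mul]
    linear_combination (hiLevel e₁ e₂ t : ℝ) * hab
  refine Proper.of_sep hh ?_ ?_
    (proper_of_subsingleton (p := (hiLevel e₁ e₂ t : ℝ)) ?_ ?_)
  · rintro _ ⟨v, rfl | rfl, rfl⟩ <;> simp [ha]
  · rintro _ ⟨v, rfl | rfl, rfl⟩ <;> dsimp only <;> linarith
  · rintro v ⟨-, hv⟩; exact sub_eq_zero.1 hv
  · rintro v ⟨-, hv⟩; exact sub_eq_zero.1 hv

theorem Piece.proper_join_of_lt (hq : 0 < q) (h₁ : 0 ≤ e₁) (h₂ : 0 ≤ e₂)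
    (hOC : O 2 ≠ C 2) (h : Piece q p e₁ e₂ t F) (h' : Piece q p e₁ e₂ t' F') (ht : t < t') :
    Proper (rcast '' joinSet O C F (levels e₁ e₂ t))
        (rcast '' joinSet O C F' (levels e₁ e₂ t')) := by
  refine proper_join h.nonempty ⟨_, Or.inl rfl⟩ h'.nonempty ⟨_, Or.inl rfl⟩ hOC
    (h.proper_of_lt hq h' ht) (proper_levels h₁ h₂ ht) ?_
  intro P hP P' hP' θ hθ θ' hθ' e
  left
  rw [mem_hull₁_levels h₁ h₂] at hθ hθ'
  have hc : (hiLevel e₁ e₂ t : ℝ) ≤ loLevel e₁ e₂ t' := by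
    exact_mod_cast hiLevel_le_loLevel h₁ h₂ ht
  exact ⟨(h.side_top hq (by have := h'.le_five; omega)).le (h'.side_bot_of_lt hq ht) hP hP' e,
    by linarith⟩

theorem Piece.proper_join (hq : 0 < q) (hpq : IsCoprime p q) (h₁ : 0 ≤ e₁) (h₂ : 0 ≤ e₂)
    (hOC : O 2 ≠ C 2) (h : Piece q p e₁ e₂ t F) (h' : Piece q p e₁ e₂ t' F') :
    Proper (rcast '' joinSet O C F (levels e₁ e₂ t))
        (rcast '' joinSet O C F' (levels e₁ e₂ t')) := by
  rcases lt_trichotomy t t' with ht | rfl | ht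
  · exact h.proper_join_of_lt hq h₁ h₂ hOC h' ht
  · refine _root_.proper_join h.nonempty ⟨_, Or.inl rfl⟩ h'.nonempty ⟨_, Or.inl rfl⟩ hOC
      (h.proper hq hpq h') (proper_self _) ?_
    intro P hP P' hP' θ hθ θ' hθ' e
    rw [mem_hull₁_levels h₁ h₂] at hθ hθ'
    have key : loLevel e₁ e₂ t = hiLevel e₁ e₂ t ∨ P.2 = P'.2 := by
      by_cases ht : t = 1 ∨ t = 4
      · right
        have hp : topPath q p t = botPath q p t := by
          rcases ht with rfl | rfl <;> simp [topPath, botPath]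
        have a := h.side_top hq (by omega)
        have a' := h'.side_top hq (by omega)
        have b := h.side_bot hq (by omega)
        have b' := h'.side_bot hq (by omega)
        rw [← hp] at b b'
        exact le_antisymm (a.le b' hP hP' e) (a'.le b hP' hP e.symm)
      · left
        have := h.le_five
        push Not at ht
        unfold loLevel hiLevel
        split_ifs <;> omega
    rcases key with k | k
    · rw [k] at hθ hθ'
      rcases le_total P.2 P'.2 with h3 | h3
      · left; exact ⟨h3, by linarith⟩
      · right; exact ⟨h3, by linarith⟩
    · rcases le_total θ θ' with h3 | h3
      · left; exact ⟨k.le, h3⟩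
      · right; exact ⟨k.ge, h3⟩
  · exact (h'.proper_join_of_lt hq h₁ h₂ hOC h ht).symm

end Cell

section Unimodular

/-- The determinant of the edge vectors of a lattice tetrahedron. -/
def edgeDet (s : Fin 4 → Fin 3 → ℤ) : ℤ :=
  Matrix.det (Matrix.of fun i j : Fin 3 => s i.succ j - s 0 j)

/-- The vertex sets of unimodular lattice tetrahedra. -/
def Unimod (V : Set (Fin 3 → ℤ)) : Prop :=
  ∃ s : Fin 4 → Fin 3 → ℤ, Set.range s = V ∧ (edgeDet s).natAbs = 1

theorem range_four {α : Type*} (a b c d : α) : Set.range ![a, b, c, d] = {a, b, c, d} := by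
  simp only [Matrix.range_cons, Matrix.range_empty, Set.union_empty, Set.singleton_union]

theorem edgeDet_vec (a b c d : Fin 3 → ℤ) : edgeDet ![a, b, c, d] =
    (b 0 - a 0) * ((c 1 - a 1) * (d 2 - a 2) - (c 2 - a 2) * (d 1 - a 1)) -
    (b 1 - a 1) * ((c 0 - a 0) * (d 2 - a 2) - (c 2 - a 2) * (d 0 - a 0)) +
    (b 2 - a 2) * ((c 0 - a 0) * (d 1 - a 1) - (c 1 - a 1) * (d 0 - a 0)) := by
  rw [edgeDet, Matrix.det_fin_three]
  simp only [Matrix.of_apply]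
  simp only [show Fin.succ (0 : Fin 3) = 1 from rfl, show Fin.succ (1 : Fin 3) = 2 from rfl,
    show Fin.succ (2 : Fin 3) = 3 from rfl, Matrix.cons_val]
  ring

variable {O C : Fin 3 → ℤ}

theorem unimod_join_three {a b c : ℤ × ℤ} (hOC : (O 2 - C 2).natAbs = 1)
    (hd : ((b.1 - a.1) * (c.2 - a.2) - (b.2 - a.2) * (c.1 - a.1)).natAbs = 1) (l : ℤ) :
    Unimod (joinSet O C {a, b, c} {l, l}) := by
  refine ⟨![apexPt C l, basePt O a, basePt O b, basePt O c], ?_, ?_⟩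
  · rw [range_four, joinSet, Set.image_insert_eq, Set.image_pair, Set.pair_eq_singleton,
      Set.image_singleton, Set.union_singleton]
  · rw [edgeDet_vec]
    simp only [apexPt, basePt, Matrix.cons_val]
    have e := Int.natAbs_mul (O 2 - C 2)
      ((b.1 - a.1) * (c.2 - a.2) - (b.2 - a.2) * (c.1 - a.1))
    rw [hOC, hd, one_mul] at e
    rw [← e]
    congr 1
    ring

theorem unimod_join_two {x y y' l : ℤ} (hOC : (O 2 - C 2).natAbs = 1) :
    Unimod (joinSet O C {(x, y), (x + 1, y')} {l, l + 1}) := by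
  refine ⟨![basePt O (x, y), basePt O (x + 1, y'), apexPt C l, apexPt C (l + 1)], ?_, ?_⟩
  · rw [range_four, joinSet, Set.image_pair, Set.image_pair, Set.insert_union, Set.singleton_union]
  · rw [edgeDet_vec, ← hOC]
    simp only [apexPt, basePt, Matrix.cons_val]
    congr 1
    ring

variable {q p e₁ e₂ : ℤ} {t : ℕ} {F : Set (ℤ × ℤ)}

theorem Piece.unimod (hq : 0 < q) (hpq : IsCoprime p q)
    (hOC : (O 2 - C 2).natAbs = 1) (h : Piece q p e₁ e₂ t F) :
    Unimod (joinSet O C F (levels e₁ e₂ t)) := by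
  cases h with
  | lowCap h =>
    exact unimod_join_three hOC (h.det_eq (closePath_lowPath hq hpq)) 0
  | lowEdge x he =>
    have := unimod_join_two (x := x) (y := lowPath q p x) (y' := lowPath q p (x + 1)) (l := 0) hOC
    simpa [levels, loLevel, hiLevel, he] using this
  | leftTri => exact unimod_join_three hOC (by simp) e₁
  | rightTri => exact unimod_join_three hOC (by simp) e₁
  | upEdge x he =>
    have := unimod_join_two (x := x) (y := upPath q p x) (y' := upPath q p (x + 1)) (l := e₁) hOC
    simpa [levels, loLevel, hiLevel, he] using this
  | upCap h => exact unimod_join_three hOC (h.det_eq (closePath_upPath hq hpq)) (e₁ + e₂)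

end Unimodular

section Cover

theorem exists_unit_interval {q : ℤ} (hq : 0 < q) {X : ℝ} (h0 : 0 ≤ X) (h1 : X ≤ q) :
    ∃ x : ℤ, 0 ≤ x ∧ x < q ∧ (x : ℝ) ≤ X ∧ X ≤ x + 1 := by
  rcases eq_or_lt_of_le h1 with rfl | h1
  · exact ⟨q - 1, by omega, by omega, by push_cast; linarith, by push_cast; linarith⟩
  · exact ⟨⌊X⌋, Int.floor_nonneg.2 h0, Int.floor_lt.2 h1, Int.floor_le X,
      (Int.lt_floor_add_one X).le⟩

theorem mem_hull_edge (g : ℤ → ℤ) {X : ℝ} {x : ℤ} (h0 : (x : ℝ) ≤ X) (h1 : X ≤ x + 1) :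
    ((X, interp g X) : ℝ × ℝ) ∈ hull₂ {(x, g x), (x + 1, g (x + 1))} := by
  refine mem_hull_triple (a := rcast₂ (x, g x)) (b := rcast₂ (x + 1, g (x + 1)))
    (c := rcast₂ (x, g x)) (u := 1 - (X - x)) (v := X - x) (w := 0)
    ⟨_, Or.inl rfl, rfl⟩ ⟨_, Or.inr rfl, rfl⟩ ⟨_, Or.inl rfl, rfl⟩
    (by linarith) (by linarith) le_rfl (by ring) ?_
  rw [interp_eq g h0 h1]
  ext <;> simp [rcast₂] <;> ring

theorem exists_level {y τ a G : ℝ} (hτ : 0 ≤ τ) (h0 : G ≤ y - τ * a) (h1 : y - τ * (a + 1) ≤ G) :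
    ∃ θ, a ≤ θ ∧ θ ≤ a + 1 ∧ y - τ * θ = G := by
  rcases eq_or_lt_of_le hτ with rfl | hτ
  · exact ⟨a, le_rfl, by linarith, by linarith⟩
  · refine ⟨(y - G) / τ, ?_, ?_, ?_⟩
    · rw [le_div_iff₀ hτ]; linarith
    · rw [div_le_iff₀ hτ]; linarith
    · field_simp; ring

variable {q p e₁ e₂ : ℤ}

theorem interp_midPath_eq {X : ℝ} (h : 1 < X) :
    interp (midPath q p) X = interp (lowPath q p) X := by
  have h1 : 1 ≤ ⌊X⌋ := Int.le_floor.2 (by exact_mod_cast h.le)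
  rw [interp, interp, midPath_of_ne (by omega), midPath_of_ne (by omega)]

theorem interp_upPath_eq {X : ℝ} (h : X < q - 1) :
    interp (upPath q p) X = interp (midPath q p) X := by
  have h1 : ⌊X⌋ < q - 1 := Int.floor_lt.2 (by exact_mod_cast h)
  rw [interp, interp, upPath_of_ne (by omega), upPath_of_ne (by omega)]

theorem exists_piece_of_heights (hq : 0 < q) (hpq : IsCoprime p q) (h₁ : e₁ = 0 ∨ e₁ = 1)
    (h₂ : e₂ = 0 ∨ e₂ = 1) {X y τ : ℝ} (hX : 0 ≤ X) (hX' : X ≤ q) (hτ : 0 ≤ τ)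
    (hy : 0 ≤ q * y - p * X) (hy' : q * y - p * X ≤ q + q * (e₁ + e₂) * τ) :
    ∃ t F, Piece q p e₁ e₂ t F ∧ ∃ θ : ℝ, (loLevel e₁ e₂ t : ℝ) ≤ θ ∧ θ ≤ hiLevel e₁ e₂ t ∧
      ((X, y - τ * θ) : ℝ × ℝ) ∈ hull₂ F := by
  have hq' : (0 : ℝ) < q := by exact_mod_cast hq
  obtain ⟨x, hx0, hx1, hxX, hXx⟩ := exists_unit_interval hq hX hX'
  by_cases hA : 2 ≤ q ∧ y ≤ interp (lowPath q p) X
  · obtain ⟨i, j, k, hc, hP⟩ := exists_capTri (P := (X, y)) hA.1 (closePath_lowPath hq hpq) hX hX'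
      (by push_cast; simpa using hy) (by simpa using hA.2)
    exact ⟨0, _, Piece.lowCap hc, 0, by simp [loLevel], by simp [hiLevel], by simpa using hP⟩
  have hlow : interp (lowPath q p) X ≤ y := by
    rcases le_or_gt 2 q with h | h
    · by_contra! h'
      exact hA ⟨h, h'.le⟩
    · obtain rfl : q = 1 := by omega
      have hr : lowPath 1 p 1 = p := lowPath_right one_pos
      rw [interp_eq (lowPath 1 p) (x := 0) (by simpa using hX) (by simpa using hX'), zero_add, hr,
        lowPath_zero]
      push_cast at hy ⊢
      linarith
  by_cases hB : e₁ = 1 ∧ y - τ ≤ interp (lowPath q p) X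
  · obtain ⟨θ, h3, h4, h5⟩ := exists_level (y := y) (a := 0) hτ (by simpa using hlow)
      (by simpa using hB.2)
    refine ⟨1, _, Piece.lowEdge x hB.1 hx0 hx1, θ, by simpa [loLevel] using h3,
      by simpa [hiLevel, hB.1] using h4, ?_⟩
    rw [h5]
    exact mem_hull_edge _ hxX hXx
  have hlow' : interp (lowPath q p) X ≤ y - τ * e₁ := by
    rcases h₁ with rfl | rfl
    · simpa using hlow
    · simp only [true_and, not_le] at hB
      simpa using hB.le
  by_cases hC : X ≤ 1 ∧ y - τ * e₁ ≤ interp (midPath q p) X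
  · refine ⟨2, _, Piece.leftTri, e₁, by simp [loLevel], by simp [hiLevel], ?_⟩
    have e1 := interp_eq (lowPath q p) (x := 0) (by simpa using hX) (by simpa using hC.1)
    have e2 := interp_eq (midPath q p) (x := 0) (by simpa using hX) (by simpa using hC.1)
    rw [lowPath_zero, zero_add, ← midPath_of_ne one_ne_zero] at e1
    rw [midPath_zero, zero_add] at e2
    push_cast at e1 e2
    refine mem_hull_triple (a := rcast₂ (0, 0)) (b := rcast₂ (0, 1))
      (c := rcast₂ (1, midPath q p 1)) (u := 1 - X - (y - τ * e₁ - X * midPath q p 1))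
      (v := y - τ * e₁ - X * midPath q p 1) (w := X) ⟨_, Or.inl rfl, rfl⟩
      ⟨_, Or.inr (Or.inl rfl), rfl⟩ ⟨_, Or.inr (Or.inr rfl), rfl⟩
      (by linarith [hC.2]) (by linarith) hX (by ring) ?_
    ext <;> simp [rcast₂]
  have hmid : interp (midPath q p) X ≤ y - τ * e₁ := by
    rcases le_or_gt X 1 with h | h
    · by_contra! h'
      exact hC ⟨h, h'.le⟩
    · rwa [interp_midPath_eq h]
  by_cases hD : (q : ℝ) - 1 ≤ X ∧ y - τ * e₁ ≤ interp (upPath q p) X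
  · refine ⟨3, _, Piece.rightTri, e₁, by simp [loLevel], by simp [hiLevel], ?_⟩
    have e1 := interp_eq (midPath q p) (X := X) (x := q - 1) (by push_cast; linarith [hD.1])
      (by push_cast; linarith)
    have e2 := interp_eq (upPath q p) (X := X) (x := q - 1) (by push_cast; linarith [hD.1])
      (by push_cast; linarith)
    rw [sub_add_cancel, midPath_right hq] at e1
    rw [sub_add_cancel, upPath_right hq, upPath_of_ne (by omega)] at e2
    push_cast at e1 e2
    refine mem_hull_triple (a := rcast₂ (q, p)) (b := rcast₂ (q, p + 1))
      (c := rcast₂ (q - 1, midPath q p (q - 1)))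
      (u := X - (q - 1) - (y - τ * e₁ - interp (midPath q p) X))
      (v := y - τ * e₁ - interp (midPath q p) X) (w := q - X) ⟨_, Or.inl rfl, rfl⟩
      ⟨_, Or.inr (Or.inl rfl), rfl⟩ ⟨_, Or.inr (Or.inr rfl), rfl⟩
      (by linarith [hD.2]) (by linarith) (by linarith) (by ring) ?_
    rw [e1]
    ext <;> simp [rcast₂] <;> ring
  have hup : interp (upPath q p) X ≤ y - τ * e₁ := by
    rcases le_or_gt ((q : ℝ) - 1) X with h | h
    · by_contra! h'
      exact hD ⟨h, h'.le⟩
    · rwa [interp_upPath_eq h]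
  by_cases hE : e₂ = 1 ∧ y - τ * (e₁ + 1) ≤ interp (upPath q p) X
  · obtain ⟨θ, h3, h4, h5⟩ := exists_level hτ hup hE.2
    refine ⟨4, _, Piece.upEdge x hE.1 hx0 hx1, θ, by simpa [loLevel] using h3,
      by simpa [hiLevel, hE.1] using h4, ?_⟩
    rw [h5]
    exact mem_hull_edge _ hxX hXx
  have hup' : interp (upPath q p) X ≤ y - τ * (e₁ + e₂) := by
    rcases h₂ with rfl | rfl
    · simpa using hup
    · simp only [true_and, not_le] at hE
      simpa using hE.le
  have hq2 : 2 ≤ q := by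
    by_contra! h
    obtain rfl : q = 1 := by omega
    have hr : upPath 1 p 1 = p + 1 := upPath_right one_pos
    have e1 := interp_eq (upPath 1 p) (x := 0) (by simpa using hX) (by simpa using hX')
    rw [zero_add, hr, upPath_zero one_pos] at e1
    push_cast at e1 hy' hD
    rcases h₂ with rfl | rfl
    · exact hD ⟨by linarith, by push_cast at hy'; linarith⟩
    · exact hE ⟨rfl, by push_cast at hy'; linarith⟩
  obtain ⟨i, j, k, hc, hP⟩ := exists_capTri (P := (X, y - τ * (e₁ + e₂))) hq2
    (closePath_upPath hq hpq) hX hX' (by push_cast; linarith)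
    (by push_cast; linarith)
  exact ⟨5, _, Piece.upCap hc, e₁ + e₂, by simp [loLevel], by simp [hiLevel], hP⟩

theorem exists_piece_cover (hq : 0 < q) (hpq : IsCoprime p q) (h₁ : e₁ = 0 ∨ e₁ = 1)
    (h₂ : e₂ = 0 ∨ e₂ = 1) {u w ρ : ℝ} (h0 : 0 ≤ ρ) (h1 : ρ ≤ 1) (hu : 0 ≤ u)
    (hu' : u ≤ q * (1 - ρ)) (hw : 0 ≤ q * w - p * u)
    (hw' : q * w - p * u ≤ q * (1 - ρ) + q * (e₁ + e₂) * ρ) :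
    ∃ t F, Piece q p e₁ e₂ t F ∧ ∃ P ∈ hull₂ F, ∃ θ ∈ hull₁ (levels e₁ e₂ t),
      u = (1 - ρ) * P.1 ∧ w = (1 - ρ) * P.2 + ρ * θ := by
  have hq' : (0 : ℝ) < q := by exact_mod_cast hq
  have k₁ : 0 ≤ e₁ := by omega
  have k₂ : 0 ≤ e₂ := by omega
  simp only [mem_hull₁_levels k₁ k₂]
  rcases eq_or_lt_of_le h1 with rfl | h1
  · obtain rfl : u = 0 := by linarith
    have hw0 : 0 ≤ w := by
      by_contra! h
      nlinarith
    have hw1 : w ≤ e₁ + e₂ := by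
      by_contra! h
      nlinarith
    have key : ∃ t F, Piece q p e₁ e₂ t F ∧ (loLevel e₁ e₂ t : ℝ) ≤ w ∧ w ≤ hiLevel e₁ e₂ t := by
      by_cases hA : e₁ = 1 ∧ w ≤ 1
      · refine ⟨1, _, Piece.lowEdge 0 hA.1 le_rfl hq, ?_, ?_⟩
        · simpa [loLevel] using hw0
        · simpa [hiLevel, hA.1] using hA.2
      rcases h₂ with rfl | rfl
      · obtain rfl : e₁ = 0 := by
          rcases h₁ with h | rfl
          · exact h
          · exact absurd ⟨rfl, by simpa using hw1⟩ hA
        refine ⟨2, _, Piece.leftTri, ?_, ?_⟩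
        · simpa [loLevel] using hw0
        · simpa [hiLevel] using hw1
      · refine ⟨4, _, Piece.upEdge 0 rfl le_rfl hq, ?_, ?_⟩
        · rcases h₁ with rfl | rfl
          · simpa [loLevel] using hw0
          · simp only [true_and, not_le] at hA
            simpa [loLevel] using hA.le
        · simpa [hiLevel] using hw1
    obtain ⟨t, F, hF, h2, h3⟩ := key
    obtain ⟨v, hv⟩ := hF.nonempty
    exact ⟨t, F, hF, rcast₂ v, subset_convexHull ℝ _ ⟨v, hv, rfl⟩, w, ⟨h2, h3⟩, by ring, by ring⟩
  · have hs : 0 < 1 - ρ := by linarith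
    obtain ⟨t, F, hF, θ, h2, h3, hP⟩ := exists_piece_of_heights hq hpq h₁ h₂ (X := u / (1 - ρ))
      (y := w / (1 - ρ)) (τ := ρ / (1 - ρ)) (by positivity) (by rwa [div_le_iff₀ hs])
      (by positivity)
      (by
        have : q * (w / (1 - ρ)) - p * (u / (1 - ρ)) = (q * w - p * u) / (1 - ρ) := by ring
        rw [this]; positivity)
      (by
        have : q * (w / (1 - ρ)) - p * (u / (1 - ρ)) = (q * w - p * u) / (1 - ρ) := by ring
        rw [this, div_le_iff₀ hs]
        refine hw'.trans_eq ?_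
        field_simp)
    refine ⟨t, F, hF, _, hP, θ, ⟨h2, h3⟩, ?_, ?_⟩
    · field_simp
    · field_simp; ring

end Cover

section Coordinates

/-- The barycentric coordinates of the tetrahedron `nfTetra q p`, shifted to vanish at its
vertex `0`. -/
noncomputable def lam (q p : ℤ) (i : Fin 4) (x : Fin 3 → ℝ) : ℝ :=
  ![-(x 0 / q + x 2), x 0 / q, x 2 - (x 1 - p * x 0 / q), x 1 - p * x 0 / q] i

/-- The normal form of an empty lattice tetrahedron of normalized volume `q`. -/
def nfTetra (q p : ℤ) : Fin 4 → Fin 3 → ℤ := ![![0, 0, 0], ![q, p, 0], ![0, 0, 1], ![0, 1, 1]]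

variable {q p : ℤ}

theorem lam_one (x : Fin 3 → ℝ) : lam q p 1 x = x 0 / q := rfl

theorem lam_two (x : Fin 3 → ℝ) : lam q p 2 x = x 2 - (x 1 - p * x 0 / q) := rfl

theorem lam_three (x : Fin 3 → ℝ) : lam q p 3 x = x 1 - p * x 0 / q := rfl

theorem lam_add (i : Fin 4) (x y : Fin 3 → ℝ) : lam q p i (x + y) = lam q p i x + lam q p i y := by
  fin_cases i <;> simp [lam] <;> ring

theorem lam_smul (i : Fin 4) (c : ℝ) (x : Fin 3 → ℝ) : lam q p i (c • x) = c * lam q p i x := by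
  fin_cases i <;> simp [lam] <;> ring

theorem lam_sub (i : Fin 4) (x y : Fin 3 → ℝ) : lam q p i (x - y) = lam q p i x - lam q p i y := by
  fin_cases i <;> simp [lam] <;> ring

theorem isAff_lam (i : Fin 4) : IsAff (lam q p i) := fun x y a b _ => by
  rw [lam_add, lam_smul, lam_smul]

theorem lam_sum (m : Fin 4) (x : Fin 3 → ℝ) :
    lam q p m x + lam q p (m + 1) x + lam q p (m + 2) x + lam q p (m + 3) x = 0 := by
  fin_cases m <;> simp [lam] <;> ring

theorem lam_ext (hq : 0 < q) {x y : Fin 3 → ℝ} (h : ∀ i, lam q p i x = lam q p i y) : x = y := by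
  have hq' : (q : ℝ) ≠ 0 := by exact_mod_cast hq.ne'
  have h1 := h 1
  have h2 := h 2
  have h3 := h 3
  rw [lam_one, lam_one, div_left_inj' hq'] at h1
  rw [lam_three, lam_three, h1] at h3
  rw [lam_two, lam_two, h1] at h2
  funext i
  fin_cases i <;> dsimp <;> linarith

theorem lam_nf (hq : 0 < q) (i j : Fin 4) : lam q p i (rcast (nfTetra q p j)) =
    (if i = j then 1 else 0) - (if i = 0 then 1 else 0) := by
  have hq' : (q : ℝ) ≠ 0 := by exact_mod_cast hq.ne'
  fin_cases i <;> fin_cases j <;> simp [lam, nfTetra, rcast, hq']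

theorem exists_int_of_lam (hq : 0 < q) (hpq : IsCoprime p q) {v : Fin 3 → ℤ} {m : Fin 4} {c : ℤ}
    (h : lam q p m (rcast v) = c) : ∃ f : Fin 4 → ℤ, ∀ i, lam q p i (rcast v) = f i := by
  have hq' : (q : ℝ) ≠ 0 := by exact_mod_cast hq.ne'
  have hd : q ∣ v 0 := by
    fin_cases m
    · change -((v 0 : ℝ) / q + v 2) = c at h
      field_simp at h
      norm_cast at h
      exact ⟨-c - v 2, by linarith⟩
    · change (v 0 : ℝ) / q = c at h
      field_simp at h
      norm_cast at h
      exact ⟨c, by linarith⟩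
    · change (v 2 : ℝ) - (v 1 - p * v 0 / q) = c at h
      field_simp at h
      norm_cast at h
      exact hpq.symm.dvd_of_dvd_mul_left ⟨c - v 2 + v 1, by linarith⟩
    · change (v 1 - p * v 0 / q : ℝ) = c at h
      field_simp at h
      norm_cast at h
      exact hpq.symm.dvd_of_dvd_mul_left ⟨v 1 - c, by linarith⟩
  obtain ⟨b, hb⟩ := hd
  refine ⟨![-(b + v 2), b, v 2 - (v 1 - p * b), v 1 - p * b], fun i => ?_⟩
  have hb' : (v 0 : ℝ) = q * b := by exact_mod_cast hb
  fin_cases i <;> simp [lam, rcast, hb'] <;> field_simp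

/-- On the plane `lam m = c`, the coordinates of points of `V` differ by at most one. -/
def AlcOn (q p : ℤ) (m : Fin 4) (c : ℤ) (V : Set (Fin 3 → ℤ)) : Prop :=
  ∀ v ∈ V, ∀ w ∈ V, lam q p m (rcast v) = c → lam q p m (rcast w) = c →
    ∀ i, lam q p i (rcast v) - lam q p i (rcast w) ≤ 1

theorem proper_of_lam_sep (hq : 0 < q) (hpq : IsCoprime p q) {m : Fin 4} {c : ℤ}
    {V W : Set (Fin 3 → ℤ)} (hfin : V.Finite) (hV : ∀ v ∈ V, lam q p m (rcast v) ≤ c)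
    (hW : ∀ v ∈ W, c ≤ lam q p m (rcast v)) (aV : AlcOn q p m c V) (aW : AlcOn q p m c W) :
    Proper (rcast '' V) (rcast '' W) := by
  have hh : IsAff (fun x => lam q p m x + -(c : ℝ)) := (isAff_lam m).add (isAff_const _)
  refine Proper.image_of_sep hh (fun v hv => by linarith [hV v hv])
    (fun v hv => by linarith [hW v hv]) ?_
  have key : ∀ x ∈ (rcast '' {v ∈ V | lam q p m (rcast v) + -(c : ℝ) = 0}) ∪
      (rcast '' {v ∈ W | lam q p m (rcast v) + -(c : ℝ) = 0}), lam q p m x = c ∧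
      ∃ f : Fin 4 → ℤ, ∀ i, lam q p i x = f i := by
    rintro _ (⟨v, ⟨-, hv⟩, rfl⟩ | ⟨v, ⟨-, hv⟩, rfl⟩)
    · exact ⟨by linarith, exists_int_of_lam hq hpq (by linarith)⟩
    · exact ⟨by linarith, exists_int_of_lam hq hpq (by linarith)⟩
  refine proper_of_alcove (f := lam q p (m + 1)) (g := lam q p (m + 2)) (h := lam q p (m + 3))
    (κ := -c) (isAff_lam _) (isAff_lam _) (isAff_lam _)
    ((hfin.subset (Set.sep_subset _ _)).image _) ?_ ?_ ?_ ?_ ?_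
  · intro x hx
    obtain ⟨-, f, hf⟩ := key x hx
    exact ⟨⟨_, hf _⟩, ⟨_, hf _⟩, ⟨_, hf _⟩⟩
  · rintro _ ⟨v, ⟨hv, hv'⟩, rfl⟩ _ ⟨w, ⟨hw, hw'⟩, rfl⟩
    have := aV v hv w hw (by linarith) (by linarith)
    exact ⟨this _, this _, this _⟩
  · rintro _ ⟨v, ⟨hv, hv'⟩, rfl⟩ _ ⟨w, ⟨hw, hw'⟩, rfl⟩
    have := aW v hv w hw (by linarith) (by linarith)
    exact ⟨this _, this _, this _⟩
  · intro x hx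
    have := lam_sum (q := q) (p := p) m x
    rw [(key x hx).1] at this
    push_cast
    linarith
  · intro x hx y hy h1 h2 h3
    refine lam_ext hq (p := p) fun i => ?_
    have : ∀ m i : Fin 4, i = m ∨ i = m + 1 ∨ i = m + 2 ∨ i = m + 3 := by decide
    rcases this m i with rfl | rfl | rfl | rfl
    · rw [(key x hx).1, (key y hy).1]
    all_goals assumption

/-- The points whose coordinates have the lower bounds `κ`. -/
def region (q p : ℤ) (κ : Fin 4 → ℤ) : Set (Fin 3 → ℝ) := {x | ∀ i, (κ i : ℝ) ≤ lam q p i x}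

theorem continuous_lam (i : Fin 4) : Continuous (lam q p i) := by
  fin_cases i
  · exact (((continuous_apply 0).div_const _).add (continuous_apply 2)).neg
  · exact (continuous_apply 0).div_const _
  · exact (continuous_apply 2).sub
      ((continuous_apply 1).sub (((continuous_apply 0).const_mul _).div_const _))
  · exact (continuous_apply 1).sub (((continuous_apply 0).const_mul _).div_const _)

theorem convex_region (κ : Fin 4 → ℤ) : Convex ℝ (region q p κ) := by
  intro x hx y hy a b ha hb hab i
  rw [isAff_lam i x y a b hab]
  have h1 := mul_le_mul_of_nonneg_left (hx i) ha
  have h2 := mul_le_mul_of_nonneg_left (hy i) hb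
  obtain rfl : b = 1 - a := by linarith
  linarith

theorem mem_frontier_region (hq : 0 < q) {κ : Fin 4 → ℤ} {x : Fin 3 → ℝ} :
    x ∈ frontier (region q p κ) ↔ x ∈ region q p κ ∧ ∃ m, lam q p m x = κ m := by
  have hq' : (0 : ℝ) < q := by exact_mod_cast hq
  have hcl : IsClosed (region q p κ) := by
    rw [region, Set.ofPred_forall]
    exact isClosed_iInter fun i => isClosed_le continuous_const (continuous_lam i)
  rw [hcl.frontier_eq]
  constructor
  · rintro ⟨hx, hx'⟩
    refine ⟨hx, ?_⟩
    by_contra! h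
    refine hx' ((interior_maximal (t := {x | ∀ i, (κ i : ℝ) < lam q p i x}) ?_ ?_) ?_)
    · exact fun y hy i => (hy i).le
    · rw [Set.ofPred_forall]
      exact isOpen_iInter_of_finite fun i => isOpen_lt continuous_const (continuous_lam i)
    · exact fun i => lt_of_le_of_ne (hx i) (h i).symm
  · rintro ⟨hx, m, hm⟩
    refine ⟨hx, fun hint => ?_⟩
    obtain ⟨d, hd⟩ : ∃ d : Fin 3 → ℝ, lam q p m d < 0 := by
      fin_cases m
      · exact ⟨![0, 0, 1], by simp [lam]⟩
      · exact ⟨![-1, 0, 0], by simp [lam, neg_div]; exact_mod_cast hq⟩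
      · exact ⟨![0, 1, 0], by simp [lam]⟩
      · exact ⟨![0, -1, 0], by simp [lam]⟩
    have hc : Continuous fun t : ℝ => x + t • d := by fun_prop
    have h0 : ∀ᶠ t : ℝ in nhds 0, x + t • d ∈ region q p κ := by
      have : Filter.Tendsto (fun t : ℝ => x + t • d) (nhds 0) (nhds x) := by
        simpa using hc.tendsto 0
      exact this (mem_interior_iff_mem_nhds.1 hint)
    obtain ⟨ε, hε, hb⟩ := Metric.eventually_nhds_iff.1 h0
    have := hb (y := ε / 2) (by rw [Real.dist_eq, sub_zero, abs_of_pos (by positivity)]; linarith) m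
    rw [lam_add, lam_smul, hm] at this
    nlinarith

theorem smul_nf_eq (hq : 0 < q) (k : ℕ) :
    (k : ℝ) • simplexHull (nfTetra q p) = region q p ![-k, 0, 0, 0] := by
  have hmem : ∀ w : Fin 4 → ℝ, (∀ i, 0 ≤ w i) → ∑ i, w i = 1 →
      ∑ i, w i • rcast (nfTetra q p i) ∈ simplexHull (nfTetra q p) := fun w h0 h1 =>
    (convex_convexHull ℝ _).sum_mem (fun i _ => h0 i) h1
      (fun i _ => subset_convexHull ℝ _ ⟨i, rfl⟩)
  ext x
  constructor
  · rintro ⟨y, hy, rfl⟩ i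
    have := (isAff_lam (q := q) (p := p) i).le_of_mem_hull (c := if i = 0 then -1 else 0)
      (by
        rintro _ ⟨j, rfl⟩
        dsimp only
        rw [lam_nf hq]
        split_ifs <;> norm_num) hy
    dsimp only
    rw [lam_smul]
    have hk : (0 : ℝ) ≤ k := k.cast_nonneg
    have h2 := mul_le_mul_of_nonneg_left this hk
    fin_cases i <;> simpa using h2
  · intro hx
    have h0 := hx 0
    have h1 := hx 1
    have h2 := hx 2
    have h3 := hx 3
    have hs := lam_sum (q := q) (p := p) 0 x
    simp only [zero_add] at hs
    simp only [Matrix.cons_val] at h0 h1 h2 h3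
    push_cast at h0 h1 h2 h3
    have hlam : ∀ w : Fin 4 → ℝ, ∑ i, w i = 1 → ∀ i : Fin 4, i ≠ 0 →
        lam q p i (∑ j, w j • rcast (nfTetra q p j)) = w i := by
      intro w hw i hi
      simp only [Fin.sum_univ_four, lam_add, lam_smul, lam_nf hq]
      fin_cases i <;> simp at hi ⊢
    rcases Nat.eq_zero_or_pos k with rfl | hk
    · have : x = 0 := lam_ext hq (p := p) fun i => by
        have e : lam q p i 0 = 0 := by simpa using lam_smul (q := q) (p := p) i 0 0
        rw [e]
        push_cast at h0
        fin_cases i <;> simp <;> linarith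
      rw [this]
      exact ⟨_, hmem (fun _ => 1 / 4) (by intro; positivity) (by norm_num), by simp⟩
    · have hk' : (0 : ℝ) < k := by exact_mod_cast hk
      set w : Fin 4 → ℝ := ![1 + lam q p 0 x / k, lam q p 1 x / k, lam q p 2 x / k, lam q p 3 x / k]
        with hw
      have hw1 : ∑ i, w i = 1 := by
        have : (lam q p 0 x + lam q p 1 x + lam q p 2 x + lam q p 3 x) / k = 0 := by
          rw [hs, zero_div]
        simp only [Fin.sum_univ_four, hw, Matrix.cons_val]
        linear_combination this
      refine ⟨_, hmem w (fun i => ?_) hw1, ?_⟩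
      · have : -1 ≤ lam q p 0 x / k := by rw [le_div_iff₀ hk']; linarith
        fin_cases i
        · simp [hw]; linarith
        · simp [hw]; positivity
        · simp [hw]; positivity
        · simp [hw]; positivity
      · have key : ∀ i : Fin 4, i ≠ 0 →
            lam q p i ((k : ℝ) • ∑ j, w j • rcast (nfTetra q p j)) = lam q p i x := by
          intro i hi
          rw [lam_smul, hlam w hw1 i hi]
          fin_cases i
          · exact absurd rfl hi
          all_goals simp [hw]; field_simp
        refine lam_ext hq (p := p) fun i => ?_
        by_cases hi : i = 0
        · have e := lam_sum (q := q) (p := p) 0 ((k : ℝ) • ∑ j, w j • rcast (nfTetra q p j))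
          simp only [zero_add] at e
          rw [key 1 (by decide), key 2 (by decide), key 3 (by decide)] at e
          rw [hi]
          linarith
        · exact key i hi

end Coordinates

section Families

variable {q p : ℤ}

/-- The difference of `v` and `w` is parallel to an edge of `nfTetra q p`. -/
def ParallelEdge (q p : ℤ) (v w : Fin 3 → ℤ) : Prop :=
  ∃ (a b : Fin 4) (c : ℝ), a ≠ b ∧
    rcast w - rcast v = c • (rcast (nfTetra q p b) - rcast (nfTetra q p a))

/-- A family of vertex sets forming a unimodular triangulation of `region q p κ` with
standard boundary. -/
structure GoodFam (q p : ℤ) (κ : Fin 4 → ℤ) (T : Set (Set (Fin 3 → ℤ))) : Prop where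
  unimod : ∀ V ∈ T, Unimod V
  sub : ∀ V ∈ T, ∀ v ∈ V, rcast v ∈ region q p κ
  cover : ∀ x ∈ region q p κ, ∃ V ∈ T, x ∈ convexHull ℝ (rcast '' V)
  proper : ∀ V ∈ T, ∀ W ∈ T, Proper (rcast '' V) (rcast '' W)
  bdry : ∀ V ∈ T, ∀ v ∈ V, ∀ w ∈ V, ∀ m, lam q p m (rcast v) = κ m →
    lam q p m (rcast w) = κ m → ParallelEdge q p v w

theorem simplexHull_eq (s : Fin 4 → Fin 3 → ℤ) :
    simplexHull s = convexHull ℝ (rcast '' Set.range s) := by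
  rw [simplexHull, ← Set.range_comp]; rfl

theorem Unimod.finite {V : Set (Fin 3 → ℤ)} (h : Unimod V) : V.Finite := by
  obtain ⟨s, rfl, -⟩ := h
  exact Set.finite_range s

theorem parallelEdge_self (v : Fin 3 → ℤ) : ParallelEdge q p v v :=
  ⟨0, 1, 0, by decide, by simp⟩

theorem exists_goodFam (hq : 0 < q) {k : ℕ} (h : HasUnimodTriangStdBdry k (nfTetra q p)) :
    ∃ T, GoodFam q p ![-k, 0, 0, 0] T := by
  obtain ⟨T, h1, h2, h3, h4⟩ := h
  rw [smul_nf_eq hq] at h1 h4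
  have hsub : ∀ s ∈ T, ∀ i, rcast (s i) ∈ region q p ![-k, 0, 0, 0] := fun s hs i => by
    rw [← h1]
    exact Set.mem_biUnion hs (subset_convexHull ℝ _ ⟨i, rfl⟩)
  refine ⟨{V | ∃ s ∈ T, Set.range s = V}, ?_, ?_, ?_, ?_, ?_⟩
  · rintro _ ⟨s, hs, rfl⟩
    exact ⟨s, rfl, h2 s hs⟩
  · rintro _ ⟨s, hs, rfl⟩ _ ⟨i, rfl⟩
    exact hsub s hs i
  · intro x hx
    rw [← h1] at hx
    simp only [Set.mem_iUnion, exists_prop] at hx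
    obtain ⟨s, hs, hx⟩ := hx
    exact ⟨_, ⟨s, hs, rfl⟩, by rwa [← simplexHull_eq]⟩
  · rintro _ ⟨s, hs, rfl⟩ _ ⟨s', hs', rfl⟩
    rw [Proper, ← Set.image_inter rcast_injective, ← simplexHull_eq, ← simplexHull_eq,
      h3 s hs s' hs']
  · rintro _ ⟨s, hs, rfl⟩ _ ⟨i, rfl⟩ _ ⟨j, rfl⟩ m hi hj
    by_cases hij : i = j
    · rw [hij]; exact parallelEdge_self _
    refine h4 s hs i j hij ?_
    intro x hx
    rw [mem_frontier_region hq]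
    refine ⟨(convex_region _).segment_subset (hsub s hs i) (hsub s hs j) hx, m, ?_⟩
    obtain ⟨a, b, ha, hb, hab, rfl⟩ := hx
    rw [isAff_lam m _ _ a b hab, hi, hj, ← add_mul, hab, one_mul]

theorem finite_region (hq : 0 < q) (k : ℕ) :
    {v : Fin 3 → ℤ | rcast v ∈ region q p ![-k, 0, 0, 0]}.Finite := by
  have hq' : (0 : ℝ) < q := by exact_mod_cast hq
  refine (Set.finite_Icc (α := Fin 3 → ℤ) ![0, -(|p| * k), 0] ![q * k, k + |p| * k, k]).subset ?_
  intro v hv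
  have h0 := hv 0
  have h1 := hv 1
  have h2 := hv 2
  have h3 := hv 3
  have e := lam_sum (q := q) (p := p) 0 (rcast v)
  simp only [zero_add] at e
  simp only [Matrix.cons_val] at h0 h1 h2 h3
  push_cast at h0 h1 h2 h3
  have e1 : lam q p 1 (rcast v) = v 0 / q := rfl
  have e23 : lam q p 2 (rcast v) + lam q p 3 (rcast v) = v 2 := by
    rw [lam_two, lam_three]; simp [rcast]
  have e3 : (v 1 : ℝ) = lam q p 3 (rcast v) + p * lam q p 1 (rcast v) := by
    rw [lam_one, lam_three]; simp [rcast]; ring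
  have e0 : (v 0 : ℝ) = q * lam q p 1 (rcast v) := by rw [e1]; field_simp
  have hle : lam q p 1 (rcast v) ≤ k := by linarith
  have habs : |(p : ℝ) * lam q p 1 (rcast v)| ≤ |(p : ℝ)| * k := by
    rw [abs_mul, abs_of_nonneg h1]; gcongr
  rw [abs_le] at habs
  rw [Set.mem_Icc, Pi.le_def, Pi.le_def]
  constructor
  · intro i
    fin_cases i
    · change 0 ≤ v 0
      have : (0 : ℝ) ≤ v 0 := by rw [e0]; positivity
      exact_mod_cast this
    · change -(|p| * k) ≤ v 1
      have : (-(|p| * k : ℤ) : ℝ) ≤ v 1 := by push_cast; linarith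
      exact_mod_cast this
    · change 0 ≤ v 2
      have : (0 : ℝ) ≤ v 2 := by linarith
      exact_mod_cast this
  · intro i
    fin_cases i
    · change v 0 ≤ q * k
      have : (v 0 : ℝ) ≤ q * k := by rw [e0]; gcongr
      exact_mod_cast this
    · change v 1 ≤ k + |p| * k
      have : (v 1 : ℝ) ≤ (k + |p| * k : ℤ) := by push_cast; linarith
      exact_mod_cast this
    · change v 2 ≤ k
      have : (v 2 : ℝ) ≤ k := by linarith
      exact_mod_cast this

theorem GoodFam.hasUnimodTriangStdBdry (hq : 0 < q) {k : ℕ} {T : Set (Set (Fin 3 → ℤ))}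
    (h : GoodFam q p ![-k, 0, 0, 0] T) : HasUnimodTriangStdBdry k (nfTetra q p) := by
  have hfin : {s : Fin 4 → Fin 3 → ℤ | Set.range s ∈ T ∧ (edgeDet s).natAbs = 1}.Finite := by
    refine (Set.Finite.pi' fun _ : Fin 4 => finite_region (p := p) hq k).subset ?_
    rintro s ⟨hs, -⟩ i
    exact h.sub _ hs _ ⟨i, rfl⟩
  have hmem : ∀ s, s ∈ hfin.toFinset ↔ Set.range s ∈ T ∧ (edgeDet s).natAbs = 1 := fun s => by
    rw [Set.Finite.mem_toFinset]; rfl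
  refine ⟨hfin.toFinset, ?_, ?_, ?_, ?_⟩
  · rw [smul_nf_eq hq]
    refine Set.Subset.antisymm (Set.iUnion₂_subset fun s hs => ?_) fun x hx => ?_
    · rw [simplexHull_eq]
      refine convexHull_min ?_ (convex_region _)
      rintro _ ⟨v, hv, rfl⟩
      exact h.sub _ ((hmem s).1 hs).1 v hv
    · obtain ⟨V, hV, hx⟩ := h.cover x hx
      obtain ⟨s, rfl, hs⟩ := h.unimod V hV
      exact Set.mem_biUnion ((hmem s).2 ⟨hV, hs⟩) (by rwa [simplexHull_eq])
  · intro s hs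
    exact ((hmem s).1 hs).2
  · intro s hs s' hs'
    rw [simplexHull_eq, simplexHull_eq]
    refine Set.Subset.antisymm ?_ (Set.subset_inter
      (convexHull_mono (Set.image_mono Set.inter_subset_left))
      (convexHull_mono (Set.image_mono Set.inter_subset_right)))
    rw [Set.image_inter rcast_injective]
    exact h.proper _ ((hmem s).1 hs).1 _ ((hmem s').1 hs').1
  · intro s hs i j _ hseg
    rw [smul_nf_eq hq] at hseg
    have hV := ((hmem s).1 hs).1
    obtain ⟨-, m, hm⟩ := (mem_frontier_region hq).1 (hseg (midpoint_mem_segment _ _))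
    have hi := h.sub _ hV (s i) ⟨i, rfl⟩ m
    have hj := h.sub _ hV (s j) ⟨j, rfl⟩ m
    have e : lam q p m (midpoint ℝ (rcast (s i)) (rcast (s j))) =
        (lam q p m (rcast (s i)) + lam q p m (rcast (s j))) / 2 := by
      rw [midpoint_eq_smul_add, lam_smul, lam_add, invOf_eq_inv]; ring
    rw [e] at hm
    exact h.bdry _ hV _ ⟨i, rfl⟩ _ ⟨j, rfl⟩ m (by linarith) (by linarith)

theorem rcast_add (x y : Fin 3 → ℤ) : rcast (x + y) = rcast x + rcast y := by
  funext i; simp [rcast]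

theorem hull_translate (t : Fin 3 → ℤ) (V : Set (Fin 3 → ℤ)) :
    convexHull ℝ (rcast '' ((· + t) '' V)) = (· + rcast t) '' convexHull ℝ (rcast '' V) := by
  rw [← image_hull, Set.image_image, Set.image_image]
  · simp only [rcast_add]
  · intro x y a b hab
    have : rcast t = a • rcast t + b • rcast t := by rw [← add_smul, hab, one_smul]
    nth_rewrite 1 [this]
    rw [smul_add, smul_add]
    abel

theorem GoodFam.translate {κ κ' : Fin 4 → ℤ} {T : Set (Set (Fin 3 → ℤ))} (h : GoodFam q p κ T)
    (t : Fin 3 → ℤ) (ht : ∀ i, (κ' i : ℝ) = κ i + lam q p i (rcast t)) :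
    GoodFam q p κ' ((fun V => (· + t) '' V) '' T) where
  unimod := by
    rintro _ ⟨V, hV, rfl⟩
    obtain ⟨s, rfl, hs⟩ := h.unimod V hV
    refine ⟨fun i => s i + t, ?_, ?_⟩
    · exact Set.range_comp (· + t) s
    · rw [← hs, edgeDet, edgeDet]
      congr 3
      funext i j
      simp
  sub := by
    rintro _ ⟨V, hV, rfl⟩ _ ⟨v, hv, rfl⟩ i
    have := h.sub V hV v hv i
    rw [ht i, rcast_add, lam_add]
    linarith
  cover := by
    intro x hx
    obtain ⟨V, hV, hxV⟩ := h.cover (x - rcast t) fun i => by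
      have := hx i
      rw [ht i] at this
      rw [lam_sub]
      linarith
    refine ⟨_, ⟨V, hV, rfl⟩, ?_⟩
    rw [hull_translate]
    exact ⟨_, hxV, sub_add_cancel _ _⟩
  proper := by
    rintro _ ⟨V, hV, rfl⟩ _ ⟨W, hW, rfl⟩
    have := h.proper V hV W hW
    rw [Proper, ← Set.image_inter rcast_injective] at this ⊢
    rw [← Set.image_inter (add_left_injective t), hull_translate, hull_translate, hull_translate,
      ← Set.image_inter (add_left_injective _)]
    exact Set.image_mono this
  bdry := by
    rintro _ ⟨V, hV, rfl⟩ _ ⟨v, hv, rfl⟩ _ ⟨w, hw, rfl⟩ m h1 h2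
    rw [ht m, rcast_add, lam_add] at h1 h2
    obtain ⟨a, b, c, hab, e⟩ := h.bdry V hV v hv w hw m (by linarith) (by linarith)
    exact ⟨a, b, c, hab, by rw [rcast_add, rcast_add, add_sub_add_right_eq_sub, e]⟩

end Families

section Cells

variable {q p : ℤ}

theorem mem_joinSet {O C : Fin 3 → ℤ} {F : Set (ℤ × ℤ)} {A : Set ℤ} {x : Fin 3 → ℤ} :
    x ∈ joinSet O C F A ↔ (∃ v ∈ F, basePt O v = x) ∨ ∃ θ ∈ A, apexPt C θ = x := Iff.rfl

/-- The vertex sets of the tetrahedra of the triangulation of a cell lying above (`d = 0`) or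
below (`d = 1`) a lattice parallelogram in the plane of height `J - i`. -/
structure CellTet (q p i J j d : ℤ) (V : Set (Fin 3 → ℤ)) : Prop where
  nonneg : 0 ≤ j
  lt : j < J - i
  dir : d = 0 ∨ d = 1
  join : ∃ t F, Piece q p (1 - d) (if j = J - i - 1 then 1 - d else d) t F ∧
    V = joinSet ![q * i, p * i + j, J - i] ![q * (i + d), p * (i + d) + j, J - i + 1 - 2 * d] F
      (levels (1 - d) (if j = J - i - 1 then 1 - d else d) t)

theorem lam_basePt (hq : 0 < q) (i J j : ℤ) (v : ℤ × ℤ) (m : Fin 4) :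
    lam q p m (rcast (basePt ![q * i, p * i + j, J - i] v)) =
      (![-(J : ℝ) - (v.1 : ℝ) / q, (i : ℝ) + (v.1 : ℝ) / q,
        (J : ℝ) - i - j - ((v.2 : ℝ) - p * v.1 / q), (j : ℝ) + ((v.2 : ℝ) - p * v.1 / q)] :
        Fin 4 → ℝ) m := by
  have hq' : (q : ℝ) ≠ 0 := by exact_mod_cast hq.ne'
  fin_cases m <;> simp [lam, rcast, basePt] <;> field_simp <;> ring

theorem lam_apexPt (hq : 0 < q) (i J j d θ : ℤ) (m : Fin 4) :
    lam q p m (rcast (apexPt ![q * (i + d), p * (i + d) + j, J - i + 1 - 2 * d] θ)) =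
      (![-(J : ℝ) - 1 + d, (i : ℝ) + d, (J : ℝ) - i + 1 - 2 * d - j - θ, (j : ℝ) + θ] :
        Fin 4 → ℝ) m := by
  have hq' : (q : ℝ) ≠ 0 := by exact_mod_cast hq.ne'
  fin_cases m <;> simp [lam, rcast, apexPt] <;> field_simp <;> ring

theorem levels_bounds {e₁ e₂ : ℤ} (h₁ : 0 ≤ e₁) (h₂ : 0 ≤ e₂) {t : ℕ} {θ : ℤ}
    (h : θ ∈ levels e₁ e₂ t) : loLevel e₁ e₂ t ≤ θ ∧ θ ≤ hiLevel e₁ e₂ t ∧ 0 ≤ θ ∧ θ ≤ e₁ + e₂ := by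
  have := loLevel_le_hiLevel h₁ h₂ t
  have h3 : 0 ≤ loLevel e₁ e₂ t := by unfold loLevel; split_ifs <;> omega
  have h4 : hiLevel e₁ e₂ t ≤ e₁ + e₂ := by unfold hiLevel; split_ifs <;> omega
  rcases h with rfl | rfl <;> omega

theorem hiLevel_le_loLevel_add_one {e₁ e₂ : ℤ} (h₁ : e₁ ≤ 1) (h₂ : e₂ ≤ 1) (t : ℕ) :
    hiLevel e₁ e₂ t ≤ loLevel e₁ e₂ t + 1 := by
  unfold loLevel hiLevel; split_ifs <;> omega

variable {i J j d i' J' j' d' : ℤ} {V V' : Set (Fin 3 → ℤ)}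

theorem CellTet.unimod (hq : 0 < q) (hpq : IsCoprime p q) (h : CellTet q p i J j d V) :
    Unimod V := by
  obtain ⟨t, F, hF, rfl⟩ := h.join
  refine hF.unimod hq hpq ?_
  simp only [Matrix.cons_val]
  rcases h.dir with rfl | rfl <;> omega

theorem CellTet.bounds (hq : 0 < q) (hpq : IsCoprime p q) (h : CellTet q p i J j d V)
    {v : Fin 3 → ℤ} (hv : v ∈ V) :
    (-(J + 1) ≤ lam q p 0 (rcast v) ∧ lam q p 0 (rcast v) ≤ -J) ∧
    (i ≤ lam q p 1 (rcast v) ∧ lam q p 1 (rcast v) ≤ i + 1) ∧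
    0 ≤ lam q p 2 (rcast v) ∧
    (j ≤ lam q p 3 (rcast v) ∧ (j < J - i - 1 → lam q p 3 (rcast v) ≤ j + 1)) := by
  have hq' : (0 : ℝ) < q := by exact_mod_cast hq
  obtain ⟨t, F, hF, rfl⟩ := h.join
  have hlt := h.lt
  rcases mem_joinSet.1 hv with ⟨P, hP, rfl⟩ | ⟨θ, hθ, rfl⟩
  · obtain ⟨b1, b2, b3, b4⟩ := hF.bounds hq hpq hP
    simp only [lam_basePt hq, Matrix.cons_val]
    have c1 : (0 : ℝ) ≤ P.1 / q := by positivity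
    have c2 : (P.1 : ℝ) / q ≤ 1 := by rw [div_le_one hq']; exact_mod_cast b2
    have e : (P.2 - p * P.1 / q : ℝ) = (q * P.2 - p * P.1 : ℤ) / q := by push_cast; field_simp
    have c3 : (0 : ℝ) ≤ P.2 - p * P.1 / q := by rw [e]; positivity
    have c4 : (P.2 - p * P.1 / q : ℝ) ≤ 1 := by
      rw [e, div_le_one hq']; exact_mod_cast b4
    have c5 : (j : ℝ) + 1 ≤ J - i := by exact_mod_cast hlt
    exact ⟨⟨by linarith, by linarith⟩, ⟨by linarith, by linarith⟩, by linarith, by linarith,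
      fun _ => by linarith⟩
  · simp only [lam_apexPt hq, Matrix.cons_val]
    obtain ⟨-, -, b1, b2⟩ := levels_bounds (by rcases h.dir with rfl | rfl <;> norm_num)
      (by rcases h.dir with rfl | rfl <;> split_ifs <;> norm_num) hθ
    have hd := h.dir
    norm_cast
    split_ifs at b2 <;> refine ⟨⟨?_, ?_⟩, ⟨?_, ?_⟩, ?_, ?_, fun _ => ?_⟩ <;> omega

/-- The vertices of a cell on a lattice plane `lam m = c` have integral coordinates, which
differ by at most one. -/
theorem CellTet.alcOn (hq : 0 < q) (h : CellTet q p i J j d V) (m : Fin 4) (c : ℤ)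
    (hpq : IsCoprime p q) : AlcOn q p m c V := by
  have hq' : (q : ℝ) ≠ 0 := by exact_mod_cast hq.ne'
  obtain ⟨t, F, hF, rfl⟩ := h.join
  have hd := h.dir
  set e₂ := if j = J - i - 1 then 1 - d else d with he₂
  have k₂ : 0 ≤ e₂ := by rw [he₂]; split_ifs <;> omega
  have k₂' : e₂ ≤ 1 := by rw [he₂]; split_ifs <;> omega
  have k₁ : 0 ≤ 1 - d := by omega
  have k₁' : 1 - d ≤ 1 := by omega
  have base : ∀ P ∈ F, lam q p m (rcast (basePt ![q * i, p * i + j, J - i] P)) = c →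
      ∃ b κ : ℤ, 0 ≤ b ∧ b ≤ 1 ∧ 0 ≤ κ ∧ κ ≤ 1 ∧
        (1 - d) - 1 + κ ≤ loLevel (1 - d) e₂ t ∧ hiLevel (1 - d) e₂ t ≤ (1 - d) + κ ∧
        ∀ l, lam q p l (rcast (basePt ![q * i, p * i + j, J - i] P)) =
          ((![-J - b, i + b, J - i - j - κ, j + κ] l : ℤ) : ℝ) := by
    intro P hP hc
    obtain ⟨f, hf⟩ := exists_int_of_lam hq hpq hc
    obtain ⟨b1, b2, -, -⟩ := hF.bounds hq hpq hP
    have h1 := hf 1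
    rw [lam_basePt hq] at h1
    simp only [Matrix.cons_val] at h1
    have h2 : P.1 = q * (f 1 - i) := by
      field_simp at h1
      norm_cast at h1
      linarith
    have hx : P.1 = 0 ∨ P.1 = q := by
      have h3 : 0 ≤ f 1 - i := by
        by_contra! h3
        nlinarith
      have h4 : f 1 - i ≤ 1 := by
        by_contra! h4
        nlinarith
      obtain h5 | h5 : f 1 - i = 0 ∨ f 1 - i = 1 := by omega
      · left; rw [h2, h5, mul_zero]
      · right; rw [h2, h5, mul_one]
    obtain ⟨b, κ, c1, c2, c3, c4, c5, c6, c7, c8⟩ := hF.corner hq k₁ k₁' k₂ k₂' hP hx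
    refine ⟨b, κ, c1, c2, c3, c4, c7, c8, fun l => ?_⟩
    rw [lam_basePt hq, c5, c6]
    fin_cases l <;> simp <;> field_simp <;> ring
  have apex : ∀ θ ∈ levels (1 - d) e₂ t, ∀ l, lam q p l (rcast (apexPt
      ![q * (i + d), p * (i + d) + j, J - i + 1 - 2 * d] θ)) =
      ((![-J - 1 + d, i + d, J - i + 1 - 2 * d - j - θ, j + θ] l : ℤ) : ℝ) := by
    intro θ _ l
    rw [lam_apexPt hq]
    fin_cases l <;> simp
  have hlohi := hiLevel_le_loLevel_add_one k₁' k₂' t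
  intro v hv w hw hvc hwc l
  rcases mem_joinSet.1 hv with ⟨P, hP, rfl⟩ | ⟨θ, hθ, rfl⟩ <;>
    rcases mem_joinSet.1 hw with ⟨P', hP', rfl⟩ | ⟨θ', hθ', rfl⟩
  · obtain ⟨b, κ, b1, b2, b3, b4, b5, b6, e⟩ := base P hP hvc
    obtain ⟨b', κ', b1', b2', b3', b4', b5', b6', e'⟩ := base P' hP' hwc
    rw [e, e']
    norm_cast
    fin_cases l <;> simp <;> omega
  · obtain ⟨b, κ, b1, b2, b3, b4, b5, b6, e⟩ := base P hP hvc
    have := levels_bounds k₁ k₂ hθ'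
    rw [e, apex θ' hθ']
    norm_cast
    fin_cases l <;> simp <;> omega
  · obtain ⟨b, κ, b1, b2, b3, b4, b5, b6, e⟩ := base P' hP' hwc
    have := levels_bounds k₁ k₂ hθ
    rw [e, apex θ hθ]
    norm_cast
    fin_cases l <;> simp <;> omega
  · have := levels_bounds k₁ k₂ hθ
    have := levels_bounds k₁ k₂ hθ'
    rw [apex θ hθ, apex θ' hθ']
    norm_cast
    fin_cases l <;> simp <;> omega

theorem proper_basePt (O : Fin 3 → ℤ) {F F' : Set (ℤ × ℤ)}
    (h : Proper (rcast₂ '' F) (rcast₂ '' F')) :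
    Proper (rcast '' (basePt O '' F)) (rcast '' (basePt O '' F')) := by
  have hinj : Function.Injective (basePtR O) := by
    intro x y e
    have e0 := congrFun e 0
    have e1 := congrFun e 1
    simp only [basePtR, Matrix.cons_val, add_right_inj] at e0 e1
    exact Prod.ext e0 e1
  rw [Proper, ← Set.image_inter rcast₂_injective] at h
  rintro x ⟨hx, hx'⟩
  rw [hull_basePt] at hx hx'
  obtain ⟨P, hP, rfl⟩ := hx
  obtain ⟨P', hP', e⟩ := hx'
  obtain rfl := hinj e
  refine convexHull_mono (s := rcast '' (basePt O '' (F ∩ F'))) ?_ ?_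
  · exact Set.subset_inter (Set.image_mono (Set.image_mono Set.inter_subset_left))
      (Set.image_mono (Set.image_mono Set.inter_subset_right))
  · rw [hull_basePt]
    exact ⟨_, h ⟨hP, hP'⟩, rfl⟩

theorem CellTet.proper_up_down (hq : 0 < q) (hpq : IsCoprime p q) (h : CellTet q p i J j 0 V)
    (h' : CellTet q p i J j 1 V') : Proper (rcast '' V) (rcast '' V') := by
  obtain ⟨t, F, hF, rfl⟩ := h.join
  obtain ⟨t', F', hF', rfl⟩ := h'.join
  have hh : IsAff (fun x : Fin 3 → ℝ => (J - i : ℝ) - x 2) := by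
    intro x y a b hab
    obtain rfl : b = 1 - a := by linarith
    simp only [Pi.add_apply, Pi.smul_apply, smul_eq_mul]; ring
  refine Proper.image_of_sep hh ?_ ?_ ?_
  · rintro v hv
    rcases mem_joinSet.1 hv with ⟨P, hP, rfl⟩ | ⟨θ, hθ, rfl⟩ <;>
      simp [rcast, basePt, apexPt]
  · rintro v hv
    rcases mem_joinSet.1 hv with ⟨P, hP, rfl⟩ | ⟨θ, hθ, rfl⟩ <;>
      simp [rcast, basePt, apexPt]
  · have := proper_basePt ![q * i, p * i + j, J - i] (hF.proper hq hpq hF')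
    convert this using 2
    · ext v
      rw [Set.mem_sep_iff, mem_joinSet, Set.mem_image]
      constructor
      · rintro ⟨hv | ⟨θ, hθ, rfl⟩, h0⟩
        · exact hv
        · simp [rcast, apexPt] at h0
      · rintro ⟨P, hP, rfl⟩
        exact ⟨Or.inl ⟨P, hP, rfl⟩, by simp [rcast, basePt]⟩
    · ext v
      rw [Set.mem_sep_iff, mem_joinSet, Set.mem_image]
      constructor
      · rintro ⟨hv | ⟨θ, hθ, rfl⟩, h0⟩
        · exact hv
        · simp [rcast, apexPt] at h0
          linarith
      · rintro ⟨P, hP, rfl⟩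
        exact ⟨Or.inl ⟨P, hP, rfl⟩, by simp [rcast, basePt]⟩

theorem CellTet.proper_of_dir (hq : 0 < q) (hpq : IsCoprime p q) (h : CellTet q p i J j d V)
    (h' : CellTet q p i J j d' V') : Proper (rcast '' V) (rcast '' V') := by
  by_cases hd : d = d'
  · subst hd
    have hd := h.dir
    obtain ⟨t, F, hF, rfl⟩ := h.join
    obtain ⟨t', F', hF', rfl⟩ := h'.join
    refine hF.proper_join hq hpq (by omega) (by split_ifs <;> omega) ?_ hF'
    simp only [Matrix.cons_val]
    omega
  rcases h.dir with rfl | rfl <;> rcases h'.dir with rfl | rfl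
  · exact absurd rfl hd
  · exact h.proper_up_down hq hpq h'
  · exact (h'.proper_up_down hq hpq h).symm
  · exact absurd rfl hd

theorem CellTet.proper_of_lt_one (hq : 0 < q) (hpq : IsCoprime p q) (h : CellTet q p i J j d V)
    (h' : CellTet q p i' J' j' d' V') (hi : i < i') : Proper (rcast '' V) (rcast '' V') := by
  refine proper_of_lam_sep hq hpq (m := 1) (c := i + 1) (h.unimod hq hpq).finite
    (fun v hv => ?_) (fun v hv => ?_) (h.alcOn hq _ _ hpq) (h'.alcOn hq _ _ hpq)
  · exact_mod_cast (h.bounds hq hpq hv).2.1.2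
  · have h1 := (h'.bounds hq hpq hv).2.1.1
    have h2 : (i : ℝ) + 1 ≤ i' := by exact_mod_cast hi
    push_cast
    linarith

theorem CellTet.proper_of_lt_zero (hq : 0 < q) (hpq : IsCoprime p q) (h : CellTet q p i J j d V)
    (h' : CellTet q p i' J' j' d' V') (hJ : J' < J) : Proper (rcast '' V) (rcast '' V') := by
  refine proper_of_lam_sep hq hpq (m := 0) (c := -J) (h.unimod hq hpq).finite
    (fun v hv => ?_) (fun v hv => ?_) (h.alcOn hq _ _ hpq) (h'.alcOn hq _ _ hpq)
  · exact_mod_cast (h.bounds hq hpq hv).1.2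
  · have h1 := (h'.bounds hq hpq hv).1.1
    have h2 : (J' : ℝ) + 1 ≤ J := by exact_mod_cast hJ
    push_cast
    linarith

theorem CellTet.proper_of_lt_three (hq : 0 < q) (hpq : IsCoprime p q) (h : CellTet q p i J j d V)
    (h' : CellTet q p i J j' d' V') (hj : j < j') : Proper (rcast '' V) (rcast '' V') := by
  refine proper_of_lam_sep hq hpq (m := 3) (c := j + 1) (h.unimod hq hpq).finite
    (fun v hv => ?_) (fun v hv => ?_) (h.alcOn hq _ _ hpq) (h'.alcOn hq _ _ hpq)
  · have := h'.lt
    exact_mod_cast (h.bounds hq hpq hv).2.2.2.2 (by omega)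
  · have h1 := (h'.bounds hq hpq hv).2.2.2.1
    have h2 : (j : ℝ) + 1 ≤ j' := by exact_mod_cast hj
    push_cast
    linarith

theorem CellTet.proper (hq : 0 < q) (hpq : IsCoprime p q) (h : CellTet q p i J j d V)
    (h' : CellTet q p i' J' j' d' V') : Proper (rcast '' V) (rcast '' V') := by
  rcases lt_trichotomy i i' with hi | rfl | hi
  · exact h.proper_of_lt_one hq hpq h' hi
  swap
  · exact (h'.proper_of_lt_one hq hpq h hi).symm
  rcases lt_trichotomy J J' with hJ | rfl | hJ
  · exact (h'.proper_of_lt_zero hq hpq h hJ).symm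
  swap
  · exact h.proper_of_lt_zero hq hpq h' hJ
  rcases lt_trichotomy j j' with hj | rfl | hj
  · exact h.proper_of_lt_three hq hpq h' hj
  swap
  · exact (h'.proper_of_lt_three hq hpq h hj).symm
  exact h.proper_of_dir hq hpq h'

/-- The tetrahedra of a cell cover it. -/
theorem exists_cellTet (hq : 0 < q) (hpq : IsCoprime p q) (hj : 0 ≤ j) (hj' : j < J - i)
    (hd : d = 0 ∨ d = 1) {x : Fin 3 → ℝ} {ρ : ℝ} (h0 : 0 ≤ ρ) (h1 : ρ ≤ 1)
    (hz : x 2 = J - i + (1 - 2 * d) * ρ) (h2 : i + d * ρ ≤ lam q p 1 x)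
    (h3 : lam q p 1 x ≤ i + d * ρ + (1 - ρ)) (h4 : j ≤ lam q p 3 x)
    (h5 : lam q p 3 x ≤ j + (1 - ρ) + (1 - d + (if j = J - i - 1 then 1 - d else d : ℤ)) * ρ) :
    ∃ V, CellTet q p i J j d V ∧ x ∈ convexHull ℝ (rcast '' V) := by
  have hq' : (0 : ℝ) < q := by exact_mod_cast hq
  have ex : x 0 = q * lam q p 1 x := by rw [lam_one]; field_simp
  have ey : x 1 = lam q p 3 x + p * lam q p 1 x := by rw [lam_one, lam_three]; ring
  obtain ⟨t, F, hF, P, hP, θ, hθ, e1, e2⟩ := exists_piece_cover hq hpq (e₁ := 1 - d)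
    (e₂ := if j = J - i - 1 then 1 - d else d) (by omega) (by split_ifs <;> omega)
    (u := x 0 - q * i - q * d * ρ) (w := x 1 - p * i - j - p * d * ρ) h0 h1
    (by rw [ex]; nlinarith) (by rw [ex]; nlinarith) (by rw [ex, ey]; nlinarith)
    (by
      have := mul_le_mul_of_nonneg_left h5 hq'.le
      rw [ex, ey]; push_cast at this ⊢; linarith)
  refine ⟨_, ⟨hj, hj', hd, t, F, hF, rfl⟩, ?_⟩
  have := join_mem (O := ![q * i, p * i + j, J - i])
    (C := ![q * (i + d), p * (i + d) + j, J - i + 1 - 2 * d]) hP hθ h0 h1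
  convert this using 1
  funext l
  fin_cases l <;> simp [basePtR, apexPtR]
  · linarith
  · linarith
  · rw [hz]; ring

end Cells

section Union

variable {q p : ℤ}

theorem dvd_edgeDet {s : Fin 4 → Fin 3 → ℤ} {i j : Fin 4} (hij : i ≠ j) {n : ℤ}
    (h : ∀ l, n ∣ s j l - s i l) : n ∣ edgeDet s := by
  have h' : ∀ l, ((s i l : ℤ) : ZMod n.natAbs) = s j l := fun l => by
    rw [ZMod.intCast_eq_intCast_iff_dvd_sub]
    exact Int.natAbs_dvd.2 (h l)
  rw [← Int.natAbs_dvd, ← ZMod.intCast_zmod_eq_zero_iff_dvd, edgeDet, Matrix.det_fin_three]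
  have h0 := h' 0
  have h1 := h' 1
  have h2 := h' 2
  simp only [Matrix.of_apply]
  push_cast
  fin_cases i <;> fin_cases j <;> first
    | exact absurd rfl hij
    | (simp at h0 h1 h2 ⊢; rw [h0, h1, h2]; ring)

theorem GoodFam.alcOn (hq : 0 < q) (hpq : IsCoprime p q) {κ : Fin 4 → ℤ}
    {T : Set (Set (Fin 3 → ℤ))} (h : GoodFam q p κ T) {V : Set (Fin 3 → ℤ)} (hV : V ∈ T)
    (m : Fin 4) : AlcOn q p m (κ m) V := by
  intro v hv w hw hvm hwm l
  obtain ⟨a, b, c, hab, e⟩ := h.bdry V hV w hw v hv m hwm hvm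
  obtain ⟨f, hf⟩ := exists_int_of_lam hq hpq hvm
  obtain ⟨g, hg⟩ := exists_int_of_lam hq hpq hwm
  have key : ∀ i, (f i - g i : ℝ) =
      c * ((if i = b then 1 else 0) - (if i = a then 1 else 0)) := fun i => by
    have := congrArg (lam q p i) e
    rw [lam_sub, lam_smul, lam_sub, hf, hg, lam_nf hq, lam_nf hq] at this
    rw [this]; ring
  have hc : c = (f b - g b : ℤ) := by
    have := key b
    rw [if_pos rfl, if_neg hab.symm] at this
    push_cast
    linarith
  rw [hf, hg, key]
  obtain ⟨s, rfl, hs⟩ := h.unimod V hV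
  obtain ⟨i, rfl⟩ := hv
  obtain ⟨j, rfl⟩ := hw
  by_cases hij : j = i
  · subst hij
    rw [← key, ← hf, ← hg, sub_self]
    exact zero_le_one
  have hdvd : (f b - g b) ∣ edgeDet s := dvd_edgeDet hij fun r => by
    refine ⟨nfTetra q p b r - nfTetra q p a r, ?_⟩
    have := congrFun e r
    rw [hc] at this
    simp only [rcast, Pi.sub_apply, Pi.smul_apply, smul_eq_mul] at this
    exact_mod_cast this
  have h1 : (f b - g b).natAbs = 1 := by
    rw [← Int.natAbs_dvd_natAbs, hs] at hdvd
    exact Nat.dvd_one.1 hdvd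
  rw [hc]
  obtain h2 | h2 : f b - g b = 1 ∨ f b - g b = -1 := by omega
  all_goals rw [h2]; split_ifs <;> norm_num

theorem exists_pair_of_sum_eq_zero {D : Fin 4 → ℤ} (h1 : ∀ i, D i ≤ 1) (h2 : ∀ i, -1 ≤ D i)
    {m : Fin 4} (hm : D m = 0) (hs : D 0 + D 1 + D 2 + D 3 = 0) :
    ∃ a b, a ≠ b ∧ ∀ i, D i = D b * ((if i = b then 1 else 0) - (if i = a then 1 else 0)) := by
  have pair : ∀ a b : Fin 4, a ≠ b → (∀ i, i ≠ a → i ≠ b → D i = 0) → D a = -D b →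
      ∃ a b, a ≠ b ∧ ∀ i, D i = D b * ((if i = b then 1 else 0) - (if i = a then 1 else 0)) := by
    refine fun a b hab h h' => ⟨a, b, hab, fun i => ?_⟩
    by_cases hb : i = b
    · subst hb
      rw [if_pos rfl, if_neg hab.symm]; ring
    by_cases ha : i = a
    · subst ha
      rw [if_pos rfl, if_neg hb, h']; ring
    · rw [if_neg ha, if_neg hb, h i ha hb]; ring
  have := h1 0; have := h1 1; have := h1 2; have := h1 3
  have := h2 0; have := h2 1; have := h2 2; have := h2 3
  obtain ⟨n, hnm, hn⟩ : ∃ n, n ≠ m ∧ D n = 0 := by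
    fin_cases m
    · obtain h | h | h : D 1 = 0 ∨ D 2 = 0 ∨ D 3 = 0 := by simp at hm; omega
      exacts [⟨1, by decide, h⟩, ⟨2, by decide, h⟩, ⟨3, by decide, h⟩]
    · obtain h | h | h : D 0 = 0 ∨ D 2 = 0 ∨ D 3 = 0 := by simp at hm; omega
      exacts [⟨0, by decide, h⟩, ⟨2, by decide, h⟩, ⟨3, by decide, h⟩]
    · obtain h | h | h : D 0 = 0 ∨ D 1 = 0 ∨ D 3 = 0 := by simp at hm; omega
      exacts [⟨0, by decide, h⟩, ⟨1, by decide, h⟩, ⟨3, by decide, h⟩]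
    · obtain h | h | h : D 0 = 0 ∨ D 1 = 0 ∨ D 2 = 0 := by simp at hm; omega
      exacts [⟨0, by decide, h⟩, ⟨1, by decide, h⟩, ⟨2, by decide, h⟩]
  obtain ⟨a, b, hab, hc, hs'⟩ : ∃ a b : Fin 4, a ≠ b ∧ (∀ i, i ≠ a → i ≠ b → i = m ∨ i = n) ∧
      D a + D b + D m + D n = D 0 + D 1 + D 2 + D 3 := by
    fin_cases m <;> fin_cases n <;> first
      | exact absurd rfl hnm
      | exact ⟨0, 1, by decide, by decide, by simp; ring⟩
      | exact ⟨0, 2, by decide, by decide, by simp; ring⟩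
      | exact ⟨0, 3, by decide, by decide, by simp; ring⟩
      | exact ⟨1, 2, by decide, by decide, by simp; ring⟩
      | exact ⟨1, 3, by decide, by decide, by simp; ring⟩
      | exact ⟨2, 3, by decide, by decide, by simp; ring⟩
      | exact ⟨0, 1, by decide, by decide, rfl⟩
  refine pair a b hab (fun i hia hib => ?_) (by omega)
  rcases hc i hia hib with rfl | rfl <;> assumption

theorem AlcOn.parallelEdge (hq : 0 < q) (hpq : IsCoprime p q) {m : Fin 4} {c : ℤ}
    {V : Set (Fin 3 → ℤ)} (h : AlcOn q p m c V) {v w : Fin 3 → ℤ} (hv : v ∈ V) (hw : w ∈ V)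
    (hvm : lam q p m (rcast v) = c) (hwm : lam q p m (rcast w) = c) : ParallelEdge q p v w := by
  obtain ⟨f, hf⟩ := exists_int_of_lam hq hpq hvm
  obtain ⟨g, hg⟩ := exists_int_of_lam hq hpq hwm
  have e1 := lam_sum (q := q) (p := p) 0 (rcast v)
  have e2 := lam_sum (q := q) (p := p) 0 (rcast w)
  rw [hf, hf, hf, hf] at e1
  rw [hg, hg, hg, hg] at e2
  norm_cast at e1 e2
  simp only [zero_add] at e1 e2
  obtain ⟨a, b, hab, hD⟩ := exists_pair_of_sum_eq_zero (D := fun i => g i - f i) (m := m)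
    (fun i => by
      have := h w hw v hv hwm hvm i
      rw [hf, hg] at this
      exact_mod_cast this)
    (fun i => by
      have := h v hv w hw hvm hwm i
      rw [hf, hg] at this
      norm_cast at this
      change -1 ≤ g i - f i
      omega)
    (by
      rw [hf] at hvm
      rw [hg] at hwm
      norm_cast at hvm hwm
      simp [hvm, hwm])
    (by omega)
  refine ⟨a, b, (g b - f b : ℤ), hab, lam_ext (p := p) hq fun i => ?_⟩
  rw [lam_sub, lam_smul, lam_sub, hf, hg, lam_nf hq, lam_nf hq]
  have := hD i
  have h' : (g i - f i : ℝ) =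
      (g b - f b : ℤ) * ((if i = b then 1 else 0) - (if i = a then 1 else 0)) := by
    exact_mod_cast this
  rw [h']; ring

/-- The tetrahedra of the cells filling the region between `L • Δ` and a translate of
`(k - L) • Δ` inside `k • Δ`. -/
def cells (q p L k : ℤ) : Set (Set (Fin 3 → ℤ)) :=
  {V | ∃ i J j d, 0 ≤ i ∧ i < L ∧ L ≤ J ∧ J < k ∧ CellTet q p i J j d V}

theorem exists_cells (hq : 0 < q) (hpq : IsCoprime p q) {L k : ℤ} {x : Fin 3 → ℝ}
    (hx : x ∈ region q p ![-k, 0, 0, 0]) (h0 : lam q p 0 x < -L) (h1 : lam q p 1 x < L) :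
    ∃ V ∈ cells q p L k, x ∈ convexHull ℝ (rcast '' V) := by
  have hx0 := hx 0
  have hx1 := hx 1
  have hx2 := hx 2
  have hx3 := hx 3
  simp only [Matrix.cons_val] at hx0 hx1 hx2 hx3
  push_cast at hx0 hx1 hx2 hx3
  have ez0 : lam q p 0 x = -(lam q p 1 x + x 2) := rfl
  have ez : lam q p 2 x + lam q p 3 x = x 2 := by rw [lam_two, lam_three]; ring
  set i := ⌊lam q p 1 x⌋ with hi
  set J := min ⌊lam q p 1 x + x 2⌋ (k - 1) with hJ
  have i0 : 0 ≤ i := Int.floor_nonneg.2 hx1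
  have i1 : (i : ℝ) ≤ lam q p 1 x := Int.floor_le _
  have i2 : lam q p 1 x < i + 1 := Int.lt_floor_add_one _
  have iL : i < L := Int.floor_lt.2 h1
  have hLk : L < k := by
    have : (L : ℝ) < k := by linarith
    exact_mod_cast this
  have JL : L ≤ J := le_min (Int.le_floor.2 (by linarith)) (by omega)
  have Jk : J < k := by have := min_le_right ⌊lam q p 1 x + x 2⌋ (k - 1); omega
  have J1 : (J : ℝ) ≤ lam q p 1 x + x 2 :=
    (Int.cast_le.2 (min_le_left _ _)).trans (Int.floor_le _)
  have J2 : lam q p 1 x + x 2 ≤ J + 1 := by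
    rcases min_choice ⌊lam q p 1 x + x 2⌋ (k - 1) with h | h <;> rw [hJ, h]
    · exact (Int.lt_floor_add_one _).le
    · push_cast; linarith
  set j := min ⌊lam q p 3 x⌋ (J - i - 1) with hj
  have j0 : 0 ≤ j := le_min (Int.floor_nonneg.2 hx3) (by omega)
  have j1 : j < J - i := by have := min_le_right ⌊lam q p 3 x⌋ (J - i - 1); omega
  have j2 : (j : ℝ) ≤ lam q p 3 x := (Int.cast_le.2 (min_le_left _ _)).trans (Int.floor_le _)
  have j3 : j ≠ J - i - 1 → lam q p 3 x ≤ j + 1 := fun hne => by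
    rcases min_choice ⌊lam q p 3 x⌋ (J - i - 1) with h | h
    · rw [hj, h]; exact (Int.lt_floor_add_one _).le
    · exact absurd h hne
  have j4 : j = J - i - 1 → (j : ℝ) = J - i - 1 := fun h => by rw [h]; push_cast; ring
  clear_value i J j
  rcases le_total (J - i : ℝ) (x 2) with hz | hz
  · obtain ⟨V, hV, hxV⟩ := exists_cellTet hq hpq j0 j1 (d := 0) (Or.inl rfl) (x := x)
      (ρ := x 2 - (J - i)) (by linarith) (by linarith) (by push_cast; ring)
      (by push_cast; linarith) (by push_cast; linarith) j2 (by
        split_ifs with h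
        · have := j4 h
          push_cast; linarith
        · have := j3 h
          push_cast; linarith)
    exact ⟨V, ⟨i, J, j, 0, i0, iL, JL, Jk, hV⟩, hxV⟩
  · obtain ⟨V, hV, hxV⟩ := exists_cellTet hq hpq j0 j1 (d := 1) (Or.inr rfl) (x := x)
      (ρ := (J - i) - x 2) (by linarith) (by linarith) (by push_cast; ring)
      (by push_cast; linarith) (by push_cast; linarith) j2 (by
        split_ifs with h
        · have := j4 h
          push_cast; linarith
        · have := j3 h
          push_cast; linarith)
    exact ⟨V, ⟨i, J, j, 1, i0, iL, JL, Jk, hV⟩, hxV⟩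

theorem GoodFam.union (hq : 0 < q) (hpq : IsCoprime p q) {L k : ℤ} (hL : 0 ≤ L) (hLk : L ≤ k)
    {T₁ T₂ : Set (Set (Fin 3 → ℤ))} (h₁ : GoodFam q p ![-L, 0, 0, 0] T₁)
    (h₂ : GoodFam q p ![-k, L, 0, 0] T₂) :
    GoodFam q p ![-k, 0, 0, 0] (T₁ ∪ T₂ ∪ cells q p L k) := by
  have hL' : (0 : ℝ) ≤ L := by exact_mod_cast hL
  have hLk' : (L : ℝ) ≤ k := by exact_mod_cast hLk
  have b₁ : ∀ V ∈ T₁, ∀ v ∈ V, -(L : ℝ) ≤ lam q p 0 (rcast v) ∧ 0 ≤ lam q p 1 (rcast v) ∧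
      0 ≤ lam q p 2 (rcast v) ∧ 0 ≤ lam q p 3 (rcast v) := fun V hV v hv => by
    have h := h₁.sub V hV v hv
    have := h 0; have := h 1; have := h 2; have := h 3
    simp only [Matrix.cons_val] at *
    push_cast at *
    refine ⟨?_, ?_, ?_, ?_⟩ <;> assumption
  have b₂ : ∀ V ∈ T₂, ∀ v ∈ V, -(k : ℝ) ≤ lam q p 0 (rcast v) ∧ L ≤ lam q p 1 (rcast v) ∧
      0 ≤ lam q p 2 (rcast v) ∧ 0 ≤ lam q p 3 (rcast v) := fun V hV v hv => by
    have h := h₂.sub V hV v hv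
    have := h 0; have := h 1; have := h 2; have := h 3
    simp only [Matrix.cons_val] at *
    push_cast at *
    refine ⟨?_, ?_, ?_, ?_⟩ <;> assumption
  have b₃ : ∀ V ∈ cells q p L k, ∀ v ∈ V, -(k : ℝ) ≤ lam q p 0 (rcast v) ∧
      lam q p 0 (rcast v) ≤ -L ∧ 0 ≤ lam q p 1 (rcast v) ∧ lam q p 1 (rcast v) ≤ L ∧
      0 ≤ lam q p 2 (rcast v) ∧ 0 ≤ lam q p 3 (rcast v) := by
    rintro V ⟨i, J, j, d, i0, i1, J0, J1, hV⟩ v hv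
    obtain ⟨⟨c1, c2⟩, ⟨c3, c4⟩, c5, c6, -⟩ := hV.bounds hq hpq hv
    have hj : (0 : ℝ) ≤ j := by exact_mod_cast hV.nonneg
    have : (0 : ℝ) ≤ i := by exact_mod_cast i0
    have : (i : ℝ) + 1 ≤ L := by exact_mod_cast i1
    have : (L : ℝ) ≤ J := by exact_mod_cast J0
    have : (J : ℝ) + 1 ≤ k := by exact_mod_cast J1
    refine ⟨?_, ?_, ?_, ?_, ?_, ?_⟩ <;> linarith
  have sum : ∀ v : Fin 3 → ℤ, lam q p 0 (rcast v) + lam q p 1 (rcast v) + lam q p 2 (rcast v) +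
      lam q p 3 (rcast v) = 0 := fun v => lam_sum 0 (rcast v)
  have u₃ : ∀ V ∈ cells q p L k, Unimod V := fun V ⟨i, J, j, d, _, _, _, _, hV⟩ =>
    hV.unimod hq hpq
  have a₃ : ∀ V ∈ cells q p L k, ∀ m c, AlcOn q p m c V :=
    fun V ⟨i, J, j, d, _, _, _, _, hV⟩ m c => hV.alcOn hq m c hpq
  have p₁₂ : ∀ V ∈ T₁, ∀ W ∈ T₂, Proper (rcast '' V) (rcast '' W) := fun V hV W hW => by
    refine proper_of_lam_sep hq hpq (m := 1) (c := L) (h₁.unimod V hV).finite (fun v hv => ?_)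
      (fun v hv => (b₂ W hW v hv).2.1) ?_ (h₂.alcOn hq hpq hW 1)
    · have := b₁ V hV v hv
      linarith [sum v]
    · intro v hv w hw ev ew i
      have := b₁ V hV v hv
      have := b₁ V hV w hw
      have := sum v
      have := sum w
      fin_cases i <;> simp only [Fin.zero_eta, Fin.mk_one, Fin.reduceFinMk] <;> linarith
  have p₁₃ : ∀ V ∈ T₁, ∀ W ∈ cells q p L k, Proper (rcast '' W) (rcast '' V) :=
    fun V hV W hW => proper_of_lam_sep hq hpq (m := 0) (c := -L) (u₃ W hW).finite
      (fun v hv => by push_cast; exact (b₃ W hW v hv).2.1)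
      (fun v hv => by push_cast; exact (b₁ V hV v hv).1) (a₃ W hW _ _) (h₁.alcOn hq hpq hV 0)
  have p₂₃ : ∀ V ∈ T₂, ∀ W ∈ cells q p L k, Proper (rcast '' W) (rcast '' V) :=
    fun V hV W hW => proper_of_lam_sep hq hpq (m := 1) (c := L) (u₃ W hW).finite
      (fun v hv => (b₃ W hW v hv).2.2.2.1)
      (fun v hv => (b₂ V hV v hv).2.1) (a₃ W hW _ _) (h₂.alcOn hq hpq hV 1)
  refine ⟨?_, ?_, ?_, ?_, ?_⟩
  · rintro V ((hV | hV) | hV)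
    exacts [h₁.unimod V hV, h₂.unimod V hV, u₃ V hV]
  · rintro V ((hV | hV) | hV) v hv i
    · have := b₁ V hV v hv
      fin_cases i <;> simp <;> linarith
    · have := b₂ V hV v hv
      fin_cases i <;> simp <;> linarith
    · have := b₃ V hV v hv
      fin_cases i <;> simp <;> linarith
  · intro x hx
    have hx0 := hx 0
    have hx1 := hx 1
    have hx2 := hx 2
    have hx3 := hx 3
    rcases le_or_gt (-(L : ℝ)) (lam q p 0 x) with h0 | h0
    · obtain ⟨V, hV, hxV⟩ := h₁.cover x fun i => by
        fin_cases i
        exacts [by simpa using h0, hx1, hx2, hx3]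
      exact ⟨V, Or.inl (Or.inl hV), hxV⟩
    rcases le_or_gt (L : ℝ) (lam q p 1 x) with h1 | h1
    · obtain ⟨V, hV, hxV⟩ := h₂.cover x fun i => by
        fin_cases i
        exacts [hx0, h1, hx2, hx3]
      exact ⟨V, Or.inl (Or.inr hV), hxV⟩
    obtain ⟨V, hV, hxV⟩ := exists_cells hq hpq hx h0 h1
    exact ⟨V, Or.inr hV, hxV⟩
  · rintro V ((hV | hV) | hV) W ((hW | hW) | hW)
    · exact h₁.proper V hV W hW
    · exact p₁₂ V hV W hW
    · exact (p₁₃ V hV W hW).symm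
    · exact (p₁₂ W hW V hV).symm
    · exact h₂.proper V hV W hW
    · exact (p₂₃ V hV W hW).symm
    · exact p₁₃ W hW V hV
    · exact p₂₃ W hW V hV
    · obtain ⟨i, J, j, d, _, _, _, _, hV⟩ := hV
      obtain ⟨i', J', j', d', _, _, _, _, hW⟩ := hW
      exact hV.proper hq hpq hW
  · rintro V ((hV | hV) | hV) v hv w hw m ev ew
    · have := b₁ V hV v hv
      have := b₁ V hV w hw
      refine h₁.bdry V hV v hv w hw m ?_ ?_
      all_goals
        fin_cases m
        · simp at ev ew ⊢; linarith
        all_goals assumption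
    · have := b₂ V hV v hv
      have := b₂ V hV w hw
      refine h₂.bdry V hV v hv w hw m ?_ ?_
      all_goals
        fin_cases m
        · assumption
        · simp at ev ew ⊢; linarith
        all_goals assumption
    · exact (a₃ V hV m _).parallelEdge hq hpq hv hw ev ew

theorem hasUnimodTriangStdBdry_nf_add (hq : 0 < q) (hpq : IsCoprime p q) {k₁ k₂ : ℕ}
    (h₁ : HasUnimodTriangStdBdry k₁ (nfTetra q p)) (h₂ : HasUnimodTriangStdBdry k₂ (nfTetra q p)) :
    HasUnimodTriangStdBdry (k₁ + k₂) (nfTetra q p) := by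
  have hq' : (q : ℝ) ≠ 0 := by exact_mod_cast hq.ne'
  obtain ⟨T₁, h₁⟩ := exists_goodFam hq h₁
  obtain ⟨T₂, h₂⟩ := exists_goodFam hq h₂
  have h₂' := h₂.translate (κ' := ![-(k₁ + k₂ : ℕ), k₁, 0, 0]) ![q * k₁, p * k₁, 0] fun i => by
    fin_cases i <;> simp [lam, rcast] <;> field_simp <;> ring
  exact (h₁.union hq hpq (by positivity) (by push_cast; omega) h₂').hasUnimodTriangStdBdry hq

end Union

section Terminal

theorem exists_ceil (x : ℤ) {m : ℤ} (hm : 0 < m) : ∃ g, (g - 1) * m < x ∧ x ≤ g * m := by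
  refine ⟨-(-x / m), ?_, ?_⟩
  · have := Int.lt_ediv_add_one_mul_self (-x) hm
    linarith
  · have := Int.ediv_mul_le (-x) hm.ne'
    linarith

/-- The arithmetic core of White's theorem on empty lattice tetrahedra. -/
theorem eq_one_of_sum_ediv {N a b c : ℤ} (hc : 1 ≤ c) (hcb : c ≤ b) (hba : b ≤ a)
    (ha : a < N) (hs : a + b + c = N + 1)
    (hf : ∀ j, 0 < j → j < N → j * a / N + j * b / N + j * c / N = j - 1)
    (hnd : ∀ j, 0 < j → j < N → ¬ N ∣ j * a) : c = 1 := by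
  by_contra hc1
  have hc2 : 2 ≤ c := by omega
  have hN : 0 < N := by omega
  have h2a : N < 2 * a := by
    rcases lt_trichotomy N (2 * a) with h | h | h
    · exact h
    · exact absurd ⟨1, by rw [mul_one, h]⟩ (hnd 2 (by norm_num) (by omega))
    · have := hf 2 (by norm_num) (by omega)
      rw [Int.ediv_eq_zero_of_lt (by omega) h, Int.ediv_eq_zero_of_lt (by omega) (by omega),
        Int.ediv_eq_zero_of_lt (by omega) (by omega)] at this
      omega
  obtain ⟨B, hB⟩ : ∃ B, B = N - a := ⟨_, rfl⟩
  have h : ∀ j, 0 ≤ j → j < N → j * b / N + j * c / N = j * B / N := by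
    intro j h0 h1
    rcases h0.eq_or_lt with rfl | h0
    · simp
    have e := hf j h0 h1
    have hne := hnd j h0 h1
    have h3 : j * a / N = j - 1 - j * B / N := by
      rw [Int.ediv_eq_iff_of_pos hN]
      have h4 := Int.ediv_mul_le (j * B) hN.ne'
      have h5 := Int.lt_ediv_add_one_mul_self (j * B) hN
      have h6 : j * a = j * N - j * B := by rw [hB]; ring
      have h7 : j * B / N * N ≠ j * B := fun h7 => hne ⟨j - j * B / N,
          by linear_combination h6 + h7⟩
      have h8 := lt_of_le_of_ne h4 h7
      constructor <;> nlinarith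
    omega
  have hB0 : 3 ≤ B := by omega
  obtain ⟨G, hG1, hG2⟩ := exists_ceil N (m := B) (by omega)
  obtain ⟨s, hs1, hs2⟩ := exists_ceil N (m := c) (by omega)
  have hG0 : 0 < G := by nlinarith
  have hGN : G < N := by nlinarith
  have hGb : N ≤ G * b := by
    by_contra! hlt
    have hlt' : G * c < N := by nlinarith
    have e := h G hG0.le hGN
    rw [Int.ediv_eq_zero_of_lt (by nlinarith) hlt, Int.ediv_eq_zero_of_lt (by nlinarith) hlt'] at e
    have : 1 ≤ G * B / N := (Int.le_ediv_iff_mul_le hN).2 (by linarith)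
    omega
  have hs0 : 0 < s := by nlinarith
  have hsN : s < N := by nlinarith
  obtain ⟨t, ht⟩ : ∃ t, t = s * b / N := ⟨_, rfl⟩
  have ht1 : t * N ≤ s * b := by rw [ht]; exact Int.ediv_mul_le _ hN.ne'
  have ht2 : s * b < (t + 1) * N := by rw [ht]; exact Int.lt_ediv_add_one_mul_self _ hN
  have ht0 : 1 ≤ t := by rw [ht]; exact (Int.le_ediv_iff_mul_le hN).2 (by nlinarith)
  have htb : t + 1 ≤ b := by
    by_contra! hlt
    have : t * N ≥ b * N := by nlinarith
    nlinarith
  have hb0 : 0 < b := by omega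
  obtain ⟨u, hu1, hu2⟩ := exists_ceil (t * N) hb0
  obtain ⟨r, hr1, hr2⟩ := exists_ceil ((t + 1) * N) hb0
  have hus : u ≤ s := by
    by_contra! hlt
    have := mul_le_mul_of_nonneg_right (by omega : s ≤ u - 1) hb0.le
    linarith
  have hu0 : 1 ≤ u := by
    by_contra! hlt
    have h1 := mul_le_mul_of_nonneg_right (by omega : u ≤ 0) hb0.le
    have h2 := mul_le_mul_of_nonneg_right ht0 hN.le
    linarith
  have hsr : s < r := by
    by_contra! hlt
    have := mul_le_mul_of_nonneg_right hlt hb0.le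
    linarith
  have hrN : r ≤ N := by
    by_contra! hlt
    have h1 := mul_le_mul_of_nonneg_right (by omega : N ≤ r - 1) hb0.le
    have h2 := mul_le_mul_of_nonneg_right htb hN.le
    linarith
  have hgap : r - u ≤ G := by
    by_contra! hlt
    have := mul_le_mul_of_nonneg_right (by omega : u + G ≤ r - 1) hb0.le
    linarith
  have hlow : (u - 1) * B < t * N := by
    have e := h (u - 1) (by omega) (by omega)
    have e1 : (u - 1) * b / N < t := (Int.ediv_lt_iff_lt_mul hN).2 hu1
    have e2 : (u - 1) * c / N < 1 := (Int.ediv_lt_iff_lt_mul hN).2 (by nlinarith)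
    exact (Int.ediv_lt_iff_lt_mul hN).1 (by omega)
  have hhigh : (t + 2) * N ≤ r * B := by
    rcases hrN.eq_or_lt with rfl | hlt
    · nlinarith
    have e := h r (by omega) hlt
    have e1 : t + 1 ≤ r * b / N := (Int.le_ediv_iff_mul_le hN).2 hr2
    have e2 : 1 ≤ r * c / N := (Int.le_ediv_iff_mul_le hN).2 (by nlinarith)
    exact (Int.le_ediv_iff_mul_le hN).1 (by omega)
  have hG3 : 3 ≤ G := by
    by_contra! hlt
    have := mul_le_mul_of_nonneg_right (by omega : G ≤ 2) (by omega : 0 ≤ B)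
    omega
  have h1 := mul_le_mul_of_nonneg_right hgap (by omega : 0 ≤ B)
  have h2 := mul_le_mul_of_nonneg_right hG3 (by omega : 0 ≤ B)
  linarith

end Terminal

section White

theorem eq_one_of_sum_emod {N : ℤ} {a : Fin 3 → ℤ} (h1 : ∀ i, 1 ≤ a i) (h2 : ∀ i, a i < N)
    (hf : ∀ j, 0 < j → j < N → j * a 0 % N + j * a 1 % N + j * a 2 % N = N + j)
    (hnd : ∀ i j, 0 < j → j < N → ¬ N ∣ j * a i) : ∃ i, a i = 1 := by
  have hN : 1 < N := (h1 0).trans_lt (h2 0)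
  have hs : a 0 + a 1 + a 2 = N + 1 := by
    have := hf 1 one_pos hN
    simp only [one_mul] at this
    rwa [Int.emod_eq_of_lt (by linarith [h1 0]) (h2 0),
      Int.emod_eq_of_lt (by linarith [h1 1]) (h2 1),
      Int.emod_eq_of_lt (by linarith [h1 2]) (h2 2)] at this
  have hf' : ∀ j, 0 < j → j < N → j * a 0 / N + j * a 1 / N + j * a 2 / N = j - 1 := by
    intro j h0 hj
    have := hf j h0 hj
    rw [Int.emod_def, Int.emod_def, Int.emod_def] at this
    have e : j * (a 0 + a 1 + a 2) = j * (N + 1) := by rw [hs]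
    have : N * (j * a 0 / N + j * a 1 / N + j * a 2 / N) = N * (j - 1) := by linarith
    exact mul_left_cancel₀ (by omega) this
  rcases le_total (a 0) (a 1) with h01 | h01 <;> rcases le_total (a 1) (a 2) with h12 | h12 <;>
    rcases le_total (a 0) (a 2) with h02 | h02
  · exact ⟨0, eq_one_of_sum_ediv (h1 0) h01 h12 (h2 2) (by omega)
      (fun j h0 hj => by rw [← hf' j h0 hj]; ring) (hnd 2)⟩
  · exact ⟨0, eq_one_of_sum_ediv (h1 0) h01 h12 (h2 2) (by omega)
      (fun j h0 hj => by rw [← hf' j h0 hj]; ring) (hnd 2)⟩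
  · exact ⟨0, eq_one_of_sum_ediv (h1 0) h02 h12 (h2 1) (by omega)
      (fun j h0 hj => by rw [← hf' j h0 hj]; ring) (hnd 1)⟩
  · exact ⟨2, eq_one_of_sum_ediv (h1 2) h02 h01 (h2 1) (by omega)
      (fun j h0 hj => by rw [← hf' j h0 hj]; ring) (hnd 1)⟩
  · exact ⟨1, eq_one_of_sum_ediv (h1 1) h01 h02 (h2 2) (by omega)
      (fun j h0 hj => by rw [← hf' j h0 hj]; ring) (hnd 2)⟩
  · exact ⟨1, eq_one_of_sum_ediv (h1 1) h12 h02 (h2 0) (by omega)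
      (fun j h0 hj => by rw [← hf' j h0 hj]; ring) (hnd 0)⟩
  · exact ⟨2, eq_one_of_sum_ediv (h1 2) h12 h01 (h2 0) (by omega)
      (fun j h0 hj => by rw [← hf' j h0 hj]) (hnd 0)⟩
  · exact ⟨2, eq_one_of_sum_ediv (h1 2) h12 h01 (h2 0) (by omega)
      (fun j h0 hj => by rw [← hf' j h0 hj]) (hnd 0)⟩

/-- `r i / N` are the linear parts of the barycentric coordinates with respect to `v`. -/
structure BaryForms (v : Fin 4 → Fin 3 → ℤ) (N : ℤ) (r : Fin 4 → (Fin 3 → ℤ) →ₗ[ℤ] ℤ) : Prop where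
  pos : 0 < N
  det : |edgeDet v| = N
  sum : ∀ x, r 0 x + r 1 x + r 2 x + r 3 x = 0
  eval : ∀ i j, r i (v j - v 0) = N * ((if i = j then 1 else 0) - (if i = 0 then 1 else 0))
  recon : ∀ x, N • x = r 0 x • v 0 + r 1 x • v 1 + r 2 x • v 2 + r 3 x • v 3

variable {v : Fin 4 → Fin 3 → ℤ} {N : ℤ} {r : Fin 4 → (Fin 3 → ℤ) →ₗ[ℤ] ℤ}

theorem edgeDet_ne_zero (h : AffineIndependent ℝ fun i => rcast (v i)) : edgeDet v ≠ 0 := by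
  intro h0
  rw [edgeDet, ← Matrix.det_transpose, ← Matrix.exists_mulVec_eq_zero_iff] at h0
  obtain ⟨y, hy, hy0⟩ := h0
  have key := affineIndependent_iff.1 h Finset.univ ![-(y 0 + y 1 + y 2 : ℝ), y 0, y 1, y 2]
    (by simp [Fin.sum_univ_succ]; ring) (by
      funext l
      have := congrFun hy0 l
      simp [Matrix.mulVec, dotProduct, Fin.sum_univ_succ] at this
      have h' : ((v 1 l - v 0 l) * y 0 + ((v 2 l - v 0 l) * y 1 +
          (v 3 l - v 0 l) * y 2) : ℝ) = 0 := by
        exact_mod_cast this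
      simp [Fin.sum_univ_succ, rcast]
      linarith)
  apply hy
  funext l
  have := key l.succ (Finset.mem_univ _)
  fin_cases l <;> simpa using this

theorem exists_baryForms (h : AffineIndependent ℝ fun i => rcast (v i)) :
    ∃ N r, BaryForms v N r ∧ ∀ g : ℤ, (∀ x, g ∣ r 1 x) → ∀ l m,
      g ∣ (v 2 l - v 0 l) * (v 3 m - v 0 m) - (v 2 m - v 0 m) * (v 3 l - v 0 l) := by
  have hD := edgeDet_ne_zero h
  obtain ⟨D, hDD⟩ : ∃ D, D = edgeDet v := ⟨_, rfl⟩
  obtain ⟨E, hE⟩ : ∃ E : Matrix (Fin 3) (Fin 3) ℤ, E = Matrix.of fun l i => v i.succ l - v 0 l :=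
    ⟨_, rfl⟩
  have hdet : E.det = D := by
    rw [hDD, edgeDet, ← Matrix.det_transpose, hE]; rfl
  obtain ⟨s, hs⟩ : ∃ s : Fin 3 → (Fin 3 → ℤ) →ₗ[ℤ] ℤ,
      ∀ i x, s i x = D.sign * (E.adjugate.mulVec x) i :=
    ⟨fun i => D.sign • (LinearMap.proj i ∘ₗ Matrix.toLin' E.adjugate), fun i x => by simp⟩
  have hev : ∀ i j : Fin 3, s i (v j.succ - v 0) = |D| * (if i = j then 1 else 0) := by
    intro i j
    have e : v j.succ - v 0 = E.mulVec (Pi.single j 1) := by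
      funext l
      simp [hE]
    rw [hs, e, Matrix.mulVec_mulVec, Matrix.adjugate_mul, hdet, ← Int.sign_mul_self_eq_abs]
    simp only [Matrix.smul_mulVec, Matrix.one_mulVec, Pi.smul_apply, Pi.single_apply, smul_eq_mul,
      mul_assoc]
  have hrec : ∀ x l, |D| * x l = s 0 x * (v 1 l - v 0 l) + s 1 x * (v 2 l - v 0 l) +
      s 2 x * (v 3 l - v 0 l) := by
    intro x l
    have e : E.mulVec (E.adjugate.mulVec x) l = D * x l := by
      rw [Matrix.mulVec_mulVec, Matrix.mul_adjugate, hdet]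
      simp
    rw [← Int.sign_mul_self_eq_abs, mul_assoc, ← e, hs, hs, hs]
    generalize E.adjugate.mulVec x = y
    simp [hE, Matrix.mulVec, dotProduct, Fin.sum_univ_succ]
    ring
  refine ⟨|D|, ![-(s 0 + s 1 + s 2), s 0, s 1, s 2],
      ⟨abs_pos.2 (hDD ▸ hD), by rw [hDD], ?_, ?_, ?_⟩,
    ?_⟩
  · intro x
    simp
    ring
  · intro i j
    induction j using Fin.cases with
    | zero => simp
    | succ j =>
      fin_cases i <;> simp [hev] <;> fin_cases j <;> simp
  · intro x
    funext l
    simp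
    rw [hrec]
    ring
  · intro g hg
    have hadj : ∀ m, g ∣ E.adjugate 0 m := by
      intro m
      have h1 := hg (Pi.single m 1)
      simp only [Matrix.cons_val, hs] at h1
      have h2 := h1.mul_left D.sign
      rw [← mul_assoc, ← Int.sign_mul, Int.sign_eq_one_of_pos (mul_self_pos.2 (hDD ▸ hD))] at h2
      simpa using h2
    have a0 := hadj 0
    have a1 := hadj 1
    have a2 := hadj 2
    rw [Matrix.adjugate_fin_three] at a0 a1 a2
    simp [hE] at a0 a1 a2
    obtain ⟨c0, a0⟩ := a0
    obtain ⟨c1, a1⟩ := a1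
    obtain ⟨c2, a2⟩ := a2
    intro l m
    fin_cases l <;> fin_cases m <;> simp only [Fin.zero_eta, Fin.mk_one, Fin.reduceFinMk]
    · exact ⟨0, by ring⟩
    · exact ⟨c2, by linear_combination a2⟩
    · exact ⟨-c1, by linear_combination -a1⟩
    · exact ⟨-c2, by linear_combination -a2⟩
    · exact ⟨0, by ring⟩
    · exact ⟨c0, by linear_combination a0⟩
    · exact ⟨c1, by linear_combination a1⟩
    · exact ⟨-c0, by linear_combination -a0⟩
    · exact ⟨0, by ring⟩

end White

section Empty

variable {v : Fin 4 → Fin 3 → ℤ} {N : ℤ} {r : Fin 4 → (Fin 3 → ℤ) →ₗ[ℤ] ℤ}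

/-- A lattice point of an empty tetrahedron has a barycentric coordinate equal to one. -/
theorem BaryForms.exists_eq (hr : BaryForms v N r) (hv : IsEmptyTetra v) (x : Fin 3 → ℤ)
    (f : Fin 4 → ℤ) (h0 : ∀ i, 0 ≤ r i x + N * f i) (hf : f 0 + f 1 + f 2 + f 3 = 1) :
    ∃ j, r j x + N * f j = N := by
  have hN := hr.pos
  have hN' : (0 : ℝ) < N := by exact_mod_cast hN
  have hz : rcast (x + (f 0 • v 0 + f 1 • v 1 + f 2 • v 2 + f 3 • v 3)) =
      ∑ i, ((r i x + N * f i : ℤ) / N : ℝ) • rcast (v i) := by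
    funext l
    have := congrFun (hr.recon x) l
    simp only [Pi.smul_apply, Pi.add_apply, smul_eq_mul] at this
    have e : (N * x l : ℝ) = r 0 x * v 0 l + r 1 x * v 1 l + r 2 x * v 2 l + r 3 x * v 3 l := by
      exact_mod_cast this
    simp [rcast, Fin.sum_univ_succ]
    field_simp
    linear_combination e
  obtain ⟨j, hj⟩ := hv.2 (x + (f 0 • v 0 + f 1 • v 1 + f 2 • v 2 + f 3 • v 3)) <| by
    rw [hz]
    refine (convex_convexHull ℝ _).sum_mem (fun i _ => ?_) ?_
      fun i _ => subset_convexHull ℝ _ ⟨i, rfl⟩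
    · exact div_nonneg (by exact_mod_cast h0 i) hN'.le
    · rw [← Finset.sum_div, div_eq_one_iff_eq hN'.ne']
      have e := hr.sum x
      rw [← Int.cast_sum]
      congr 1
      simp only [Fin.sum_univ_four]
      linear_combination e + N * hf
  refine ⟨j, ?_⟩
  have e : x = (v j - v 0) - (f 1 • (v 1 - v 0) + f 2 • (v 2 - v 0) + f 3 • (v 3 - v 0)) := by
    rw [← hj, show f 0 = 1 - f 1 - f 2 - f 3 by linarith]
    module
  have e' := congrArg (r j) e
  simp only [map_sub (r j) (v j - v 0), map_add, map_smul, hr.eval, smul_eq_mul] at e'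
  rw [e']
  fin_cases j <;> simp <;> first | ring1 | linear_combination N * hf

theorem BaryForms.dvd_or (hr : BaryForms v N r) (hv : IsEmptyTetra v) (x : Fin 3 → ℤ) :
    (∀ i, N ∣ r i x) ∨ (∀ i, ¬ N ∣ r i x) ∧
      r 0 x % N + r 1 x % N + r 2 x % N + r 3 x % N = 2 * N := by
  have hN := hr.pos
  have hne : ∀ x, r 0 x % N + r 1 x % N + r 2 x % N + r 3 x % N ≠ N := by
    intro x hx
    have e := hr.sum x
    obtain ⟨j, hj⟩ := hr.exists_eq hv x (fun i => -(r i x / N))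
      (fun i => by
        rw [mul_neg, ← sub_eq_add_neg, ← Int.emod_def]
        exact Int.emod_nonneg _ hN.ne')
      (by
        simp only [Int.emod_def] at hx
        refine mul_left_cancel₀ hN.ne' ?_
        linear_combination hx - e)
    rw [mul_neg, ← sub_eq_add_neg, ← Int.emod_def] at hj
    exact (Int.emod_lt_of_pos (r j x) hN).ne hj
  have hneg : ∀ i, ¬ N ∣ r i x → r i (-x) % N = N - r i x % N := fun i hi => by
    rw [map_neg, Int.neg_emod, if_neg hi, Int.natAbs_of_nonneg hN.le]
  have hzero : ∀ i, N ∣ r i x → r i (-x) % N = 0 ∧ r i x % N = 0 := fun i hi => by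
    rw [map_neg]
    exact ⟨Int.emod_eq_zero_of_dvd (hi.neg_right), Int.emod_eq_zero_of_dvd hi⟩
  have hpos : ∀ i, 0 ≤ r i x % N := fun i => Int.emod_nonneg _ hN.ne'
  have hlt : ∀ i, r i x % N < N := fun i => Int.emod_lt_of_pos _ hN
  obtain ⟨m, hm⟩ : ∃ m, r 0 x % N + r 1 x % N + r 2 x % N + r 3 x % N = N * m := by
    refine ⟨-(r 0 x / N + r 1 x / N + r 2 x / N + r 3 x / N), ?_⟩
    simp only [Int.emod_def]
    linear_combination hr.sum x
  have h1 := hne x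
  have h2 := hne (-x)
  have := hpos 0; have := hpos 1; have := hpos 2; have := hpos 3
  have := hlt 0; have := hlt 1; have := hlt 2; have := hlt 3
  have hm0 : 0 ≤ m := by nlinarith
  have hm4 : m < 4 := by nlinarith
  by_cases hall : ∀ i, N ∣ r i x
  · exact Or.inl hall
  have hm0' : m ≠ 0 := by
    rintro rfl
    refine hall fun i => Int.dvd_of_emod_eq_zero ?_
    fin_cases i <;> simp only [Fin.zero_eta, Fin.mk_one, Fin.reduceFinMk] <;> omega
  have hm1 : m ≠ 1 := by
    rintro rfl
    rw [mul_one] at hm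
    exact h1 hm
  right
  have hnd : ∀ i, ¬ N ∣ r i x := by
    by_contra! hcon
    obtain ⟨i, hi⟩ := hcon
    have hm3 : m ≠ 3 := by
      rintro rfl
      have := (hzero i hi).2
      fin_cases i <;> simp only [Fin.zero_eta, Fin.mk_one, Fin.reduceFinMk] at this <;> omega
    obtain rfl : m = 2 := by omega
    have cs : ∀ l, (r l (-x) % N = N - r l x % N) ∨ (r l (-x) % N = 0 ∧ r l x % N = 0) :=
      fun l => by
        by_cases hl : N ∣ r l x
        · exact Or.inr (hzero l hl)
        · exact Or.inl (hneg l hl)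
    have := hzero i hi
    have := cs 0; have := cs 1; have := cs 2; have := cs 3
    fin_cases i <;> simp only [Fin.zero_eta, Fin.mk_one, Fin.reduceFinMk] at * <;> omega
  refine ⟨hnd, ?_⟩
  have := hneg 0 (hnd 0); have := hneg 1 (hnd 1)
  have := hneg 2 (hnd 2); have := hneg 3 (hnd 3)
  obtain rfl | rfl : m = 2 ∨ m = 3 := by omega
  · linarith
  · exfalso; apply h2; linarith

/-- A facet of an empty tetrahedron spans a primitive sublattice. -/
theorem BaryForms.exists_eq_neg_one (hr : BaryForms v N r) (hv : IsEmptyTetra v)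
    (hg : ∀ g : ℤ, (∀ x, g ∣ r 1 x) → ∀ l m,
      g ∣ (v 2 l - v 0 l) * (v 3 m - v 0 m) - (v 2 m - v 0 m) * (v 3 l - v 0 l)) :
    ∃ x, r 1 x = -1 := by
  have hN := hr.pos
  have hprin : (LinearMap.range (r 1)).IsPrincipal := IsPrincipalIdealRing.principal _
  obtain ⟨g, hspan⟩ := hprin
  have hdvd : ∀ x, g ∣ r 1 x := fun x => by
    have : r 1 x ∈ LinearMap.range (r 1) := ⟨x, rfl⟩
    rw [hspan] at this
    exact Ideal.mem_span_singleton.1 this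
  obtain ⟨z, hz⟩ : ∃ z, r 1 z = g := by
    have : g ∈ LinearMap.range (r 1) := by
      rw [hspan]
      exact Ideal.mem_span_singleton_self g
    exact this
  have hg0 : g ≠ 0 := by
    rintro rfl
    have := hdvd (v 1 - v 0)
    rw [hr.eval] at this
    simp at this
    omega
  have hfacet : ∀ x, r 1 x = 0 → ∀ i, N ∣ r i x := fun x hx => by
    rcases hr.dvd_or hv x with h | h
    · exact h
    · exact absurd (hx ▸ dvd_zero N) (h.1 1)
  have e2 : ∀ l, g ∣ v 2 l - v 0 l ∧ g ∣ v 3 l - v 0 l := by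
    intro l
    choose y hy using fun m => hg g hdvd l m
    have hy' : (v 2 l - v 0 l) • (v 3 - v 0) - (v 3 l - v 0 l) • (v 2 - v 0) = g • y := by
      funext m
      have := hy m
      simp only [Pi.sub_apply, Pi.smul_apply, smul_eq_mul]
      linear_combination this
    have hry : ∀ i, (v 2 l - v 0 l) * r i (v 3 - v 0) - (v 3 l - v 0 l) * r i (v 2 - v 0) =
        g * r i y := fun i => by
      have := congrArg (r i) hy'
      simpa only [map_sub (r i) (_ • _), map_smul, smul_eq_mul] using this
    simp only [hr.eval] at hry
    have hy1 : r 1 y = 0 := by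
      have := hry 1
      simp at this
      exact this.resolve_left hg0
    obtain ⟨c2, h2⟩ := hfacet y hy1 2
    obtain ⟨c3, h3⟩ := hfacet y hy1 3
    have k2 := hry 2
    have k3 := hry 3
    simp [h2, h3] at k2 k3
    constructor
    · exact ⟨c3, mul_right_cancel₀ hN.ne' (by linear_combination k3)⟩
    · exact ⟨-c2, mul_right_cancel₀ hN.ne' (by linear_combination -k2)⟩
  have hunit : IsUnit g := by
    choose y hy using fun l => (e2 l).1
    have hy' : v 2 - v 0 = g • y := funext hy
    have hry : ∀ i, r i (v 2 - v 0) = g * r i y := fun i => by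
      rw [hy', map_smul, smul_eq_mul]
    simp only [hr.eval] at hry
    have hy1 : r 1 y = 0 := by
      have := hry 1
      simp at this
      exact this.resolve_left hg0
    obtain ⟨c2, h2⟩ := hfacet y hy1 2
    have k2 := hry 2
    simp [h2] at k2
    exact IsUnit.of_mul_eq_one c2 (mul_right_cancel₀ hN.ne' (by linear_combination -k2))
  rcases Int.isUnit_iff.1 hunit with rfl | rfl
  · exact ⟨-z, by rw [map_neg, hz]⟩
  · exact ⟨z, hz⟩

theorem exists_forms (hv : IsEmptyTetra v) : ∃ N r, BaryForms v N r ∧ ∃ i : Fin 4, i ≠ 1 ∧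
    (∀ x, N ∣ r 1 x + r i x) ∧
    ∀ d : Fin 4, d ≠ 1 → ∃ p, IsCoprime p N ∧ ∀ x, N ∣ p * r 1 x + r d x := by
  obtain ⟨N, r, hr, hg⟩ := exists_baryForms hv.1
  have hN := hr.pos
  obtain ⟨z, hz⟩ := hr.exists_eq_neg_one hv hg
  refine ⟨N, r, hr, ?_⟩
  have hgen : ∀ x d, N ∣ r d z * r 1 x + r d x := by
    intro x d
    have h1 : r 1 (x + r 1 x • z) = 0 := by
      rw [map_add, map_smul, hz, smul_eq_mul]; ring
    rcases hr.dvd_or hv (x + r 1 x • z) with h | h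
    · have := h d
      rw [map_add, map_smul, smul_eq_mul] at this
      rwa [add_comm, mul_comm]
    · exact absurd (h1 ▸ dvd_zero N) (h.1 1)
  rcases (show 1 ≤ N from hN).eq_or_lt with rfl | hN1
  · exact ⟨0, by decide, fun x => one_dvd _, fun d _ =>
      ⟨0, isCoprime_one_right, fun x => one_dvd _⟩⟩
  have hmul : ∀ j, 0 < j → j < N → (∀ i, ¬ N ∣ j * r i z) ∧
      j * r 0 z % N + j * r 2 z % N + j * r 3 z % N = N + j := by
    intro j h0 hj
    rcases hr.dvd_or hv (j • z) with h | ⟨h, hs⟩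
    · have := h 1
      rw [map_smul, hz, smul_eq_mul, mul_neg_one, dvd_neg] at this
      have := Int.le_of_dvd h0 this
      omega
    · simp only [map_smul, smul_eq_mul] at h hs
      refine ⟨h, ?_⟩
      have e : j * r 1 z % N = N - j := by
        rw [hz, mul_neg_one, Int.neg_emod, if_neg, Int.natAbs_of_nonneg hN.le,
          Int.emod_eq_of_lt h0.le hj]
        intro hd
        have := Int.le_of_dvd h0 hd
        omega
      rw [e] at hs
      linarith
  have hemod : ∀ j a : ℤ, j * (a % N) % N = j * a % N := fun j a => by
    rw [Int.mul_emod, Int.emod_emod_of_dvd _ dvd_rfl, ← Int.mul_emod]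
  have hnd : ∀ i, ¬ N ∣ r i z := fun i => by simpa using (hmul 1 one_pos hN1).1 i
  obtain ⟨i, hi⟩ := eq_one_of_sum_emod (N := N) (a := ![r 0 z % N, r 2 z % N, r 3 z % N])
    (fun i => by
      have : ∀ l, 1 ≤ r l z % N := fun l =>
        lt_of_le_of_ne (Int.emod_nonneg _ hN.ne') fun h => hnd l (Int.dvd_of_emod_eq_zero h.symm)
      fin_cases i <;> exact this _)
    (fun i => by fin_cases i <;> exact Int.emod_lt_of_pos _ hN)
    (fun j h0 hj => by
      simp only [Matrix.cons_val, hemod]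
      exact (hmul j h0 hj).2)
    (fun i j h0 hj hd => by
      have : ∀ l, ¬ N ∣ j * (r l z % N) := fun l hd => (hmul j h0 hj).1 l <|
        Int.dvd_of_emod_eq_zero (by rw [← hemod]; exact Int.emod_eq_zero_of_dvd hd)
      fin_cases i <;> exact this _ hd)
  obtain ⟨l, hl, hl1⟩ : ∃ l : Fin 4, l ≠ 1 ∧ r l z % N = 1 := by
    fin_cases i
    exacts [⟨0, by decide, hi⟩, ⟨2, by decide, hi⟩, ⟨3, by decide, hi⟩]
  refine ⟨l, hl, fun x => ?_, fun d _ => ⟨r d z, ?_, fun x => hgen x d⟩⟩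
  · have h1 := hgen x l
    have h2 : N ∣ r l z - 1 := Int.dvd_of_emod_eq_zero (by
      rw [Int.sub_emod, hl1, ← Int.emod_emod_of_dvd 1 (dvd_refl N),
          Int.emod_eq_of_lt (by omega) hN1]
      simp)
    have := h1.sub (h2.mul_right (r 1 x))
    ring_nf at this ⊢
    exact this
  · rw [Int.isCoprime_iff_gcd_eq_one]
    by_contra hne
    obtain ⟨c, hc⟩ := Int.gcd_dvd_right (r d z) N
    obtain ⟨e, he⟩ := Int.gcd_dvd_left (r d z) N
    have hgp := Int.gcd_pos_of_ne_zero_right (r d z) hN.ne'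
    obtain ⟨g, hg⟩ : ∃ g : ℤ, (Int.gcd (r d z) N : ℤ) = g := ⟨_, rfl⟩
    have hg2 : 2 ≤ g := by omega
    rw [hg] at hc he
    have hc0 : 0 < c := pos_of_mul_pos_right (hc ▸ hN) (by omega)
    exact (hmul c hc0 (by nlinarith)).1 d ⟨e, by rw [he, hc]; ring⟩

end Empty

section Transport

open Matrix

variable {P Q : Matrix (Fin 3) (Fin 3) ℤ}

theorem rcast_mulVec_add (P : Matrix (Fin 3) (Fin 3) ℤ) (x t : Fin 3 → ℤ) :
    rcast (P *ᵥ x + t) = P.map (Int.cast : ℤ → ℝ) *ᵥ rcast x + rcast t := by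
  funext l
  simp [rcast, Matrix.mulVec, dotProduct]

theorem edgeDet_mulVec_add (P : Matrix (Fin 3) (Fin 3) ℤ) (t : Fin 3 → ℤ)
    (s : Fin 4 → Fin 3 → ℤ) : edgeDet (fun i => P *ᵥ s i + t) = edgeDet s * P.det := by
  rw [edgeDet, edgeDet, ← P.det_transpose, ← Matrix.det_mul]
  congr 1
  ext i j
  simp only [Matrix.of_apply, Matrix.mul_apply, Matrix.mulVec, dotProduct, Matrix.transpose_apply,
    Pi.add_apply, Fin.sum_univ_three]
  ring

/-- The affine homeomorphism of `ℝ³` induced by an invertible integer matrix and a translation. -/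
def affineHomeo (hPQ : P * Q = 1) (t : Fin 3 → ℝ) : (Fin 3 → ℝ) ≃ₜ (Fin 3 → ℝ) where
  toFun x := P.map (Int.cast : ℤ → ℝ) *ᵥ x + t
  invFun x := Q.map (Int.cast : ℤ → ℝ) *ᵥ (x - t)
  left_inv x := by
    have h : Q.map (Int.cast : ℤ → ℝ) * P.map (Int.cast : ℤ → ℝ) = 1 := by
      rw [← Matrix.map_mul_intCast, mul_eq_one_comm.1 hPQ]; simp
    beta_reduce
    rw [add_sub_cancel_right, Matrix.mulVec_mulVec, h, Matrix.one_mulVec]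
  right_inv x := by
    have h : P.map (Int.cast : ℤ → ℝ) * Q.map (Int.cast : ℤ → ℝ) = 1 := by
      rw [← Matrix.map_mul_intCast, hPQ]; simp
    beta_reduce
    rw [Matrix.mulVec_mulVec, h, Matrix.one_mulVec, sub_add_cancel]
  continuous_toFun := by fun_prop
  continuous_invFun := by fun_prop

theorem HasUnimodTriangStdBdry.map {v w : Fin 4 → Fin 3 → ℤ} {k : ℕ} {t : Fin 3 → ℤ}
    (h : HasUnimodTriangStdBdry k v) (hPQ : P * Q = 1) (σ : Equiv.Perm (Fin 4))
    (hw : ∀ j, w j = P *ᵥ v (σ j) + t) : HasUnimodTriangStdBdry k w := by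
  classical
  obtain ⟨T, h1, h2, h3, h4⟩ := h
  have hψ : ∀ t (x y : Fin 3 → ℝ) (a b : ℝ), a + b = 1 →
      affineHomeo hPQ t (a • x + b • y) = a • affineHomeo hPQ t x + b • affineHomeo hPQ t y := by
    intro t x y a b hab
    obtain rfl : b = 1 - a := by linarith
    simp only [affineHomeo, Homeomorph.homeomorph_mk_coe, Equiv.coe_fn_mk, Matrix.mulVec_add,
      Matrix.mulVec_smul]
    module
  have hcast : ∀ (x t : Fin 3 → ℤ), rcast (P *ᵥ x + t) = affineHomeo hPQ (rcast t) (rcast x) :=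
    rcast_mulVec_add P
  obtain ⟨ψ, hψ'⟩ : ∃ ψ, ψ = affineHomeo hPQ (rcast (k • t)) := ⟨_, rfl⟩
  obtain ⟨φ, hφ⟩ : ∃ φ : (Fin 3 → ℤ) → Fin 3 → ℤ, ∀ x, φ x = P *ᵥ x + k • t := ⟨_, fun _ => rfl⟩
  have hrφ : ∀ x, rcast (φ x) = ψ (rcast x) := fun x => by rw [hφ, hψ', hcast]
  have hinj : Function.Injective φ := fun x y hxy => rcast_injective <| ψ.injective <| by
    rw [← hrφ, ← hrφ, hxy]
  have hhull : ∀ A : Set (Fin 3 → ℤ), convexHull ℝ (rcast '' (φ '' A)) =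
      ψ '' convexHull ℝ (rcast '' A) := fun A => by
    rw [← image_hull (hψ' ▸ hψ _), Set.image_image, Set.image_image]
    simp only [hrφ]
  have hs : ∀ s, simplexHull (φ ∘ s) = ψ '' simplexHull s := fun s => by
    rw [simplexHull_eq, simplexHull_eq, Set.range_comp, hhull]
  have hk : (k : ℝ) • simplexHull w = ψ '' ((k : ℝ) • simplexHull v) := by
    have : simplexHull w = affineHomeo hPQ (rcast t) '' simplexHull v := by
      rw [simplexHull, simplexHull, ← image_hull (hψ _), ← Set.range_comp]
      congr 1
      rw [← σ.surjective.range_comp (affineHomeo hPQ (rcast t) ∘ fun i => rcast (v i))]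
      congr 1
      funext j
      simp only [Function.comp_apply, hw, hcast]
    rw [this, ← Set.image_smul, ← Set.image_smul, Set.image_image, Set.image_image]
    congr 1
    funext x
    have e : rcast (k • t) = (k : ℝ) • rcast t := by funext l; simp [rcast]
    rw [hψ', e]
    simp only [affineHomeo, Homeomorph.homeomorph_mk_coe, Equiv.coe_fn_mk, smul_add,
      Matrix.mulVec_smul]
  refine ⟨T.image (φ ∘ ·), ?_, ?_, ?_, ?_⟩
  · rw [hk, ← h1, Set.image_iUnion₂, Finset.set_biUnion_finset_image]
    simp only [hs]
  · intro s' hs'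
    obtain ⟨s, hsT, rfl⟩ := Finset.mem_image.1 hs'
    have e : φ ∘ s = fun i => P *ᵥ s i + k • t := funext fun i => hφ _
    have hP : P.det.natAbs = 1 := Int.natAbs_of_isUnit (by
      rw [← Matrix.isUnit_iff_isUnit_det]
      exact IsUnit.of_mul_eq_one Q hPQ)
    have := edgeDet_mulVec_add P (k • t) s
    rw [← e] at this
    change (edgeDet (φ ∘ s)).natAbs = 1
    rw [this, Int.natAbs_mul, hP, mul_one]
    exact h2 s hsT
  · intro a ha b hb
    obtain ⟨s, hsT, rfl⟩ := Finset.mem_image.1 ha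
    obtain ⟨s', hsT', rfl⟩ := Finset.mem_image.1 hb
    rw [hs, hs, ← Set.image_inter ψ.injective, h3 s hsT s' hsT', Set.range_comp, Set.range_comp,
      ← Set.image_inter hinj, hhull]
  · intro a ha i j hij hseg
    obtain ⟨s, hsT, rfl⟩ := Finset.mem_image.1 ha
    have hseg' : segment ℝ (rcast (s i)) (rcast (s j)) ⊆ frontier ((k : ℝ) • simplexHull v) := by
      rw [← Set.image_subset_image_iff ψ.injective, ψ.image_frontier, ← hk]
      refine subset_of_eq_of_subset ?_ hseg
      rw [← convexHull_pair, ← convexHull_pair, ← image_hull (hψ' ▸ hψ _), Set.image_pair,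
        Function.comp_apply, Function.comp_apply, hrφ, hrφ]
    obtain ⟨a, b, c, hab, e⟩ := h4 s hsT i j hij hseg'
    refine ⟨σ.symm a, σ.symm b, c, σ.symm.injective.ne hab, ?_⟩
    rw [Function.comp_apply, Function.comp_apply, hφ, hφ, hw, hw, rcast_mulVec_add,
      rcast_mulVec_add, rcast_mulVec_add, rcast_mulVec_add, add_sub_add_right_eq_sub,
      add_sub_add_right_eq_sub, ← Matrix.mulVec_sub, ← Matrix.mulVec_sub, e, Matrix.mulVec_smul,
      σ.apply_symm_apply, σ.apply_symm_apply]

end Transport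

section NormalForm

open Matrix

variable {v : Fin 4 → Fin 3 → ℤ}

theorem abs_edgeDet_swap (v : Fin 4 → Fin 3 → ℤ) (i : Fin 4) :
    |edgeDet (v ∘ Equiv.swap 0 i)| = |edgeDet v| := by
  have e : ∀ u : Fin 4 → Fin 3 → ℤ, u = ![u 0, u 1, u 2, u 3] := fun u => by
    funext j; fin_cases j <;> rfl
  rw [e (v ∘ _), e v, edgeDet_vec, edgeDet_vec]
  rw [abs_eq_abs]
  fin_cases i
  · left; rfl
  all_goals
    right
    simp [Equiv.swap_apply_def]
    ring

/-- Every empty lattice tetrahedron is unimodularly equivalent to some `nfTetra q p`. -/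
theorem exists_nfTetra (hv : IsEmptyTetra v) : ∃ q p : ℤ, 0 < q ∧ IsCoprime p q ∧
    ∃ (P Q : Matrix (Fin 3) (Fin 3) ℤ) (σ : Equiv.Perm (Fin 4)) (t : Fin 3 → ℤ),
      P * Q = 1 ∧ ∀ j, nfTetra q p j = P *ᵥ v (σ j) + t := by
  obtain ⟨N, r, hr, i, hi, hri, hd⟩ := exists_forms hv
  have hN := hr.pos
  obtain ⟨σ, hσ⟩ : ∃ σ : Equiv.Perm (Fin 4), σ = Equiv.swap 0 i := ⟨_, rfl⟩
  have σ1 : σ 1 = 1 := by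
    rw [hσ]
    exact Equiv.swap_apply_of_ne_of_ne (by decide) hi.symm
  have σ0 : σ 0 = i := by rw [hσ]; exact Equiv.swap_apply_left _ _
  obtain ⟨p, hp, h3⟩ := hd (σ 3) fun h => absurd (σ.injective (h.trans σ1.symm)) (by decide)
  have h2 : ∀ x, N ∣ r (σ 2) x + r (σ 3) x := by
    intro x
    have e : r (σ 0) x + r (σ 1) x + r (σ 2) x + r (σ 3) x = 0 := by
      rw [← hr.sum x, ← Fin.sum_univ_four (fun l => r l x),
          ← Fin.sum_univ_four (fun l => r (σ l) x)]
      exact Equiv.sum_comp σ fun l => r l x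
    rw [σ0, σ1] at e
    have := (hri x).neg_right
    rwa [show -(r 1 x + r i x) = r (σ 2) x + r (σ 3) x by linarith] at this
  have hev : ∀ m j, r (σ m) (v (σ j) - v (σ 0)) =
      N * ((if m = j then 1 else 0) - (if m = 0 then 1 else 0)) := by
    intro m j
    rw [← sub_sub_sub_cancel_right (v (σ j)) (v (σ 0)) (v 0), map_sub, hr.eval, hr.eval]
    simp only [σ.injective.eq_iff]
    ring
  choose f hf using h3
  choose g hg using h2
  obtain ⟨P, hP⟩ : ∃ P : Matrix (Fin 3) (Fin 3) ℤ, P = Matrix.of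
      ![fun l => r 1 (Pi.single l 1), fun l => f (Pi.single l 1), fun l => g (Pi.single l 1)] :=
    ⟨_, rfl⟩
  have hlin : ∀ m x, r m x = x 0 * r m (Pi.single 0 1) + x 1 * r m (Pi.single 1 1) +
      x 2 * r m (Pi.single 2 1) := by
    intro m x
    rw [LinearMap.pi_apply_eq_sum_univ (r m) x, Fin.sum_univ_three]
    simp only [smul_eq_mul]
    congr <;> funext j <;> simp [Pi.single_apply, eq_comm]
  have hP0 : ∀ x, (P *ᵥ x) 0 = r 1 x := fun x => by
    rw [hlin]
    simp [hP, Matrix.mulVec, dotProduct, Fin.sum_univ_three]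
    ring
  have hP1 : ∀ x, N * (P *ᵥ x) 1 = p * r 1 x + r (σ 3) x := fun x => by
    rw [hlin, hlin (σ 3)]
    simp [hP, Matrix.mulVec, dotProduct, Fin.sum_univ_three]
    linear_combination -x 0 * hf (Pi.single 0 1) - x 1 * hf (Pi.single 1 1) -
      x 2 * hf (Pi.single 2 1)
  have hP2 : ∀ x, N * (P *ᵥ x) 2 = r (σ 2) x + r (σ 3) x := fun x => by
    rw [hlin, hlin (σ 3)]
    simp [hP, Matrix.mulVec, dotProduct, Fin.sum_univ_three]
    linear_combination -x 0 * hg (Pi.single 0 1) - x 1 * hg (Pi.single 1 1) -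
      x 2 * hg (Pi.single 2 1)
  have hnf : ∀ j, nfTetra N p j = P *ᵥ v (σ j) + -(P *ᵥ v (σ 0)) := by
    intro j
    rw [← sub_eq_add_neg, ← Matrix.mulVec_sub]
    have e0 := hP0 (v (σ j) - v (σ 0))
    have e1 := hP1 (v (σ j) - v (σ 0))
    have e2 := hP2 (v (σ j) - v (σ 0))
    have e3 := hev 1 j
    rw [σ1] at e3
    rw [e3] at e0 e1
    rw [hev] at e1 e2
    rw [hev] at e2
    funext l
    refine mul_left_cancel₀ hN.ne' ?_
    fin_cases l
    · simp only [Fin.zero_eta]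
      rw [e0]
      fin_cases j <;> simp [nfTetra]
    · simp only [Fin.mk_one]
      rw [e1]
      fin_cases j <;> simp [nfTetra, mul_comm]
    · simp only [Fin.reduceFinMk]
      rw [e2]
      fin_cases j <;> simp [nfTetra]
  have hunit : IsUnit P.det := by
    have e := edgeDet_mulVec_add P (-(P *ᵥ v (σ 0))) (v ∘ σ)
    have e' : (fun i => P *ᵥ (v ∘ σ) i + -(P *ᵥ v (σ 0))) = nfTetra N p :=
      funext fun j => (hnf j).symm
    rw [e', nfTetra, edgeDet_vec] at e
    have hdet := abs_edgeDet_swap v i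
    rw [← hσ, hr.det] at hdet
    simp at e
    have := congrArg abs e
    rw [abs_neg, abs_mul, hdet, abs_of_pos hN] at this
    refine Int.isUnit_iff_abs_eq.2 (mul_left_cancel₀ hN.ne' ?_)
    rw [mul_one]
    exact this.symm
  exact ⟨N, p, hN, hp, P, P⁻¹, σ, _, Matrix.mul_nonsing_inv _ hunit, hnf⟩

end NormalForm

/-- The set of `k` such that `kΔ` has a unimodular triangulation with
standard boundary for every empty lattice tetrahedron `Δ` is closed under addition. -/
theorem std_bdry_triangulation_add
    (k₁ k₂ : ℕ)
    (h₁ : ∀ v : Fin 4 → Fin 3 → ℤ, IsEmptyTetra v → HasUnimodTriangStdBdry k₁ v)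
    (h₂ : ∀ v : Fin 4 → Fin 3 → ℤ, IsEmptyTetra v → HasUnimodTriangStdBdry k₂ v) :
    ∀ v : Fin 4 → Fin 3 → ℤ, IsEmptyTetra v → HasUnimodTriangStdBdry (k₁ + k₂) v := by
  intro v hv
  obtain ⟨q, p, hq, hpq, P, Q, σ, t, hPQ, hP⟩ := exists_nfTetra hv
  refine (hasUnimodTriangStdBdry_nf_add hq hpq ((h₁ v hv).map hPQ σ hP)
    ((h₂ v hv).map hPQ σ hP)).map (t := -Q.mulVec t) (mul_eq_one_comm.1 hPQ) σ.symm fun j => ?_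
  rw [hP, σ.apply_symm_apply, Matrix.mulVec_add, Matrix.mulVec_mulVec, mul_eq_one_comm.1 hPQ,
    Matrix.one_mulVec, add_neg_cancel_right]
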